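/- There exists a smooth (C^∞) nonvanishing vector field on the 3-sphere S³ with no periodic orbit. Extrinsically: there is a smooth map X : S³ → ℝ⁴ such that for every p ∈ S³ one has ⟨X p, p⟩ = 0 and X p ≠ 0, and there is no nonconstant differentiable curve γ : ℝ → ℝ⁴ with γ(t) ∈ S³ and γ′(t) = X(γ(t)) for all t which satisfies γ(t+T) = γ(t) for all t for some T > 0. (Kuperberg's counterexample to the Seifert Conjecture.) -/

import Mathlib

/-- Data attached to a bi-infinite sequence of crossings of the boundary of a plug: crossing `k`
is an entry or an exit, `inn k` and `out k` describe it as seen from inside and from outside,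
and `R` is reachability along trajectories. -/
structure CrossingData {Y : Type*} (R : Y → Y → Prop) (ent : ℤ → Prop) (inn out : ℤ → Y)
    (rad : ℤ → ℝ) : Prop where
  trans : ∀ {a b c}, R a b → R b c → R a c
  arc_ee : ∀ k, ent k → ent (k + 1) → R (inn k) (out (k + 1))
  arc_ex : ∀ k, ent k → ¬ ent (k + 1) → R (inn k) (inn (k + 1))
  arc_xe : ∀ k, ¬ ent k → ent (k + 1) → R (out k) (out (k + 1))
  arc_xx : ∀ k, ¬ ent k → ¬ ent (k + 1) → R (out k) (inn (k + 1))
  match_ends : ∀ k l, ent k → ¬ ent l → R (inn k) (inn l) → R (out k) (out l)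
  rad_lt : ∀ k l, ent k → ent l → R (inn k) (out l) → rad k < rad l
  rad_lt' : ∀ k l, ¬ ent k → ¬ ent l → R (out k) (inn l) → rad l < rad k
  no_cycle : ∀ k l, ent k → ¬ ent l → R (inn k) (inn l) → R (out l) (out k) → False

namespace CrossingData

variable {Y : Type*} {R : Y → Y → Prop} {ent : ℤ → Prop} {inn out : ℤ → Y} {rad : ℤ → ℝ}

theorem reverse (h : CrossingData R ent inn out rad) :
    CrossingData (fun a b => R b a) (fun k => ¬ ent (-k)) (fun k => inn (-k))
      (fun k => out (-k)) (fun k => rad (-k)) := by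
  have e : ∀ k : ℤ, -(k + 1) + 1 = -k := fun k => by ring
  refine ⟨fun h1 h2 => h.trans h2 h1, fun k h1 h2 => ?_, fun k h1 h2 => ?_, fun k h1 h2 => ?_,
    fun k h1 h2 => ?_, fun k l h1 h2 h3 => ?_, fun k l h1 h2 h3 => ?_, fun k l h1 h2 h3 => ?_,
    fun k l h1 h2 h3 h4 => ?_⟩
  · have := h.arc_xx (-(k + 1)) h2 (by rwa [e]); rwa [e] at this
  · have := h.arc_ex (-(k + 1)) (not_not.1 h2) (by rwa [e]); rwa [e] at this
  · have := h.arc_xe (-(k + 1)) h2 (by rw [e]; exact not_not.1 h1); rwa [e] at this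
  · have := h.arc_ee (-(k + 1)) (not_not.1 h2) (by rw [e]; exact not_not.1 h1); rwa [e] at this
  · exact h.match_ends _ _ (not_not.1 h2) h1 h3
  · exact h.rad_lt' _ _ h2 h1 h3
  · exact h.rad_lt _ _ (not_not.1 h2) (not_not.1 h1) h3
  · exact h.no_cycle _ _ (not_not.1 h2) h1 h3 h4

/-- The height function counts entries minus exits. -/
def IsHeight (ent : ℤ → Prop) (H : ℤ → ℤ) : Prop :=
  ∀ k, (ent k → H (k + 1) = H k + 1) ∧ (¬ ent k → H (k + 1) = H k - 1)

theorem exists_isHeight (ent : ℤ → Prop) : ∃ H, IsHeight ent H := by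
  classical
  let s : ℤ → ℤ := fun k => if ent k then 1 else -1
  let H : ℤ → ℤ := fun k => ∑ j ∈ Finset.range k.toNat, s j -
    ∑ j ∈ Finset.range (-k).toNat, s (-(j : ℤ) - 1)
  have key : ∀ k, H (k + 1) = H k + s k := by
    intro k
    rcases le_or_gt 0 k with hk | hk
    · obtain ⟨m, rfl⟩ := Int.eq_ofNat_of_zero_le hk
      have h1 : ((m : ℤ) + 1).toNat = m + 1 := by lia
      have h2 : (-((m : ℤ) + 1)).toNat = 0 := by lia
      have h3 : (-(m : ℤ)).toNat = 0 := by lia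
      simp only [H, h1, h2, h3, Int.toNat_natCast, Finset.sum_range_succ, Finset.range_zero,
        Finset.sum_empty]
      ring
    · obtain ⟨m, hm⟩ := Int.eq_ofNat_of_zero_le (show 0 ≤ -k - 1 by lia)
      obtain rfl : k = -(m : ℤ) - 1 := by lia
      have h1 : (-(m : ℤ) - 1 + 1).toNat = 0 := by lia
      have h2 : (-(-(m : ℤ) - 1 + 1)).toNat = m := by lia
      have h3 : (-(m : ℤ) - 1).toNat = 0 := by lia
      have h4 : (-(-(m : ℤ) - 1)).toNat = m + 1 := by lia
      simp only [H, h1, h2, h3, h4, Finset.sum_range_succ, Finset.range_zero,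
        Finset.sum_empty]
      ring
  exact ⟨H, fun k => ⟨fun h => by rw [key]; simp [s, h], fun h => by rw [key]; simp [s, h]; ring⟩⟩

theorem IsHeight.drift {H : ℤ → ℤ} (hH : IsHeight ent H) {n : ℤ}
    (hp : ∀ k, ent (k + n) ↔ ent k) (k : ℤ) : H (k + n) = H k + (H n - H 0) := by
  induction k using Int.induction_on with
  | zero => simp
  | succ i ih =>
    by_cases h : ent i
    · rw [show (i : ℤ) + 1 + n = i + n + 1 by ring, (hH _).1 ((hp _).2 h), (hH _).1 h, ih]; ring
    · rw [show (i : ℤ) + 1 + n = i + n + 1 by ring, (hH _).2 (mt (hp _).1 h), (hH _).2 h, ih]; ring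
  | pred i ih =>
    have h1 := hH (-(i : ℤ) - 1)
    have h2 := hH (-(i : ℤ) - 1 + n)
    rw [show -(i : ℤ) - 1 + 1 = -i by ring] at h1
    rw [show -(i : ℤ) - 1 + n + 1 = -i + n by ring, hp] at h2
    by_cases h : ent (-(i : ℤ) - 1)
    · have := h1.1 h; have := h2.1 h; lia
    · have := h1.2 h; have := h2.2 h; lia

/-- Every block on which the height stays above its initial value and returns to it joins
`out` to `out`. The first sub-block moreover joins `inn` to `inn`. -/
theorem balanced (h : CrossingData R ent inn out rad) {H : ℤ → ℤ} (hH : IsHeight ent H) (d : ℕ) :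
    ∀ i j : ℤ, j = i + d → i < j → H j = H i → (∀ k, i ≤ k → k ≤ j → H i ≤ H k) →
      R (out i) (out (j - 1)) ∧ ∃ m, i < m ∧ m ≤ j ∧ H m = H i ∧ ¬ ent (m - 1) ∧
        R (inn i) (inn (m - 1)) ∧ (m < j → R (out m) (out (j - 1))) := by
  induction d using Nat.strong_induction_on with
  | _ d ih =>
  intro i j hd hij hHj hk
  have hent : ∀ k, H k < H (k + 1) → ent k := fun k hlt => by
    by_contra hc; have := (hH k).2 hc; lia
  have hext : ∀ k, H (k + 1) < H k → ¬ ent k := fun k hlt hc => by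
    have := (hH k).1 hc; lia
  have hstep : ∀ k, H (k + 1) = H k + 1 ∨ H (k + 1) = H k - 1 := fun k => by
    by_cases hc : ent k
    · exact Or.inl ((hH k).1 hc)
    · exact Or.inr ((hH k).2 hc)
  have hei : ent i := hent i (by have := hk (i + 1) (by lia) (by lia); rcases hstep i <;> lia)
  obtain ⟨m, ⟨hm1, hm2⟩, hmin⟩ := Int.exists_least_of_bdd (P := fun m => i < m ∧ H m = H i)
    ⟨i, fun z hz => hz.1.le⟩ ⟨j, hij, hHj⟩
  have hmj : m ≤ j := hmin j ⟨hij, hHj⟩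
  have hbig : ∀ k, i < k → k < m → H i + 1 ≤ H k := fun k h1 h2 => by
    have h3 := hk k h1.le (by lia)
    by_contra hc
    have := hmin k ⟨h1, by lia⟩
    lia
  have hi1 := (hH i).1 hei
  have him : i + 2 ≤ m := by
    by_contra hc
    obtain rfl : m = i + 1 := by lia
    lia
  have hxm : ¬ ent (m - 1) := hext (m - 1) (by
    have := hbig (m - 1) (by lia) (by lia)
    rw [show m - 1 + 1 = m by ring]; lia)
  have hinn : R (inn i) (inn (m - 1)) := by
    rcases eq_or_lt_of_le him with he | hl
    · subst he
      have := h.arc_ex i hei (by rwa [show i + 2 - 1 = i + 1 by ring] at hxm)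
      rwa [show i + 2 - 1 = i + 1 by ring]
    · have hHm1 : H (m - 1) = H i + 1 := by
        have := (hH (m - 1)).2 hxm
        rw [show m - 1 + 1 = m by ring] at this; lia
      obtain ⟨hb, -⟩ := ih ((m - 2 - i).toNat) (by lia) (i + 1) (m - 1) (by lia) (by lia)
        (by lia) (fun k h1 h2 => by rw [hi1]; exact hbig k (by lia) (by lia))
      have he1 : ent (i + 1) := hent _ (by
        have h5 := hstep (i + 1)
        have h6 : H i + 1 ≤ H (i + 1 + 1) := by
          exact hbig _ (by lia) (by
            rcases eq_or_lt_of_le (show i + 1 + 1 ≤ m by lia) with h7 | h7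
            · lia
            · exact h7)
        lia)
      have hx2 : ¬ ent (m - 1 - 1) := fun hc => by
        have := (hH (m - 1 - 1)).1 hc
        rw [show m - 1 - 1 + 1 = m - 1 by ring] at this
        have := hbig (m - 1 - 1) (by lia) (by lia)
        lia
      have h1 := h.arc_ee i hei he1
      have h2 := h.arc_xx (m - 1 - 1) hx2 (by rwa [show m - 1 - 1 + 1 = m - 1 by ring])
      rw [show m - 1 - 1 + 1 = m - 1 by ring] at h2
      exact h.trans h1 (h.trans hb h2)
  have hout := h.match_ends _ _ hei hxm hinn
  have hrest : m < j → R (out m) (out (j - 1)) := fun hlt =>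
    (ih ((j - m).toNat) (by lia) m j (by lia) hlt (by lia)
      (fun k h1 h2 => by rw [hm2]; exact hk k (by lia) h2)).1
  refine ⟨?_, m, hm1, hmj, hm2, hxm, hinn, hrest⟩
  rcases eq_or_lt_of_le hmj with he | hl
  · rwa [← he]
  · have hem : ent m := hent m (by have := hk (m + 1) (by lia) (by lia); rcases hstep m <;> lia)
    have h2 := h.arc_xe (m - 1) hxm (by rwa [show m - 1 + 1 = m by ring])
    rw [show m - 1 + 1 = m by ring] at h2
    exact h.trans hout (h.trans h2 (hrest hl))

theorem false_of_drift_eq_zero (h : CrossingData R ent inn out rad) {H : ℤ → ℤ}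
    (hH : IsHeight ent H) {n : ℤ} (hn : 0 < n) (hout : ∀ k, out (k + n) = out k)
    (hD : ∀ k, H (k + n) = H k) : False := by
  obtain ⟨c, -, hmin⟩ := Finset.exists_min_image (Finset.Ico 0 n) H ⟨0, by simp [hn]⟩
  have hper : ∀ k, H k = H (k % n) := fun k => by
    have := (show Function.Periodic H n from hD).sub_int_mul_eq (k / n) (x := k)
    simpa [Int.emod_def, mul_comm] using this.symm
  have hall : ∀ k, H c ≤ H k := fun k => by
    rw [hper k]
    exact hmin _ (Finset.mem_Ico.2 ⟨Int.emod_nonneg _ hn.ne', Int.emod_lt_of_pos _ hn⟩)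
  obtain ⟨-, m, hm1, hm2, hm3, hm4, hm5, hm6⟩ := h.balanced hH n.toNat c (c + n) (by lia) (by lia)
    (hD c) (fun k _ _ => hall k)
  have hent : ∀ k, H k = H c → ent k := fun k hk => by
    by_contra hx
    have := (hH k).2 hx
    have := hall (k + 1)
    lia
  have key : ∀ j, H j = H c → ¬ ent (j - 1) → R (out (j - 1)) (out j) := fun j hj hx => by
    have := h.arc_xe (j - 1) hx (by rw [show j - 1 + 1 = j by ring]; exact hent j hj)
    rwa [show j - 1 + 1 = j by ring] at this
  have hxn : ¬ ent (c + n - 1) := fun hx => by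
    have h1 := (hH _).1 hx
    rw [show c + n - 1 + 1 = c + n by ring, hD] at h1
    have := hall (c + n - 1)
    lia
  refine h.no_cycle c (m - 1) (hent c rfl) hm4 hm5 ?_
  rw [← hout c]
  rcases eq_or_lt_of_le hm2 with he | hl
  · rw [he]; exact key _ (hD c) hxn
  · exact h.trans (key m hm3 hm4) (h.trans (hm6 hl) (key _ (hD c) hxn))

theorem false_of_drift_pos (h : CrossingData R ent inn out rad) {H : ℤ → ℤ}
    (hH : IsHeight ent H) {n : ℤ} (hn : 0 < n) (hrad : ∀ k, rad (k + n) = rad k)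
    {D : ℤ} (hD0 : 0 < D) (hD : ∀ k, H (k + n) = H k + D) : False := by
  have hmul : ∀ (q : ℕ) k, H (k + q * n) = H k + q * D := fun q k => by
    induction q with
    | zero => simp
    | succ q ih =>
      rw [show k + ((q + 1 : ℕ) : ℤ) * n = k + q * n + n by push_cast; ring, hD, ih]
      push_cast; ring
  obtain ⟨c, -, hmin⟩ := Finset.exists_min_image (Finset.Ico 0 n) H ⟨0, by simp [hn]⟩
  have hbdd : ∀ b : ℤ, ∃ B, ∀ k, H k ≤ b → k ≤ B := fun b => by
    refine ⟨n * ((b - H c).toNat + 1), fun k hk => ?_⟩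
    by_contra! hlt
    have h1 := Int.mul_ediv_add_emod k n
    have h2 : H c ≤ H (k % n) :=
      hmin _ (Finset.mem_Ico.2 ⟨Int.emod_nonneg _ hn.ne', Int.emod_lt_of_pos _ hn⟩)
    have h3 : ((b - H c).toNat : ℤ) + 1 ≤ k / n := by
      rw [Int.le_ediv_iff_mul_le hn]; linarith
    obtain ⟨q, hq⟩ := Int.eq_ofNat_of_zero_le (show 0 ≤ k / n by lia)
    rw [hq] at h1 h3
    have h4 := hmul q (k % n)
    rw [show k % n + q * n = k by linarith] at h4
    have h5 : (q : ℤ) * 1 ≤ q * D := mul_le_mul_of_nonneg_left (by lia) (by lia)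
    lia
  have hladder : ∀ b : ℤ, ∀ k, H k ≤ b → ∃ i, k ≤ i ∧ H i ≤ b ∧ ∀ k, i < k → b < H k := by
    intro b k hk
    obtain ⟨i, hi, hmax⟩ := Int.exists_greatest_of_bdd (hbdd b) ⟨k, hk⟩
    exact ⟨i, hmax k hk, hi, fun k hik => by
      by_contra! hc; have := hmax k hc; lia⟩
  have hlad : ∀ i, (∀ k, i < k → H i < H k) → ∃ j, (∀ k, j < k → H j < H k) ∧ rad i < rad j := by
    intro i hi
    have hext : ∀ i, (∀ k, i < k → H i < H k) → ent i := fun i hi => by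
      by_contra hx
      have := (hH i).2 hx
      have := hi (i + 1) (by lia)
      lia
    have hei := hext i hi
    have hi1 := (hH i).1 hei
    obtain ⟨j, hj1, hj2, hj3⟩ := hladder (H i + 1) (i + 1) hi1.le
    have hj4 : H j = H i + 1 := by have := hi j (by lia); lia
    have hj5 : ∀ k, j < k → H j < H k := fun k hk => by rw [hj4]; exact hj3 k hk
    have hej := hext j hj5
    refine ⟨j, hj5, h.rad_lt i j hei hej ?_⟩
    rcases eq_or_lt_of_le hj1 with he | hl
    · subst he; exact h.arc_ee i hei hej
    · obtain ⟨hb, -⟩ := h.balanced hH (j - i - 1).toNat (i + 1) j (by lia) hl (by lia)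
        (fun k h1 h2 => by have := hi k (by lia); lia)
      have he1 : ent (i + 1) := by
        by_contra hx
        have := (hH _).2 hx
        have := hi (i + 1 + 1) (by lia)
        lia
      have hxj : ¬ ent (j - 1) := fun hx => by
        have h1 := (hH _).1 hx
        rw [show j - 1 + 1 = j by ring] at h1
        have := hi (j - 1) (by lia)
        lia
      have h2 := h.arc_xe (j - 1) hxj (by rwa [show j - 1 + 1 = j by ring])
      rw [show j - 1 + 1 = j by ring] at h2
      exact h.trans (h.arc_ee i hei he1) (h.trans hb h2)
  have hfin : (Set.range rad).Finite := by
    refine ((Set.finite_Ico (0 : ℤ) n).image rad).subset ?_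
    rintro _ ⟨k, rfl⟩
    refine ⟨k % n, ⟨Int.emod_nonneg _ hn.ne', Int.emod_lt_of_pos _ hn⟩, ?_⟩
    have := (show Function.Periodic rad n from hrad).sub_int_mul_eq (k / n) (x := k)
    simpa [Int.emod_def, mul_comm] using this
  obtain ⟨i0, -, h1, h2⟩ := hladder (H 0) 0 le_rfl
  have hne : (rad '' {i | ∀ k, i < k → H i < H k}).Nonempty :=
    ⟨_, i0, fun k hk => lt_of_le_of_lt h1 (h2 k hk), rfl⟩
  obtain ⟨_, ⟨i, hi, rfl⟩, hmax⟩ := Set.exists_max_image _ id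
    (hfin.subset (Set.image_subset_range _ _)) hne
  obtain ⟨j, hj, hlt⟩ := hlad i hi
  exact absurd (hmax _ ⟨j, hj, rfl⟩) (not_le.2 hlt)

/-- Periodic crossing data do not exist. -/
theorem not_periodic (h : CrossingData R ent inn out rad) {n : ℤ} (hn : 0 < n)
    (hent : ∀ k, ent (k + n) ↔ ent k) (hout : ∀ k, out (k + n) = out k)
    (hrad : ∀ k, rad (k + n) = rad k) : False := by
  obtain ⟨H, hH⟩ := exists_isHeight ent
  have hD := hH.drift hent
  rcases lt_trichotomy 0 (H n - H 0) with hpos | hz | hneg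
  · exact h.false_of_drift_pos hH hn hrad hpos hD
  · exact h.false_of_drift_eq_zero hH hn hout (fun k => by rw [hD]; lia)
  · refine h.reverse.false_of_drift_pos (H := fun k => H (-k + 1)) (D := H 0 - H n)
      (fun k => ⟨fun hk => ?_, fun hk => ?_⟩) hn
      (fun k => ?_) (by lia) (fun k => ?_)
    · have := (hH (-k)).2 hk
      simp only [show -(k + 1) + 1 = -k by ring]; lia
    · have := (hH (-k)).1 (not_not.1 hk)
      simp only [show -(k + 1) + 1 = -k by ring]; lia
    · rw [← hrad (-(k + n)), show -(k + n) + n = -k by ring]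
    · have := hD (-(k + n) + 1)
      rw [show -(k + n) + 1 + n = -k + 1 by ring] at this
      lia

end CrossingData

namespace Kuperberg

open Set Filter Topology

/-- A property that is open and closed along a connected open set of times, and holds once,
holds throughout. -/
theorem connected_induction {s : Set ℝ} (hs : IsOpen s) (hc : IsPreconnected s) {p : ℝ → Prop}
    {t₀ : ℝ} (ht₀ : t₀ ∈ s) (h₀ : p t₀) (hop : ∀ t ∈ s, p t → ∀ᶠ u in 𝓝 t, p u)
    (hcl : ∀ t ∈ s, (∃ᶠ u in 𝓝 t, p u) → p t) : ∀ t ∈ s, p t := by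
  have hsub : s ⊆ {t | t ∈ s ∧ p t} := by
    refine hc.subset_of_closure_inter_subset ?_ ⟨t₀, ht₀, ht₀, h₀⟩ ?_
    · rw [isOpen_iff_mem_nhds]
      rintro t ⟨h1, h2⟩
      filter_upwards [hs.mem_nhds h1, hop t h1 h2] with u h3 h4 using ⟨h3, h4⟩
    · rintro t ⟨h1, h2⟩
      rw [mem_closure_iff_frequently] at h1
      exact ⟨h2, hcl t h2 (h1.mono fun u hu => hu.2)⟩
  exact fun t ht => (hsub ht).2

variable {E : Type*} [NormedAddCommGroup E] [NormedSpace ℝ E]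

theorem eventually_eq_of_hasDerivAt {F : E → E} (hF : ContDiff ℝ 1 F) {f g : ℝ → E} {t₀ : ℝ}
    (hf : ∀ᶠ t in 𝓝 t₀, HasDerivAt f (F (f t)) t) (hg : ∀ᶠ t in 𝓝 t₀, HasDerivAt g (F (g t)) t)
    (h : f t₀ = g t₀) : f =ᶠ[𝓝 t₀] g := by
  obtain ⟨K, s, hs, hK⟩ := (hF.contDiffAt (x := f t₀)).exists_lipschitzOnWith
  refine ODE_solution_unique_of_eventually (v := fun _ => F) (s := fun _ => s) (K := K)
    (Eventually.of_forall fun _ => hK) ?_ ?_ h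
  · exact hf.and (hf.self_of_nhds.continuousAt.eventually_mem hs)
  · rw [h] at hs
    exact hg.and (hg.self_of_nhds.continuousAt.eventually_mem hs)

theorem eqOn_of_hasDerivAt {F : E → E} (hF : ContDiff ℝ 1 F) {f g : ℝ → E} {s : Set ℝ}
    (hs : IsOpen s) (hc : IsPreconnected s) (hf : ∀ t ∈ s, HasDerivAt f (F (f t)) t)
    (hg : ∀ t ∈ s, HasDerivAt g (F (g t)) t) {t₀ : ℝ} (ht₀ : t₀ ∈ s) (h : f t₀ = g t₀) :
    ∀ t ∈ s, f t = g t := by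
  refine connected_induction hs hc ht₀ h (fun t ht hft => ?_) (fun t ht hfr => ?_)
  · exact eventually_eq_of_hasDerivAt hF
      (by filter_upwards [hs.mem_nhds ht] with u hu using hf u hu)
      (by filter_upwards [hs.mem_nhds ht] with u hu using hg u hu) hft
  · by_contra hne
    have hcont : ContinuousAt (fun u => f u - g u) t :=
      (hf t ht).continuousAt.sub (hg t ht).continuousAt
    have := hcont.eventually_ne (sub_ne_zero.2 hne)
    obtain ⟨u, hu1, hu2⟩ := (hfr.and_eventually this).exists
    exact hu2 (sub_eq_zero.2 hu1)

/-- `f` is a global solution of the autonomous equation with right-hand side `F`. -/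
def IsSol (F : E → E) (f : ℝ → E) : Prop := ∀ t, HasDerivAt f (F (f t)) t

theorem IsSol.unique {F : E → E} (hF : ContDiff ℝ 1 F) {f g : ℝ → E} (hf : IsSol F f)
    (hg : IsSol F g) {t₀ : ℝ} (h : f t₀ = g t₀) : f = g :=
  funext fun t => eqOn_of_hasDerivAt hF isOpen_univ isPreconnected_univ (fun t _ => hf t)
    (fun t _ => hg t) (mem_univ t₀) h t (mem_univ t)

theorem IsSol.comp_add {F : E → E} {f : ℝ → E} (hf : IsSol F f) (c : ℝ) :
    IsSol F (fun t => f (t + c)) := fun t => by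
  simpa using (hf (t + c)).comp_add_const t c

theorem IsSol.continuous {F : E → E} {f : ℝ → E} (hf : IsSol F f) : Continuous f :=
  continuous_iff_continuousAt.2 fun t => (hf t).continuousAt

theorem exists_isSol [FiniteDimensional ℝ E] {F : E → E} (hF : ContDiff ℝ 1 F) {M : ℝ}
    (hM : ∀ x, ‖F x‖ ≤ M) (t₀ : ℝ) (x₀ : E) : ∃ f, f t₀ = x₀ ∧ IsSol F f := by
  have : CompleteSpace E := FiniteDimensional.complete ℝ E
  have : ProperSpace E := FiniteDimensional.proper ℝ E
  have hM0 : 0 ≤ M := (norm_nonneg _).trans (hM x₀)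
  have hloc : ∀ n : ℕ, ∃ f : ℝ → E, f 0 = x₀ ∧
      ∀ t ∈ Ioo (-(n + 1 : ℝ)) (n + 1), HasDerivAt f (F (f t)) t := by
    intro n
    have hn : (0 : ℝ) < n + 1 := by positivity
    let a : NNReal := ⟨M * (n + 1), by positivity⟩
    obtain ⟨K, hK⟩ := hF.contDiffOn.exists_lipschitzOnWith one_ne_zero
      (convex_closedBall x₀ a) (isCompact_closedBall x₀ a)
    have hpl : IsPicardLindelof (fun _ => F) (tmin := -(n + 1 : ℝ)) (tmax := n + 1)
        ⟨0, by constructor <;> linarith⟩ x₀ a 0 ⟨M, hM0⟩ K :=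
      IsPicardLindelof.of_time_independent (fun x _ => hM x) hK (by
        simp only [sub_zero, zero_sub, neg_neg, max_self, a, NNReal.coe_zero]
        exact le_rfl)
    obtain ⟨f, hf0, hf⟩ := hpl.exists_eq_forall_mem_Icc_hasDerivWithinAt₀
    exact ⟨f, hf0, fun t ht => (hf t (Ioo_subset_Icc_self ht)).hasDerivAt (Icc_mem_nhds ht.1 ht.2)⟩
  choose f hf0 hf using hloc
  have hagree : ∀ n m : ℕ, n ≤ m → ∀ t ∈ Ioo (-(n + 1 : ℝ)) (n + 1), f n t = f m t := by
    intro n m hnm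
    have hc : (n : ℝ) ≤ m := by exact_mod_cast hnm
    have hn : (0 : ℝ) ≤ n := n.cast_nonneg
    exact eqOn_of_hasDerivAt hF isOpen_Ioo isPreconnected_Ioo (hf n)
      (fun t ht => hf m t ⟨by linarith [ht.1], by linarith [ht.2]⟩)
      (t₀ := 0) ⟨by linarith, by linarith⟩ ((hf0 n).trans (hf0 m).symm)
  have habs : ∀ {n : ℕ} {t : ℝ}, |t| < n + 1 → t ∈ Ioo (-(n + 1 : ℝ)) (n + 1) := fun h =>
    abs_lt.1 h
  let g : ℝ → E := fun t => f ⌈|t|⌉₊ t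
  have hg : ∀ n : ℕ, ∀ t : ℝ, |t| < n + 1 → g t = f n t := by
    intro n t ht
    have h1 : |t| < (⌈|t|⌉₊ : ℝ) + 1 := (Nat.le_ceil _).trans_lt (lt_add_one _)
    rcases le_total n ⌈|t|⌉₊ with h | h
    · exact (hagree _ _ h t (habs ht)).symm
    · exact hagree _ _ h t (habs h1)
  have hgsol : IsSol F g := by
    intro t
    have h1 : |t| < (⌈|t|⌉₊ : ℝ) + 1 := (Nat.le_ceil _).trans_lt (lt_add_one _)
    have h2 := hf _ t (habs h1)
    rw [← hg _ t h1] at h2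
    refine h2.congr_of_eventuallyEq ?_
    filter_upwards [(continuous_abs.tendsto t).eventually_lt_const h1] with u hu using hg _ u hu
  refine ⟨fun t => g (t + -t₀), ?_, hgsol.comp_add (-t₀)⟩
  simp [hg 0 0 (by simp), hf0]

end Kuperberg

namespace Kuperberg

open Set Filter Topology
open scoped ContDiff

/-! ### Periodic bump functions -/

/-- The `6`-periodic function which agrees with `φ` on `[-3, 3]`. -/
noncomputable def per (φ : ℝ → ℝ) (x : ℝ) : ℝ := φ (x - 6 * round (x / 6))

theorem abs_sub_six_round_le (x : ℝ) : |x - 6 * round (x / 6)| ≤ 3 := by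
  have h := abs_sub_round (x / 6)
  rw [abs_le] at h ⊢
  constructor <;> linarith [h.1, h.2]

theorem per_add_int (φ : ℝ → ℝ) (x : ℝ) (k : ℤ) : per φ (x + 6 * k) = per φ x := by
  unfold per
  rw [show (x + 6 * k) / 6 = x / 6 + k by ring, round_add_intCast]
  congr 1
  push_cast
  ring

theorem per_eq {φ : ℝ → ℝ} {ρ : ℝ} (hρ : ρ ≤ 2) (hφ : ∀ x, ρ ≤ |x| → φ x = 0) {x : ℝ}
    (hx : |x| ≤ 6 - ρ) : per φ x = φ x := by
  unfold per
  have h := abs_sub_six_round_le x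
  rcases eq_or_ne (round (x / 6)) 0 with h0 | h0
  · simp [h0]
  · have h1 : (1 : ℝ) ≤ |(round (x / 6) : ℝ)| := by
      exact_mod_cast Int.one_le_abs h0
    have h2 : 6 ≤ |6 * (round (x / 6) : ℝ)| := by rw [abs_mul]; norm_num; linarith
    have h3 : |6 * (round (x / 6) : ℝ)| ≤ |x| + |x - 6 * round (x / 6)| := by
      calc _ = |x - (x - 6 * round (x / 6))| := by congr 1; ring
        _ ≤ _ := abs_sub _ _
    rw [hφ x (by linarith), hφ _ (by linarith)]

theorem contDiff_per {φ : ℝ → ℝ} (hs : ContDiff ℝ ∞ φ) (hφ : ∀ x, 2 ≤ |x| → φ x = 0) :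
    ContDiff ℝ ∞ (per φ) := by
  rw [contDiff_iff_contDiffAt]
  intro x
  have h := abs_sub_six_round_le x
  set k := round (x / 6) with hk
  have hev : ∀ᶠ u : ℝ in 𝓝 x, |u - 6 * k| < 4 :=
    (by fun_prop : Continuous fun u : ℝ => |u - 6 * k|).continuousAt.eventually_lt_const
      (by linarith)
  refine (hs.comp (contDiff_id.sub contDiff_const :
    ContDiff ℝ ∞ fun u : ℝ => u - 6 * k)).contDiffAt.congr_of_eventuallyEq ?_
  filter_upwards [hev] with u hu
  have := per_add_int φ (u - 6 * k) k
  rw [sub_add_cancel] at this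
  rw [this, per_eq le_rfl hφ (by linarith)]
  rfl

/-- The smooth step. -/
noncomputable abbrev stp : ℝ → ℝ := Real.smoothTransition

/-- A bump equal to `1` on `[-1/4, 1/4]` with support `[-1/2, 1/2]`. -/
noncomputable def bmp (x : ℝ) : ℝ := stp ((1 / 4 - x ^ 2) * (16 / 3))

/-- A bump equal to `1` on `[-5/4, 5/4]` with support `[-3/2, 3/2]`. -/
noncomputable def wbmp (x : ℝ) : ℝ := stp ((9 / 4 - x ^ 2) * (16 / 11))

/-- A bump of width `1/2000` with value `1` only at `0`. -/
noncomputable def nbmp (x : ℝ) : ℝ := stp (2 - 8000000 * x ^ 2)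

theorem contDiff_bmp : ContDiff ℝ ∞ bmp :=
  Real.smoothTransition.contDiff.comp (by fun_prop)
theorem contDiff_wbmp : ContDiff ℝ ∞ wbmp :=
  Real.smoothTransition.contDiff.comp (by fun_prop)
theorem contDiff_nbmp : ContDiff ℝ ∞ nbmp :=
  Real.smoothTransition.contDiff.comp (by fun_prop)

theorem bmp_nonneg (x) : 0 ≤ bmp x := Real.smoothTransition.nonneg _
theorem bmp_le_one (x) : bmp x ≤ 1 := Real.smoothTransition.le_one _
theorem wbmp_nonneg (x) : 0 ≤ wbmp x := Real.smoothTransition.nonneg _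
theorem wbmp_le_one (x) : wbmp x ≤ 1 := Real.smoothTransition.le_one _
theorem nbmp_nonneg (x) : 0 ≤ nbmp x := Real.smoothTransition.nonneg _
theorem nbmp_le_one (x) : nbmp x ≤ 1 := Real.smoothTransition.le_one _

theorem bmp_eq_one {x : ℝ} (h : |x| ≤ 1 / 4) : bmp x = 1 :=
  Real.smoothTransition.one_of_one_le (by have := sq_le_sq' (abs_le.1 h).1 (abs_le.1 h).2; linarith)
theorem bmp_eq_zero {x : ℝ} (h : 1 / 2 ≤ |x|) : bmp x = 0 :=
  Real.smoothTransition.zero_of_nonpos (by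
    have : (1 / 2) ^ 2 ≤ x ^ 2 := by rw [← sq_abs x]; gcongr
    linarith)
theorem wbmp_eq_one {x : ℝ} (h : |x| ≤ 5 / 4) : wbmp x = 1 :=
  Real.smoothTransition.one_of_one_le (by have := sq_le_sq' (abs_le.1 h).1 (abs_le.1 h).2; linarith)
theorem wbmp_eq_zero {x : ℝ} (h : 3 / 2 ≤ |x|) : wbmp x = 0 :=
  Real.smoothTransition.zero_of_nonpos (by
    have : (3 / 2) ^ 2 ≤ x ^ 2 := by rw [← sq_abs x]; gcongr
    linarith)
theorem nbmp_eq_zero {x : ℝ} (h : 1 / 2000 ≤ |x|) : nbmp x = 0 :=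
  Real.smoothTransition.zero_of_nonpos (by
    have : (1 / 2000) ^ 2 ≤ x ^ 2 := by rw [← sq_abs x]; gcongr
    linarith)
theorem nbmp_zero : nbmp 0 = 1 := Real.smoothTransition.one_of_one_le (by norm_num)
theorem bmp_neg (x) : bmp (-x) = bmp x := by simp [bmp]

theorem abs_lt_of_nbmp_ne_zero {x : ℝ} (h : nbmp x ≠ 0) : |x| < 1 / 2000 :=
  not_le.1 fun hc => h (nbmp_eq_zero hc)

theorem deriv_nbmp_eq_zero {y : ℝ} (h : nbmp y = 0) : deriv nbmp y = 0 :=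
  IsLocalMin.deriv_eq_zero (Eventually.of_forall fun u => by rw [h]; exact nbmp_nonneg u)

/-! ### Coefficient functions of the strand coordinate -/

noncomputable def ze₁ (x : ℝ) : ℝ := per bmp (x - 4)
noncomputable def ze₂ (x : ℝ) : ℝ := per bmp (x - 5)
/-- Direction of the flow in the two insertion zones. -/
noncomputable def ee (x : ℝ) : ℝ := ze₁ x - ze₂ x
/-- Absolute value of `ee`. -/
noncomputable def ea (x : ℝ) : ℝ := ze₁ x + ze₂ x
/-- Cut-off for the finger of the strand that is inserted. -/
noncomputable def cc (x : ℝ) : ℝ := per wbmp (x - 9 / 2)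
/-- Vertical thickness of the strand. -/
noncomputable def kk (x : ℝ) : ℝ := 1 - 99 / 100 * cc x
/-- Height of the core of the strand. -/
noncomputable def hh (x : ℝ) : ℝ :=
  per (fun u => bmp u * (-1 - u)) (x - 4) + per (fun u => bmp u * (1 + u)) (x - 5)
    - 5 * per bmp (x - 3)
/-- Indicator of the zones where the plug is pierced. -/
noncomputable def chi (x : ℝ) : ℝ := per bmp (x - 1) + per bmp (x - 2)

theorem bmp_zero_of_two {x : ℝ} (h : 2 ≤ |x|) : bmp x = 0 := bmp_eq_zero (by linarith)

theorem contDiff_per_bmp_mul {ψ : ℝ → ℝ} (h : ContDiff ℝ ∞ ψ) (a : ℝ) :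
    ContDiff ℝ ∞ fun x => per (fun u => bmp u * ψ u) (x - a) :=
  (contDiff_per (contDiff_bmp.mul h) fun x hx => by rw [bmp_zero_of_two hx, zero_mul]).comp
    (by fun_prop)

theorem contDiff_per_bmp (a : ℝ) : ContDiff ℝ ∞ fun x => per bmp (x - a) :=
  (contDiff_per contDiff_bmp fun x hx => bmp_zero_of_two hx).comp (by fun_prop)

@[fun_prop] theorem contDiff_ze₁ : ContDiff ℝ ∞ ze₁ := contDiff_per_bmp 4
@[fun_prop] theorem contDiff_ze₂ : ContDiff ℝ ∞ ze₂ := contDiff_per_bmp 5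
@[fun_prop] theorem contDiff_ee : ContDiff ℝ ∞ ee := contDiff_ze₁.sub contDiff_ze₂
@[fun_prop] theorem contDiff_ea : ContDiff ℝ ∞ ea := contDiff_ze₁.add contDiff_ze₂
@[fun_prop] theorem contDiff_cc : ContDiff ℝ ∞ cc :=
  (contDiff_per contDiff_wbmp fun x hx => wbmp_eq_zero (by linarith)).comp
    (by fun_prop : ContDiff ℝ ∞ fun x : ℝ => x - 9 / 2)
@[fun_prop] theorem contDiff_kk : ContDiff ℝ ∞ kk :=
  contDiff_const.sub (contDiff_const.mul contDiff_cc)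
@[fun_prop] theorem contDiff_hh : ContDiff ℝ ∞ hh :=
  ((contDiff_per_bmp_mul (by fun_prop) 4).add (contDiff_per_bmp_mul (by fun_prop) 5)).sub
    (contDiff_const.mul (contDiff_per_bmp 3))
@[fun_prop] theorem contDiff_chi : ContDiff ℝ ∞ chi :=
  (contDiff_per_bmp 1).add (contDiff_per_bmp 2)

theorem per_sub_add_int (φ : ℝ → ℝ) (x a : ℝ) (k : ℤ) :
    per φ (x + 6 * k - a) = per φ (x - a) := by
  rw [← per_add_int φ (x - a) k]; ring_nf

theorem ze₁_add_int (x : ℝ) (k : ℤ) : ze₁ (x + 6 * k) = ze₁ x := per_sub_add_int _ _ _ _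
theorem ze₂_add_int (x : ℝ) (k : ℤ) : ze₂ (x + 6 * k) = ze₂ x := per_sub_add_int _ _ _ _
theorem ee_add_int (x : ℝ) (k : ℤ) : ee (x + 6 * k) = ee x := by
  simp only [ee, ze₁_add_int, ze₂_add_int]
theorem ea_add_int (x : ℝ) (k : ℤ) : ea (x + 6 * k) = ea x := by
  simp only [ea, ze₁_add_int, ze₂_add_int]
theorem cc_add_int (x : ℝ) (k : ℤ) : cc (x + 6 * k) = cc x := per_sub_add_int _ _ _ _
theorem kk_add_int (x : ℝ) (k : ℤ) : kk (x + 6 * k) = kk x := by simp only [kk, cc_add_int]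
theorem hh_add_int (x : ℝ) (k : ℤ) : hh (x + 6 * k) = hh x := by
  simp only [hh, per_sub_add_int]
theorem chi_add_int (x : ℝ) (k : ℤ) : chi (x + 6 * k) = chi x := by
  simp only [chi, per_sub_add_int]

theorem deriv_add_int {φ : ℝ → ℝ} (h : ∀ (x : ℝ) (k : ℤ), φ (x + 6 * k) = φ x) (x : ℝ) (k : ℤ) :
    deriv φ (x + 6 * k) = deriv φ x := by
  rw [← deriv_comp_add_const]
  congr 1
  ext u
  exact h u k

/-- Values of the coefficient functions in a fundamental domain. -/
theorem per_bmp_eq {ψ : ℝ → ℝ} {x a : ℝ} (hx : |x - a| ≤ 11 / 2) :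
    per (fun u => bmp u * ψ u) (x - a) = bmp (x - a) * ψ (x - a) :=
  per_eq (ρ := 1 / 2) (by norm_num) (fun u hu => by rw [bmp_eq_zero hu, zero_mul])
    (by linarith)

theorem per_bmp_eq' {x a : ℝ} (hx : |x - a| ≤ 11 / 2) : per bmp (x - a) = bmp (x - a) :=
  per_eq (ρ := 1 / 2) (by norm_num) (fun u hu => bmp_eq_zero hu) (by linarith)

section Window
variable {x : ℝ} (h1 : 1 / 2 ≤ x) (h2 : x ≤ 13 / 2)
include h1 h2

theorem ze₁_eq : ze₁ x = bmp (x - 4) := per_bmp_eq' (abs_le.2 ⟨by linarith, by linarith⟩)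
theorem ze₂_eq : ze₂ x = bmp (x - 5) := per_bmp_eq' (abs_le.2 ⟨by linarith, by linarith⟩)
theorem cc_eq : cc x = wbmp (x - 9 / 2) :=
  per_eq (ρ := 3 / 2) (by norm_num) (fun u hu => wbmp_eq_zero hu)
    (abs_le.2 ⟨by linarith, by linarith⟩)
theorem hh_eq : hh x = bmp (x - 4) * (3 - x) + bmp (x - 5) * (x - 4) - 5 * bmp (x - 3) := by
  unfold hh
  rw [per_bmp_eq (abs_le.2 ⟨by linarith, by linarith⟩),
    per_bmp_eq (abs_le.2 ⟨by linarith, by linarith⟩),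
    per_bmp_eq' (abs_le.2 ⟨by linarith, by linarith⟩)]
  ring
theorem chi_eq : chi x = bmp (x - 1) + bmp (x - 2) := by
  unfold chi
  rw [per_bmp_eq' (abs_le.2 ⟨by linarith, by linarith⟩),
    per_bmp_eq' (abs_le.2 ⟨by linarith, by linarith⟩)]

end Window

theorem ze₁_nonneg (x) : 0 ≤ ze₁ x := bmp_nonneg _
theorem ze₂_nonneg (x) : 0 ≤ ze₂ x := bmp_nonneg _
theorem ze₁_le_one (x) : ze₁ x ≤ 1 := bmp_le_one _
theorem ze₂_le_one (x) : ze₂ x ≤ 1 := bmp_le_one _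
theorem cc_nonneg (x) : 0 ≤ cc x := wbmp_nonneg _
theorem cc_le_one (x) : cc x ≤ 1 := wbmp_le_one _
theorem kk_pos (x) : 1 / 100 ≤ kk x := by unfold kk; linarith [cc_le_one x]
theorem kk_le_one (x) : kk x ≤ 1 := by unfold kk; linarith [cc_nonneg x]
theorem kk_ne_zero (x) : kk x ≠ 0 := by linarith [kk_pos x]
theorem chi_nonneg (x) : 0 ≤ chi x := add_nonneg (bmp_nonneg _) (bmp_nonneg _)

/-- Every real is congruent modulo `6` to a point of the fundamental domain. -/
theorem exists_window (x : ℝ) : ∃ k : ℤ, 1 / 2 ≤ x + 6 * k ∧ x + 6 * k < 13 / 2 := by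
  refine ⟨-⌊(x - 1 / 2) / 6⌋, ?_, ?_⟩
  · have := Int.floor_le ((x - 1 / 2) / 6); push_cast; linarith
  · have := Int.lt_floor_add_one ((x - 1 / 2) / 6); push_cast; linarith

theorem exists_ze₁_ze₂ (x : ℝ) : ze₁ x = 0 ∨ ze₂ x = 0 := by
  obtain ⟨k, h1, h2⟩ := exists_window x
  rw [← ze₁_add_int x k, ← ze₂_add_int x k, ze₁_eq h1 h2.le, ze₂_eq h1 h2.le]
  rcases le_total (x + 6 * k) (9 / 2) with h | h
  · exact Or.inr (bmp_eq_zero (by rw [abs_of_nonpos] <;> linarith))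
  · exact Or.inl (bmp_eq_zero (by rw [le_abs]; left; linarith))

theorem chi_le_one (x : ℝ) : chi x ≤ 1 := by
  obtain ⟨k, h1, h2⟩ := exists_window x
  rw [← chi_add_int x k, chi_eq h1 h2.le]
  rcases le_total (x + 6 * k) (3 / 2) with h | h
  · rw [bmp_eq_zero (x := x + 6 * k - 2) (by rw [abs_of_nonpos] <;> linarith), add_zero]
    exact bmp_le_one _
  · rw [bmp_eq_zero (x := x + 6 * k - 1) (by rw [le_abs]; left; linarith), zero_add]
    exact bmp_le_one _

theorem ze_eq_zero_of_ee {x : ℝ} (h : ee x = 0) : ze₁ x = 0 ∧ ze₂ x = 0 := by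
  unfold ee at h
  rcases exists_ze₁_ze₂ x with h1 | h1 <;> constructor <;> linarith

theorem deriv_ee_eq_zero {x : ℝ} (h : ee x = 0) : deriv ee x = 0 := by
  obtain ⟨h1, h2⟩ := ze_eq_zero_of_ee h
  have d1 : deriv ze₁ x = 0 :=
    IsLocalMin.deriv_eq_zero (Eventually.of_forall fun u => by rw [h1]; exact ze₁_nonneg u)
  have d2 : deriv ze₂ x = 0 :=
    IsLocalMin.deriv_eq_zero (Eventually.of_forall fun u => by rw [h2]; exact ze₂_nonneg u)
  have := (contDiff_ze₁.differentiable (by simp) x).hasDerivAt.sub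
    (contDiff_ze₂.differentiable (by simp) x).hasDerivAt
  rw [d1, d2, sub_zero] at this
  exact this.deriv

theorem abs_hh_le (x : ℝ) : |hh x| ≤ 8 := by
  have key : ∀ u : ℝ, |bmp u * (1 + u)| ≤ 3 / 2 := fun u => by
    rcases le_or_gt (1 / 2) |u| with h | h
    · rw [bmp_eq_zero h]; norm_num
    · rw [abs_mul, abs_of_nonneg (bmp_nonneg u)]
      have h2 : |1 + u| ≤ 3 / 2 := by
        rw [abs_lt] at h; rw [abs_le]; constructor <;> linarith
      calc _ ≤ 1 * (3 / 2) := mul_le_mul (bmp_le_one u) h2 (abs_nonneg _) zero_le_one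
        _ = _ := one_mul _
  have k1 : |per (fun u => bmp u * (-1 - u)) (x - 4)| ≤ 3 / 2 := by
    have := key (x - 4 - 6 * round ((x - 4) / 6))
    unfold per
    rwa [← abs_neg, ← mul_neg, neg_sub, sub_neg_eq_add, add_comm (_ - _) (1 : ℝ)]
  have k2 : |per (fun u => bmp u * (1 + u)) (x - 5)| ≤ 3 / 2 := key _
  have k3 : 0 ≤ per bmp (x - 3) := bmp_nonneg _
  have k4 : per bmp (x - 3) ≤ 1 := bmp_le_one _
  unfold hh
  rw [abs_le] at *
  constructor <;> linarith [k1.1, k1.2, k2.1, k2.2]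

end Kuperberg

namespace Kuperberg

open Set Filter Topology
open scoped ContDiff

/-! ### Values of the coefficient functions on the zones -/

theorem ee_zone₄ {x : ℝ} (h : |x - 4| ≤ 1 / 4) : ee x = 1 ∧ ea x = 1 ∧ hh x = 3 - x := by
  have h' := abs_le.1 h
  have a : bmp (x - 5) = 0 := bmp_eq_zero (by rw [le_abs]; right; linarith)
  have b : bmp (x - 3) = 0 := bmp_eq_zero (by rw [le_abs]; left; linarith)
  unfold ee ea
  rw [hh_eq (by linarith) (by linarith), ze₁_eq (by linarith) (by linarith),
    ze₂_eq (by linarith) (by linarith), a, b, bmp_eq_one h]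
  norm_num

theorem ee_zone₅ {x : ℝ} (h : |x - 5| ≤ 1 / 4) : ee x = -1 ∧ ea x = 1 ∧ hh x = x - 4 := by
  have h' := abs_le.1 h
  have a : bmp (x - 4) = 0 := bmp_eq_zero (by rw [le_abs]; left; linarith)
  have b : bmp (x - 3) = 0 := bmp_eq_zero (by rw [le_abs]; left; linarith)
  unfold ee ea
  rw [hh_eq (by linarith) (by linarith), ze₁_eq (by linarith) (by linarith),
    ze₂_eq (by linarith) (by linarith), a, b, bmp_eq_one h]
  norm_num

theorem cc_eq_one {x : ℝ} (h : |x - 9 / 2| ≤ 5 / 4) : cc x = 1 ∧ kk x = 1 / 100 := by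
  have h' := abs_le.1 h
  have : cc x = 1 := by rw [cc_eq (by linarith) (by linarith), wbmp_eq_one h]
  unfold kk
  rw [this]
  norm_num

theorem cc_eq_zero {x : ℝ} (h1 : 1 / 2 ≤ x) (h2 : x ≤ 13 / 2) (h : x ≤ 3 ∨ 6 ≤ x) :
    cc x = 0 ∧ kk x = 1 := by
  have : cc x = 0 := by
    rw [cc_eq h1 h2]
    apply wbmp_eq_zero
    rw [le_abs]
    rcases h with h | h
    · right; linarith
    · left; linarith
  unfold kk
  rw [this]
  norm_num

theorem ze_eq_zero_main {x : ℝ} (h1 : 1 / 2 ≤ x) (h2 : x ≤ 7 / 2 ∨ 11 / 2 ≤ x) (h3 : x ≤ 13 / 2) :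
    ze₁ x = 0 ∧ ze₂ x = 0 := by
  rw [ze₁_eq h1 h3, ze₂_eq h1 h3]
  rcases h2 with h | h
  · exact ⟨bmp_eq_zero (by rw [le_abs]; right; linarith),
      bmp_eq_zero (by rw [le_abs]; right; linarith)⟩
  · exact ⟨bmp_eq_zero (by rw [le_abs]; left; linarith),
      bmp_eq_zero (by rw [le_abs]; left; linarith)⟩

theorem ee_eq_zero_main {x : ℝ} (h1 : 1 / 2 ≤ x) (h2 : x ≤ 7 / 2 ∨ 11 / 2 ≤ x) (h3 : x ≤ 13 / 2) :
    ee x = 0 ∧ ea x = 0 := by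
  obtain ⟨a, b⟩ := ze_eq_zero_main h1 h2 h3
  unfold ee ea
  rw [a, b]
  norm_num

theorem abs_ee_le (x : ℝ) : |ee x| ≤ 1 := by
  unfold ee
  rw [abs_le]
  constructor <;> linarith [ze₁_nonneg x, ze₂_nonneg x, ze₁_le_one x, ze₂_le_one x]

theorem deriv_zone₄ {x : ℝ} (h : |x - 4| < 1 / 4) :
    deriv ee x = 0 ∧ deriv hh x = -1 ∧ deriv kk x = 0 := by
  have hev : ∀ᶠ u in 𝓝 x, |u - 4| < 1 / 4 :=
    (by fun_prop : Continuous fun u : ℝ => |u - 4|).continuousAt.eventually_lt_const h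
  refine ⟨?_, ?_, ?_⟩
  · rw [EventuallyEq.deriv_eq (f := fun _ => (1 : ℝ))]
    · simp
    · filter_upwards [hev] with u hu using (ee_zone₄ hu.le).1
  · rw [EventuallyEq.deriv_eq (f := fun u => (3 : ℝ) - u)]
    · simp
    · filter_upwards [hev] with u hu using (ee_zone₄ hu.le).2.2
  · rw [EventuallyEq.deriv_eq (f := fun _ => (1 / 100 : ℝ))]
    · simp
    · filter_upwards [hev] with u hu
      have := abs_lt.1 hu
      exact (cc_eq_one (abs_le.2 ⟨by linarith, by linarith⟩)).2

theorem deriv_zone₅ {x : ℝ} (h : |x - 5| < 1 / 4) :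
    deriv ee x = 0 ∧ deriv hh x = 1 ∧ deriv kk x = 0 := by
  have hev : ∀ᶠ u in 𝓝 x, |u - 5| < 1 / 4 :=
    (by fun_prop : Continuous fun u : ℝ => |u - 5|).continuousAt.eventually_lt_const h
  refine ⟨?_, ?_, ?_⟩
  · rw [EventuallyEq.deriv_eq (f := fun _ => (-1 : ℝ))]
    · simp
    · filter_upwards [hev] with u hu using (ee_zone₅ hu.le).1
  · rw [EventuallyEq.deriv_eq (f := fun u => u - (4 : ℝ))]
    · simp
    · filter_upwards [hev] with u hu using (ee_zone₅ hu.le).2.2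
  · rw [EventuallyEq.deriv_eq (f := fun _ => (1 / 100 : ℝ))]
    · simp
    · filter_upwards [hev] with u hu
      have := abs_lt.1 hu
      exact (cc_eq_one (abs_le.2 ⟨by linarith, by linarith⟩)).2

/-- The zones `1` and `2` of the main strand. -/
theorem main_zone {x : ℝ} (h : |x - 1| ≤ 1 / 4 ∨ |x - 2| ≤ 1 / 4) :
    ee x = 0 ∧ ea x = 0 ∧ hh x = 0 ∧ cc x = 0 ∧ kk x = 1 ∧ chi x = 1 := by
  have h' : 3 / 4 ≤ x ∧ x ≤ 9 / 4 := by
    rcases h with h | h <;> have := abs_le.1 h <;> constructor <;> linarith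
  obtain ⟨a, b⟩ := ee_eq_zero_main (by linarith) (Or.inl (by linarith)) (by linarith : x ≤ 13 / 2)
  obtain ⟨c, d⟩ := cc_eq_zero (by linarith) (by linarith : x ≤ 13 / 2) (Or.inl (by linarith))
  refine ⟨a, b, ?_, c, d, ?_⟩
  · rw [hh_eq (by linarith) (by linarith), bmp_eq_zero (x := x - 4), bmp_eq_zero (x := x - 5),
      bmp_eq_zero (x := x - 3)]
    · norm_num
    all_goals rw [le_abs]; right; linarith
  · rw [chi_eq (by linarith) (by linarith)]
    rcases h with h | h <;> rw [bmp_eq_one h] <;> have := abs_le.1 h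
    · rw [bmp_eq_zero (x := x - 2), add_zero]
      rw [le_abs]; right; linarith
    · rw [bmp_eq_zero (x := x - 1), zero_add]
      rw [le_abs]; left; linarith

theorem deriv_main_zone {x : ℝ} (h : |x - 1| < 1 / 4 ∨ |x - 2| < 1 / 4) :
    deriv hh x = 0 ∧ deriv kk x = 0 ∧ deriv cc x = 0 := by
  have hev : ∀ᶠ u in 𝓝 x, |u - 1| ≤ 1 / 4 ∨ |u - 2| ≤ 1 / 4 := by
    rcases h with h | h
    · filter_upwards [(by fun_prop :
        Continuous fun u : ℝ => |u - 1|).continuousAt.eventually_lt_const h] with u hu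
        using Or.inl hu.le
    · filter_upwards [(by fun_prop :
        Continuous fun u : ℝ => |u - 2|).continuousAt.eventually_lt_const h] with u hu
        using Or.inr hu.le
  refine ⟨?_, ?_, ?_⟩
  · rw [EventuallyEq.deriv_eq (f := fun _ => (0 : ℝ))]
    · simp
    · filter_upwards [hev] with u hu using (main_zone hu).2.2.1
  · rw [EventuallyEq.deriv_eq (f := fun _ => (1 : ℝ))]
    · simp
    · filter_upwards [hev] with u hu using (main_zone hu).2.2.2.2.1
  · rw [EventuallyEq.deriv_eq (f := fun _ => (0 : ℝ))]
    · simp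
    · filter_upwards [hev] with u hu using (main_zone hu).2.2.2.1

/-! ### Straightening coordinates and the vector fields -/

/-- Height over the core of the strand. -/
noncomputable def hd (v : ℝ × ℝ × ℝ) : ℝ := v.2.2 - hh v.1
noncomputable def zz (v : ℝ × ℝ × ℝ) : ℝ := hd v / kk v.1
noncomputable def th (v : ℝ × ℝ × ℝ) : ℝ := v.1 - hd v * ee v.1 * nbmp v.2.1
noncomputable def bend (v : ℝ × ℝ × ℝ) : ℝ :=
  (1 - Real.cos v.2.1) / 2 + Real.sin (Real.pi * th v) ^ 2
noncomputable def rr (v : ℝ × ℝ × ℝ) : ℝ := v.2.1 + cc (th v) * bend v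
/-- Straightening coordinates of the plug. -/
noncomputable def Lam (v : ℝ × ℝ × ℝ) : ℝ × ℝ × ℝ := (th v, rr v, zz v)

noncomputable def ff (w : ℝ × ℝ × ℝ) : ℝ := nbmp w.2.1 * (bmp (w.2.2 + 1) - bmp (w.2.2 - 1))
noncomputable def nn (w : ℝ × ℝ × ℝ) : ℝ := w.2.1 ^ 2 + (w.2.2 ^ 2 - 1) ^ 2
noncomputable def gg (w : ℝ × ℝ × ℝ) : ℝ :=
  1 - nbmp w.2.1 * (bmp (w.2.2 + 1) + bmp (w.2.2 - 1)) *
    (1 - (1 - chi w.1) * (nn w / (1 + nn w)))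
/-- The Wilson-type vector field. -/
noncomputable def WW (w : ℝ × ℝ × ℝ) : ℝ × ℝ × ℝ := (ff w, 0, gg w / kk w.1)

/-- The vertical direction of the plug. -/
noncomputable def UU (v : ℝ × ℝ × ℝ) : ℝ × ℝ × ℝ :=
  (ee v.1 * nbmp v.2.1, 0, 1 - ea v.1 * nbmp v.2.1)

noncomputable def TTy (v : ℝ × ℝ × ℝ) : ℝ :=
  -(deriv cc (th v) * bend v
    + cc (th v) * (2 * Real.pi * Real.sin (Real.pi * th v) * Real.cos (Real.pi * th v)))
    / (1 + cc (th v) * (Real.sin v.2.1 / 2))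
noncomputable def TTx (v : ℝ × ℝ × ℝ) : ℝ :=
  1 + hd v * ee v.1 * deriv nbmp v.2.1 * TTy v
/-- The direction of the core of the plug. -/
noncomputable def TT (v : ℝ × ℝ × ℝ) : ℝ × ℝ × ℝ :=
  (TTx v, TTy v, (deriv hh v.1 + deriv kk v.1 * zz v) * TTx v)

/-- Contribution of one strand to the vector field. -/
noncomputable def QQ (v : ℝ × ℝ × ℝ) : ℝ × ℝ × ℝ :=
  ff (Lam v) • TT v + (gg (Lam v) - 1) • UU v

/-- Translation along the strand. -/
def sh (c : ℝ) (v : ℝ × ℝ × ℝ) : ℝ × ℝ × ℝ := (v.1 + c, v.2.1, v.2.2)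

/-- The vector field in the universal cover of the box. -/
noncomputable def PP (v : ℝ × ℝ × ℝ) : ℝ × ℝ × ℝ := (0, 0, 1) + QQ v + QQ (sh 3 v)

@[simp] theorem sh_fst (c v) : (sh c v).1 = v.1 + c := rfl
@[simp] theorem sh_snd (c v) : (sh c v).2 = v.2 := rfl
@[simp] theorem sh_zero (v) : sh 0 v = v := by simp [sh]
theorem sh_sh (a b v) : sh a (sh b v) = sh (b + a) v := by simp [sh, add_assoc]

theorem hd_sh (v) (k : ℤ) : hd (sh (6 * k) v) = hd v := by simp [hd, hh_add_int]
theorem zz_sh (v) (k : ℤ) : zz (sh (6 * k) v) = zz v := by simp [zz, hd_sh, kk_add_int]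
theorem th_sh (v) (k : ℤ) : th (sh (6 * k) v) = th v + 6 * k := by
  simp [th, hd_sh, ee_add_int]; ring
theorem bend_sh (v) (k : ℤ) : bend (sh (6 * k) v) = bend v := by
  have h : Real.pi * (th v + 6 * k) = Real.pi * th v + ((3 * k : ℤ) : ℝ) * (2 * Real.pi) := by
    push_cast; ring
  simp only [bend, th_sh, sh_snd, h, Real.sin_add_int_mul_two_pi]
theorem rr_sh (v) (k : ℤ) : rr (sh (6 * k) v) = rr v := by
  simp [rr, th_sh, cc_add_int, bend_sh]
theorem Lam_sh (v) (k : ℤ) : Lam (sh (6 * k) v) = sh (6 * k) (Lam v) := by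
  show (th (sh (6 * k) v), rr (sh (6 * k) v), zz (sh (6 * k) v)) = _
  rw [th_sh, rr_sh, zz_sh]
  rfl
theorem ff_sh (w) (c : ℝ) : ff (sh c w) = ff w := rfl
theorem nn_sh (w) (c : ℝ) : nn (sh c w) = nn w := rfl
theorem gg_sh (w) (k : ℤ) : gg (sh (6 * k) w) = gg w := by
  simp [gg, nn_sh, chi_add_int]
theorem WW_sh (w) (k : ℤ) : WW (sh (6 * k) w) = WW w := by
  simp [WW, ff_sh, gg_sh, kk_add_int]
theorem UU_sh (v) (k : ℤ) : UU (sh (6 * k) v) = UU v := by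
  simp [UU, ee_add_int, ea_add_int]
theorem TTy_sh (v) (k : ℤ) : TTy (sh (6 * k) v) = TTy v := by
  have h : Real.pi * (th v + 6 * k) = Real.pi * th v + ((3 * k : ℤ) : ℝ) * (2 * Real.pi) := by
    push_cast; ring
  simp only [TTy, th_sh, cc_add_int, bend_sh, deriv_add_int cc_add_int, sh_snd, h,
    Real.sin_add_int_mul_two_pi, Real.cos_add_int_mul_two_pi]
theorem TTx_sh (v) (k : ℤ) : TTx (sh (6 * k) v) = TTx v := by
  simp [TTx, TTy_sh, hd_sh, ee_add_int]
theorem TT_sh (v) (k : ℤ) : TT (sh (6 * k) v) = TT v := by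
  simp only [TT, TTy_sh, TTx_sh, zz_sh, sh_fst, deriv_add_int hh_add_int,
    deriv_add_int kk_add_int]
theorem QQ_sh (v) (k : ℤ) : QQ (sh (6 * k) v) = QQ v := by
  simp only [QQ, Lam_sh, ff_sh, gg_sh, TT_sh, UU_sh]
theorem QQ_sh_six (v) : QQ (sh 6 v) = QQ v := by simpa using QQ_sh v 1

theorem PP_sh_three (v) : PP (sh 3 v) = PP v := by
  unfold PP
  rw [sh_sh, show (3 : ℝ) + 3 = 6 by norm_num, QQ_sh_six]
  abel

theorem PP_sh (v) (k : ℤ) : PP (sh (3 * k) v) = PP v := by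
  induction k using Int.induction_on with
  | zero => simp
  | succ i ih =>
    rw [← ih, ← PP_sh_three (sh (3 * (i : ℤ)) v), sh_sh]
    push_cast; ring_nf
  | pred i ih =>
    rw [← ih, ← PP_sh_three (sh (3 * ((-(i : ℤ) - 1 : ℤ) : ℝ)) v), sh_sh]
    push_cast; ring_nf

theorem bend_nonneg (v) : 0 ≤ bend v := by
  unfold bend
  have := Real.cos_le_one v.2.1
  positivity [sub_nonneg.2 this]

theorem bend_le (v) : bend v ≤ 2 := by
  unfold bend
  have := Real.neg_one_le_cos v.2.1
  have := Real.sin_sq_le_one (Real.pi * th v)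
  linarith

theorem TTy_denom_pos (v) : 0 < 1 + cc (th v) * (Real.sin v.2.1 / 2) := by
  have h1 := Real.neg_one_le_sin v.2.1
  nlinarith [cc_nonneg (th v), cc_le_one (th v)]

/-! ### Smoothness -/

@[fun_prop] theorem contDiff_hd : ContDiff ℝ ∞ hd := by unfold hd; fun_prop
@[fun_prop] theorem contDiff_zz : ContDiff ℝ ∞ zz := by
  unfold zz; exact contDiff_hd.div (by fun_prop) fun v => kk_ne_zero _
@[fun_prop] theorem contDiff_nbmp' : ContDiff ℝ ∞ nbmp := contDiff_nbmp
@[fun_prop] theorem contDiff_bmp' : ContDiff ℝ ∞ bmp := contDiff_bmp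
@[fun_prop] theorem contDiff_th : ContDiff ℝ ∞ th := by unfold th; fun_prop
@[fun_prop] theorem contDiff_bend : ContDiff ℝ ∞ bend := by unfold bend; fun_prop
@[fun_prop] theorem contDiff_rr : ContDiff ℝ ∞ rr := by unfold rr; fun_prop
@[fun_prop] theorem contDiff_Lam : ContDiff ℝ ∞ Lam := by unfold Lam; fun_prop
@[fun_prop] theorem contDiff_ff : ContDiff ℝ ∞ ff := by unfold ff; fun_prop
@[fun_prop] theorem contDiff_nn : ContDiff ℝ ∞ nn := by unfold nn; fun_prop
theorem nn_nonneg (w) : 0 ≤ nn w := by unfold nn; positivity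
@[fun_prop] theorem contDiff_gg : ContDiff ℝ ∞ gg := by
  have : ContDiff ℝ ∞ fun w => nn w / (1 + nn w) :=
    contDiff_nn.div (by fun_prop) fun w => by linarith [nn_nonneg w]
  unfold gg
  fun_prop
@[fun_prop] theorem contDiff_WW : ContDiff ℝ ∞ WW := by
  have : ContDiff ℝ ∞ fun w => gg w / kk w.1 :=
    contDiff_gg.div (by fun_prop) fun w => kk_ne_zero _
  unfold WW
  fun_prop

theorem contDiff_deriv {φ : ℝ → ℝ} (h : ContDiff ℝ ∞ φ) : ContDiff ℝ ∞ (deriv φ) :=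
  (contDiff_infty_iff_deriv.1 h).2
@[fun_prop] theorem contDiff_deriv_nbmp : ContDiff ℝ ∞ (deriv nbmp) :=
  contDiff_deriv contDiff_nbmp
@[fun_prop] theorem contDiff_TTy : ContDiff ℝ ∞ TTy := by
  unfold TTy
  exact ContDiff.div (by fun_prop) (by fun_prop) fun v => (TTy_denom_pos v).ne'
@[fun_prop] theorem contDiff_TTx : ContDiff ℝ ∞ TTx := by unfold TTx; fun_prop
@[fun_prop] theorem contDiff_TT : ContDiff ℝ ∞ TT := by unfold TT; fun_prop
@[fun_prop] theorem contDiff_UU : ContDiff ℝ ∞ UU := by unfold UU; fun_prop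
@[fun_prop] theorem contDiff_QQ : ContDiff ℝ ∞ QQ := by unfold QQ; fun_prop
@[fun_prop] theorem contDiff_sh (c : ℝ) : ContDiff ℝ ∞ (sh c) := by unfold sh; fun_prop
@[fun_prop] theorem contDiff_PP : ContDiff ℝ ∞ PP := by unfold PP; fun_prop

end Kuperberg

namespace Kuperberg

open Set Filter Topology
open scoped ContDiff

/-! ### The geometry of the self-insertion -/

theorem abs_sub_round_le_abs_sin (x : ℝ) : 2 * |x - round x| ≤ |Real.sin (Real.pi * x)| := by
  have h := abs_sub_round x
  have h1 : Real.sin (Real.pi * x) = (-1) ^ (round x) * Real.sin (Real.pi * (x - round x)) := by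
    rw [← Real.sin_add_int_mul_pi]; congr 1; ring
  have h2 : |Real.sin (Real.pi * x)| = |Real.sin (Real.pi * (x - round x))| := by
    rw [h1, abs_mul, abs_zpow]; simp
  have hp := Real.pi_pos
  have h3 : |Real.pi * (x - round x)| = Real.pi * |x - round x| := by
    rw [abs_mul, abs_of_pos hp]
  have h4 := Real.mul_abs_le_abs_sin (x := Real.pi * (x - round x))
    (by rw [h3]; nlinarith)
  rw [h3] at h4
  rw [h2]
  calc 2 * |x - round x| = 2 / Real.pi * (Real.pi * |x - round x|) := by field_simp
    _ ≤ _ := h4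

theorem abs_sub_round_lt {x : ℝ} (h : Real.sin (Real.pi * x) ^ 2 ≤ 1 / 500) :
    |x - round x| < 1 / 40 := by
  have := abs_sub_round_le_abs_sin x
  by_contra hc
  have h1 : 1 / 20 ≤ |Real.sin (Real.pi * x)| := by linarith
  have h2 : (1 / 20) ^ 2 ≤ |Real.sin (Real.pi * x)| ^ 2 := by gcongr
  rw [sq_abs] at h2
  linarith

theorem sin_sq_le_bend (v : ℝ × ℝ × ℝ) : Real.sin (Real.pi * th v) ^ 2 ≤ bend v := by
  unfold bend
  linarith [Real.cos_le_one v.2.1]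

theorem hd_eq (v : ℝ × ℝ × ℝ) : hd v = kk v.1 * zz v := by
  unfold zz; field_simp [kk_ne_zero]

/-- The closed straightened plug. -/
def GG (v : ℝ × ℝ × ℝ) : Prop := |rr v| ≤ 1 / 1000 ∧ |zz v| ≤ 2

theorem GG_sh (v) (k : ℤ) : GG (sh (6 * k) v) ↔ GG v := by simp [GG, rr_sh, zz_sh]

theorem abs_hd_le {v : ℝ × ℝ × ℝ} (h : GG v) : |hd v| ≤ 2 * kk v.1 := by
  have := kk_pos v.1
  rw [hd_eq, abs_mul, abs_of_pos (by linarith)]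
  nlinarith [h.2]

theorem abs_ee_mul_nbmp_le (x y : ℝ) : |ee x * nbmp y| ≤ 1 := by
  rw [abs_mul, abs_of_nonneg (nbmp_nonneg y)]
  nlinarith [abs_ee_le x, nbmp_le_one y, abs_nonneg (ee x), nbmp_nonneg y]

theorem abs_th_sub_le (v : ℝ × ℝ × ℝ) : |th v - v.1| ≤ |hd v| := by
  have : th v - v.1 = -(hd v * (ee v.1 * nbmp v.2.1)) := by unfold th; ring
  rw [this, abs_neg, abs_mul]
  nlinarith [abs_ee_mul_nbmp_le v.1 v.2.1, abs_nonneg (hd v)]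

/-- Where the finger of the strand enters the zones `1` and `2` of the main strand. -/
theorem finger_near {v : ℝ × ℝ × ℝ} (h : GG v) (h1 : 7 / 2 ≤ v.1) (h2 : v.1 ≤ 23 / 4)
    (hy : |v.2.1| ≤ 1 / 1000) :
    (|v.1 - 4| < 1 / 8 ∧ |th v - 4| < 1 / 8 ∧ |v.2.2 + 1| < 1 / 8) ∨
      (|v.1 - 5| < 1 / 8 ∧ |th v - 5| < 1 / 8 ∧ |v.2.2 - 1| < 1 / 8) := by
  have hk : kk v.1 = 1 / 100 := (cc_eq_one (abs_le.2 ⟨by linarith, by linarith⟩)).2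
  have hh1 : |hd v| ≤ 1 / 50 := by have := abs_hd_le h; rw [hk] at this; linarith
  have ht := abs_th_sub_le v
  have ht1 := abs_le.1 (ht.trans hh1)
  have ht2 : th v ≤ 23 / 4 := by
    rcases le_total v.1 (11 / 2) with h3 | h3
    · linarith
    · have : th v = v.1 := by
        unfold th
        rw [(ee_eq_zero_main (by linarith) (Or.inr h3) (by linarith)).1]; ring
      linarith
  have hc : cc (th v) = 1 := (cc_eq_one (abs_le.2 ⟨by linarith, by linarith⟩)).1
  have hr := abs_le.1 h.1
  have hy' := abs_le.1 hy
  have hb : bend v ≤ 1 / 500 := by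
    have : rr v = v.2.1 + bend v := by unfold rr; rw [hc, one_mul]
    linarith
  have hs := abs_lt.1 (abs_sub_round_lt ((sin_sq_le_bend v).trans hb))
  have hn1 : 3 < round (th v) := by
    have : ((3 : ℤ) : ℝ) < (round (th v) : ℝ) := by push_cast; linarith
    exact_mod_cast this
  have hn2 : round (th v) < 6 := by
    have : (round (th v) : ℝ) < ((6 : ℤ) : ℝ) := by push_cast; linarith
    exact_mod_cast this
  have hhd := abs_le.1 hh1
  have hn : round (th v) = 4 ∨ round (th v) = 5 := by omega
  rcases hn with hn | hn <;> rw [hn] at hs <;> push_cast at hs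
  · left
    have hx : |v.1 - 4| < 1 / 8 := abs_lt.2 ⟨by linarith, by linarith⟩
    have hx2 := (ee_zone₄ (hx.le.trans (by norm_num))).2.2
    have hz : v.2.2 = hd v + (3 - v.1) := by unfold hd; rw [hx2]; ring
    exact ⟨hx, abs_lt.2 ⟨by linarith, by linarith⟩, abs_lt.2 ⟨by linarith, by linarith⟩⟩
  · right
    have hx : |v.1 - 5| < 1 / 8 := abs_lt.2 ⟨by linarith, by linarith⟩
    have hx2 := (ee_zone₅ (hx.le.trans (by norm_num))).2.2
    have hz : v.2.2 = hd v + (v.1 - 4) := by unfold hd; rw [hx2]; ring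
    exact ⟨hx, abs_lt.2 ⟨by linarith, by linarith⟩, abs_lt.2 ⟨by linarith, by linarith⟩⟩

/-- Intersections of the two translates of the plug. -/
theorem near_of_inter {u : ℝ × ℝ × ℝ} (h : GG u) (h' : GG (sh 3 u)) (h1 : 1 / 2 ≤ u.1)
    (h2 : u.1 < 7 / 2) : |u.2.1| ≤ 1 / 1000 ∧
    ((|u.1 - 1| < 1 / 8 ∧ |u.2.2 + 1| < 1 / 8) ∨ (|u.1 - 2| < 1 / 8 ∧ |u.2.2 - 1| < 1 / 8)) := by
  have hthu : th u = u.1 := by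
    unfold th
    rw [(ee_eq_zero_main h1 (Or.inl h2.le) (by linarith)).1]; ring
  have hru := abs_le.1 h.1
  rcases le_or_gt u.1 (11 / 4) with h3 | h3
  · have hru' : rr u = u.2.1 := by
      unfold rr
      rw [hthu, (cc_eq_zero h1 (by linarith) (Or.inl (by linarith))).1]; ring
    have hy : |u.2.1| ≤ 1 / 1000 := hru' ▸ h.1
    refine ⟨hy, ?_⟩
    rcases finger_near h' (by simp; linarith) (by simp; linarith) (by simpa using hy) with h4 | h4
    · left
      refine ⟨?_, h4.2.2⟩
      have := h4.1
      rw [sh_fst] at this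
      convert this using 2; ring
    · right
      refine ⟨?_, h4.2.2⟩
      have := h4.1
      rw [sh_fst] at this
      convert this using 2; ring
  exfalso
  rcases le_or_gt u.1 (13 / 4) with h4 | h4
  · have e1 : hh u.1 = -5 := by
      rw [hh_eq h1 (by linarith), bmp_eq_zero (x := u.1 - 4), bmp_eq_zero (x := u.1 - 5),
        bmp_eq_one (x := u.1 - 3) (abs_le.2 ⟨by linarith, by linarith⟩)]
      · norm_num
      all_goals rw [le_abs]; right; linarith
    have e2 : hh (u.1 + 3) = 0 := by
      rw [hh_eq (by linarith) (by linarith), bmp_eq_zero (x := u.1 + 3 - 4),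
        bmp_eq_zero (x := u.1 + 3 - 5), bmp_eq_zero (x := u.1 + 3 - 3)]
      · norm_num
      all_goals rw [le_abs]; left; linarith
    have a1 := abs_le.1 (abs_hd_le h)
    have a2 := abs_le.1 (abs_hd_le h')
    have b1 := kk_le_one u.1
    have b2 := kk_le_one (u.1 + 3)
    simp only [hd, sh_fst, sh_snd, e1, e2] at a1 a2
    linarith
  · have hth' : th (sh 3 u) = u.1 + 3 := by
      unfold th
      rw [sh_fst, (ee_eq_zero_main (by linarith) (Or.inr (by linarith)) (by linarith)).1]; ring
    have hr' : rr (sh 3 u) = u.2.1 := by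
      unfold rr
      rw [hth', (cc_eq_zero (by linarith) (by linarith) (Or.inr (by linarith))).1]; simp
    have hy := h'.1
    rw [hr'] at hy
    have hy' := abs_le.1 hy
    have hb : bend u ≤ 1 / 500 := by
      have : rr u = u.2.1 + bend u := by
        unfold rr
        rw [hthu, (cc_eq_one (abs_le.2 ⟨by linarith, by linarith⟩)).1, one_mul]
      linarith
    have hs := abs_lt.1 (abs_sub_round_lt ((sin_sq_le_bend u).trans hb))
    rw [hthu] at hs
    have hn1 : 3 < round u.1 := by
      have : ((3 : ℤ) : ℝ) < (round u.1 : ℝ) := by push_cast; linarith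
      exact_mod_cast this
    have hn2 : round u.1 < 4 := by
      have : (round u.1 : ℝ) < ((4 : ℤ) : ℝ) := by push_cast; linarith
      exact_mod_cast this
    omega

end Kuperberg

namespace Kuperberg

open Set Filter Topology
open scoped ContDiff

/-- The point lies in one of the two insertion zones of the finger. -/
def NZ (w : ℝ × ℝ × ℝ) : Prop :=
  (|w.1 - 4| < 1 / 8 ∧ |th w - 4| < 1 / 8 ∧ |w.2.2 + 1| < 1 / 8) ∨
    (|w.1 - 5| < 1 / 8 ∧ |th w - 5| < 1 / 8 ∧ |w.2.2 - 1| < 1 / 8)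

theorem zone_cases {v : ℝ × ℝ × ℝ} (h : GG v) :
    ee v.1 * nbmp v.2.1 = 0 ∨ |v.2.1| < 1 / 2000 ∧ ∃ k : ℤ, NZ (sh (6 * k) v) := by
  by_cases h0 : ee v.1 * nbmp v.2.1 = 0
  · exact Or.inl h0
  · right
    have hy := abs_lt_of_nbmp_ne_zero (right_ne_zero_of_mul h0)
    refine ⟨hy, ?_⟩
    obtain ⟨k, hk1, hk2⟩ := exists_window v.1
    refine ⟨k, finger_near ((GG_sh v k).2 h) ?_ ?_ (by simp; linarith)⟩
    · by_contra hc
      rw [not_le, sh_fst] at hc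
      apply left_ne_zero_of_mul h0
      rw [← ee_add_int v.1 k]
      exact (ee_eq_zero_main hk1 (Or.inl hc.le) hk2.le).1
    · by_contra hc
      rw [not_le, sh_fst] at hc
      apply left_ne_zero_of_mul h0
      rw [← ee_add_int v.1 k]
      exact (ee_eq_zero_main hk1 (Or.inr (by linarith)) hk2.le).1

theorem zone_facts {v : ℝ × ℝ × ℝ} (h : GG v) :
    deriv kk v.1 * (ee v.1 * nbmp v.2.1) = 0 ∧ deriv ee v.1 * nbmp v.2.1 = 0 ∧
    (deriv hh v.1 * ee v.1 + ea v.1) * nbmp v.2.1 = 0 ∧ kk (th v) = kk v.1 ∧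
    ea v.1 * nbmp v.2.1 = |ee v.1 * nbmp v.2.1| ∧
    deriv kk v.1 * (ee v.1 * deriv nbmp v.2.1) = 0 := by
  rcases zone_cases h with h0 | ⟨hy, k, hk⟩
  · have hth : th v = v.1 := by unfold th; rw [mul_assoc, h0]; ring
    rcases mul_eq_zero.1 h0 with h1 | h1
    · obtain ⟨h2, h3⟩ := ze_eq_zero_of_ee h1
      have : ea v.1 = 0 := by unfold ea; rw [h2, h3]; norm_num
      simp [h1, deriv_ee_eq_zero h1, this, hth]
    · simp [h1, hth, deriv_nbmp_eq_zero h1]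
  · rw [← deriv_add_int kk_add_int v.1 k, ← deriv_add_int ee_add_int v.1 k,
      ← deriv_add_int hh_add_int v.1 k, ← ee_add_int v.1 k, ← ea_add_int v.1 k,
      ← kk_add_int (th v) k, ← kk_add_int v.1 k]
    unfold NZ at hk
    rw [th_sh, sh_fst] at hk
    rcases hk with ⟨h1, h2, -⟩ | ⟨h1, h2, -⟩
    · obtain ⟨d1, d2, d3⟩ := deriv_zone₄ (h1.trans (by norm_num))
      obtain ⟨e1, e2, -⟩ := ee_zone₄ (h1.le.trans (by norm_num))
      have b1 := abs_lt.1 h1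
      have b2 := abs_lt.1 h2
      rw [d1, d2, d3, e1, e2, (cc_eq_one (abs_le.2 ⟨by linarith, by linarith⟩)).2,
        (cc_eq_one (abs_le.2 ⟨by linarith, by linarith⟩)).2]
      simp [abs_of_nonneg (nbmp_nonneg _)]
    · obtain ⟨d1, d2, d3⟩ := deriv_zone₅ (h1.trans (by norm_num))
      obtain ⟨e1, e2, -⟩ := ee_zone₅ (h1.le.trans (by norm_num))
      have b1 := abs_lt.1 h1
      have b2 := abs_lt.1 h2
      rw [d1, d2, d3, e1, e2, (cc_eq_one (abs_le.2 ⟨by linarith, by linarith⟩)).2,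
        (cc_eq_one (abs_le.2 ⟨by linarith, by linarith⟩)).2]
      simp [abs_of_nonneg (nbmp_nonneg _)]

theorem hasDerivAt_comp_contDiff {φ : ℝ → ℝ} (h : ContDiff ℝ ∞ φ) {u : ℝ → ℝ} {u' t : ℝ}
    (hu : HasDerivAt u u' t) : HasDerivAt (fun s => φ (u s)) (deriv φ (u t) * u') t :=
  ((h.differentiable (by simp)).differentiableAt.hasDerivAt).comp t hu

theorem hasDerivAt_fst' {E F : Type*} [NormedAddCommGroup E] [NormedSpace ℝ E]
    [NormedAddCommGroup F] [NormedSpace ℝ F] {v : ℝ → E × F} {w : E × F} {t : ℝ}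
    (h : HasDerivAt v w t) : HasDerivAt (fun s => (v s).1) w.1 t :=
  (hasFDerivAt_fst (𝕜 := ℝ) (p := v t)).comp_hasDerivAt t h

theorem hasDerivAt_snd' {E F : Type*} [NormedAddCommGroup E] [NormedSpace ℝ E]
    [NormedAddCommGroup F] [NormedSpace ℝ F] {v : ℝ → E × F} {w : E × F} {t : ℝ}
    (h : HasDerivAt v w t) : HasDerivAt (fun s => (v s).2) w.2 t :=
  (hasFDerivAt_snd (𝕜 := ℝ) (p := v t)).comp_hasDerivAt t h

/-- In straightening coordinates the plug field is the Wilson-type field. -/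
theorem hasDerivAt_Lam {v : ℝ → ℝ × ℝ × ℝ} {t : ℝ} (h : GG (v t))
    (hv : HasDerivAt v (ff (Lam (v t)) • TT (v t) + gg (Lam (v t)) • UU (v t)) t) :
    HasDerivAt (fun s => Lam (v s)) (WW (Lam (v t))) t := by
  obtain ⟨z1, z2, z3, z4, -, z6⟩ := zone_facts h
  have hX := hasDerivAt_fst' hv
  have hy := hasDerivAt_fst' (hasDerivAt_snd' hv)
  have hZ := hasDerivAt_snd' (hasDerivAt_snd' hv)
  set f := ff (Lam (v t)) with hf
  set g := gg (Lam (v t)) with hg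
  have hden := (TTy_denom_pos (v t)).ne'
  have hTy : TTy (v t) * (1 + cc (th (v t)) * (Real.sin (v t).2.1 / 2)) =
    -(deriv cc (th (v t)) * bend (v t) + cc (th (v t)) * (2 * Real.pi *
      Real.sin (Real.pi * th (v t)) * Real.cos (Real.pi * th (v t)))) := by
    unfold TTy; rw [div_mul_cancel₀ _ hden]
  have hTx : TTx (v t) = 1 + hd (v t) * ee (v t).1 * deriv nbmp (v t).2.1 * TTy (v t) := rfl
  simp only [Prod.fst_add, Prod.snd_add, Prod.smul_fst, Prod.smul_snd, TT, UU, smul_eq_mul]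
    at hX hy hZ
  have hkk := kk_ne_zero (v t).1
  have hhd : HasDerivAt (fun s => hd (v s))
      (f * (deriv kk (v t).1 * zz (v t) * TTx (v t)) + g) t := by
    have := hZ.sub (hasDerivAt_comp_contDiff contDiff_hh hX)
    refine this.congr_deriv ?_
    linear_combination (-g) * z3
  have hzz : HasDerivAt (fun s => zz (v s)) (g / kk (th (v t))) t := by
    have := hhd.div (hasDerivAt_comp_contDiff contDiff_kk hX) hkk
    refine this.congr_deriv ?_
    rw [z4, hd_eq (v t)]
    field_simp
    linear_combination (-g * zz (v t)) * z1
  have hth : HasDerivAt (fun s => th (v s)) f t := by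
    have := hX.sub ((hhd.mul (hasDerivAt_comp_contDiff contDiff_ee hX)).mul
      (hasDerivAt_comp_contDiff contDiff_nbmp hy))
    refine this.congr_deriv ?_
    simp only [Pi.mul_apply]
    linear_combination f * hTx - f * zz (v t) * TTx (v t) * z1
      - hd (v t) * (f * TTx (v t) + g * (ee (v t).1 * nbmp (v t).2.1)) * z2
  have hrr : HasDerivAt (fun s => rr (v s)) 0 t := by
    have hb : HasDerivAt (fun s => bend (v s))
        (Real.sin (v t).2.1 / 2 * (f * TTy (v t)) + 2 * Real.pi * Real.sin (Real.pi * th (v t)) *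
          Real.cos (Real.pi * th (v t)) * f) t := by
      have := ((hy.cos.const_sub 1).div_const 2).add ((hth.const_mul Real.pi).sin.pow 2)
      refine this.congr_deriv ?_
      simp
      ring
    have := hy.add ((hasDerivAt_comp_contDiff contDiff_cc hth).mul hb)
    refine this.congr_deriv ?_
    linear_combination f * hTy
  exact hth.prodMk (hrr.prodMk hzz)

end Kuperberg

namespace Kuperberg

open Set Filter Topology
open scoped ContDiff

/-- The zones of the main strand into which the finger is inserted. -/
def MZ (u : ℝ × ℝ × ℝ) : Prop :=
  (|u.1 - 1| < 1 / 8 ∧ |u.2.2 + 1| < 1 / 8) ∨ (|u.1 - 2| < 1 / 8 ∧ |u.2.2 - 1| < 1 / 8)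

/-- The point lies over the finger. -/
def Child (w : ℝ × ℝ × ℝ) : Prop := ∃ k : ℤ, 7 / 2 < w.1 + 6 * k ∧ w.1 + 6 * k < 11 / 2

/-- The opposite point lies inside the finger. -/
def Nest (v : ℝ × ℝ × ℝ) : Prop :=
  Child (sh 3 v) ∧ |rr (sh 3 v)| < 1 / 1000 ∧ |zz (sh 3 v)| < 2

theorem Child_sh (w) (k : ℤ) : Child (sh (6 * k) w) ↔ Child w := by
  constructor
  · rintro ⟨j, h1, h2⟩
    refine ⟨j + k, ?_, ?_⟩ <;> simp only [sh_fst] at h1 h2 <;> push_cast <;> linarith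
  · rintro ⟨j, h1, h2⟩
    refine ⟨j - k, ?_, ?_⟩ <;> simp only [sh_fst] <;> push_cast <;> linarith

theorem sh_comm (a b v) : sh a (sh b v) = sh b (sh a v) := by rw [sh_sh, sh_sh, add_comm]

theorem Nest_sh (v) (k : ℤ) : Nest (sh (6 * k) v) ↔ Nest v := by
  unfold Nest
  rw [sh_comm, Child_sh, rr_sh, zz_sh]

theorem MZ.bounds {u : ℝ × ℝ × ℝ} (h : MZ u) :
    (|u.1 - 1| < 1 / 8 ∨ |u.1 - 2| < 1 / 8) ∧ 7 / 8 < u.1 ∧ u.1 < 17 / 8 := by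
  rcases h with ⟨h, -⟩ | ⟨h, -⟩ <;> have := abs_lt.1 h
  · exact ⟨Or.inl h, by linarith, by linarith⟩
  · exact ⟨Or.inr h, by linarith, by linarith⟩

theorem MZ.not_child {u : ℝ × ℝ × ℝ} (h : MZ u) : ¬ Child u := by
  rintro ⟨k, h1, h2⟩
  obtain ⟨-, h3, h4⟩ := h.bounds
  have a : (0 : ℤ) < k := by
    have : (0 : ℝ) < k := by linarith
    exact_mod_cast this
  have b : k < 1 := by
    have : (k : ℝ) < 1 := by linarith
    exact_mod_cast this
  omega

theorem MZ.child {u : ℝ × ℝ × ℝ} (h : MZ u) : Child (sh 3 u) := by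
  obtain ⟨-, h3, h4⟩ := h.bounds
  exact ⟨0, by simp; linarith, by simp; linarith⟩

theorem Lam_eq_self {u : ℝ × ℝ × ℝ} (h : |u.1 - 1| ≤ 1 / 4 ∨ |u.1 - 2| ≤ 1 / 4) : Lam u = u := by
  obtain ⟨h1, h2, h3, h4, h5, h6⟩ := main_zone h
  have hth : th u = u.1 := by unfold th; rw [h1]; ring
  unfold Lam
  rw [hth]
  unfold rr zz hd
  rw [hth, h3, h4, h5]
  simp

theorem MZ.Lam {u : ℝ × ℝ × ℝ} (h : MZ u) : Lam u = u :=
  Lam_eq_self (h.bounds.1.imp (fun h => h.le.trans (by norm_num)) fun h => h.le.trans (by norm_num))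

theorem inter_cases {v : ℝ × ℝ × ℝ} (h : GG v) (h' : GG (sh 3 v)) :
    |v.2.1| ≤ 1 / 1000 ∧ ∃ k : ℤ, MZ (sh (6 * k) v) ∨ MZ (sh (6 * k) (sh 3 v)) := by
  obtain ⟨k, hk1, hk2⟩ := exists_window v.1
  rcases lt_or_ge (v.1 + 6 * k) (7 / 2) with h3 | h3
  · have := near_of_inter ((GG_sh v k).2 h) (by rw [sh_comm]; exact (GG_sh _ k).2 h') hk1 h3
    exact ⟨this.1, k, Or.inl this.2⟩
  · have e : sh 3 (sh (6 * (k - 1 : ℤ)) (sh 3 v)) = sh (6 * k) v := by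
      rw [sh_sh, sh_sh]; congr 1; push_cast; ring
    have := near_of_inter ((GG_sh _ (k - 1)).2 h') (by rw [e]; exact (GG_sh _ k).2 h)
      (by simp; linarith) (by simp; linarith)
    exact ⟨this.1, k - 1, Or.inr this.2⟩

theorem not_nest_of_nest {v : ℝ × ℝ × ℝ} (h : GG v) (hn : Nest v) :
    GG (sh 3 v) ∧ ¬ Nest (sh 3 v) ∧ ¬ Child v := by
  have hg : GG (sh 3 v) := ⟨hn.2.1.le, hn.2.2.le⟩
  obtain ⟨-, k, hk | hk⟩ := inter_cases h hg
  · have := hk.not_child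
    rw [Child_sh] at this
    refine ⟨hg, fun h2 => this ?_, this⟩
    have := h2.1
    rw [sh_sh, show (3 + 3 : ℝ) = 6 * (1 : ℤ) by norm_num, Child_sh] at this
    exact this
  · exact absurd ((Child_sh _ _).2 hn.1) hk.not_child

theorem QQ_of_MZ {u : ℝ × ℝ × ℝ} (h : MZ u) :
    QQ u = (ee (u.1 + 3) * nbmp u.2.1, 0, -(nbmp u.2.1)) ∧ |ee (u.1 + 3)| = 1 ∧
      ea (u.1 + 3) = 1 := by
  have hb : |u.1 - 1| < 1 / 4 ∨ |u.1 - 2| < 1 / 4 :=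
    h.bounds.1.imp (fun h => h.trans (by norm_num)) fun h => h.trans (by norm_num)
  obtain ⟨h1, h2, h3, h4, h5, h6⟩ := main_zone (hb.imp le_of_lt le_of_lt)
  obtain ⟨d1, d2, d3⟩ := deriv_main_zone hb
  have hth : th u = u.1 := congrArg Prod.fst h.Lam
  have hTTy : TTy u = 0 := by unfold TTy; rw [hth, d3, h4]; simp
  have hTTx : TTx u = 1 := by unfold TTx; rw [hTTy]; simp
  have hTT : TT u = (1, 0, 0) := by unfold TT; rw [hTTx, hTTy, d1, d2]; simp
  have hUU : UU u = (0, 0, 1) := by unfold UU; rw [h1, h2]; simp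
  unfold QQ
  rw [h.Lam, hTT, hUU]
  unfold ff gg
  rw [h6]
  rcases h with ⟨a, b⟩ | ⟨a, b⟩
  · have b' := abs_lt.1 b
    rw [bmp_eq_one (b.le.trans (by norm_num)), bmp_eq_zero (x := u.2.2 - 1)
      (by rw [le_abs]; right; linarith)]
    obtain ⟨e1, e2, -⟩ := ee_zone₄ (x := u.1 + 3)
      (by rw [show u.1 + 3 - 4 = u.1 - 1 by ring]; exact a.le.trans (by norm_num))
    rw [e1, e2]
    simp
  · have b' := abs_lt.1 b
    rw [bmp_eq_one (x := u.2.2 - 1) (b.le.trans (by norm_num)), bmp_eq_zero (x := u.2.2 + 1)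
      (by rw [le_abs]; left; linarith)]
    obtain ⟨e1, e2, -⟩ := ee_zone₅ (x := u.1 + 3)
      (by rw [show u.1 + 3 - 5 = u.1 - 2 by ring]; exact a.le.trans (by norm_num))
    rw [e1, e2]
    simp

theorem ff_gg_of_nbmp {w : ℝ × ℝ × ℝ}
    (h : nbmp w.2.1 = 0 ∨ bmp (w.2.2 + 1) = 0 ∧ bmp (w.2.2 - 1) = 0) : ff w = 0 ∧ gg w = 1 := by
  unfold ff gg
  rcases h with h | ⟨h, h'⟩
  · rw [h]; simp
  · rw [h, h']; simp

theorem ff_gg_outside {w : ℝ × ℝ × ℝ} (h : 1 / 2000 ≤ |w.2.1| ∨ 3 / 2 ≤ |w.2.2|) :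
    ff w = 0 ∧ gg w = 1 := by
  apply ff_gg_of_nbmp
  rcases h with h | h
  · exact Or.inl (nbmp_eq_zero h)
  · right
    constructor <;> apply bmp_eq_zero <;> rw [le_abs] at * <;> rcases h with h | h
    · left; linarith
    · right; linarith
    · left; linarith
    · right; linarith

theorem QQ_ne {v : ℝ × ℝ × ℝ} (h : QQ v ≠ 0) :
    |rr v| < 1 / 2000 ∧ |zz v| < 3 / 2 ∧ nbmp (rr v) ≠ 0 := by
  have key : ∀ h' : nbmp (rr v) = 0 ∨ 1 / 2000 ≤ |rr v| ∨ 3 / 2 ≤ |zz v|, False := by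
    intro h'
    have : ff (Lam v) = 0 ∧ gg (Lam v) = 1 := by
      rcases h' with h' | h'
      · exact ff_gg_of_nbmp (Or.inl h')
      · exact ff_gg_outside h'
    apply h
    unfold QQ
    rw [this.1, this.2]
    simp
  refine ⟨?_, ?_, ?_⟩
  · by_contra hc; exact key (Or.inr (Or.inl (not_lt.1 hc)))
  · by_contra hc; exact key (Or.inr (Or.inr (not_lt.1 hc)))
  · intro hc; exact key (Or.inl hc)

theorem GG_of_QQ_ne {v : ℝ × ℝ × ℝ} (h : QQ v ≠ 0) : GG v := by
  have := QQ_ne h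
  exact ⟨by linarith [this.1], by linarith [this.2.1]⟩

/-- Inside the plug, away from the part of the finger nested in it, the field is the one of the
plug. -/
theorem PP_eq {v : ℝ × ℝ × ℝ} (h : GG v) (hn : ¬ Nest v) :
    PP v = ff (Lam v) • TT v + gg (Lam v) • UU v := by
  have key : (0, 0, 1) + QQ (sh 3 v) = UU v := by
    by_cases h0 : ee v.1 * nbmp v.2.1 = 0
    · have h1 := (zone_facts h).2.2.2.2.1
      rw [h0, abs_zero] at h1
      have hU : UU v = (0, 0, 1) := by unfold UU; rw [h0, h1]; simp
      rw [hU]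
      suffices QQ (sh 3 v) = 0 by rw [this, add_zero]
      by_contra hQ
      have hg := GG_of_QQ_ne hQ
      obtain ⟨-, k, hk | hk⟩ := inter_cases h hg
      · apply hn
        refine ⟨?_, ?_, ?_⟩
        · have := hk.child
          rw [sh_comm, Child_sh] at this
          exact this
        · linarith [(QQ_ne hQ).1]
        · linarith [(QQ_ne hQ).2.1]
      · have hL := hk.Lam
        have hr : rr (sh 3 v) = v.2.1 := by
          rw [← rr_sh _ k]
          exact congrArg (fun w => w.2.1) hL
        have he := (QQ_of_MZ hk).2.1
        have he' : (sh (6 * k) (sh 3 v)).1 + 3 = v.1 + 6 * (k + 1 : ℤ) := by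
          simp only [sh_fst]; push_cast; ring
        rw [he', ee_add_int] at he
        have h3 := (QQ_ne hQ).2.2
        rw [hr] at h3
        have h4 : ee v.1 ≠ 0 := fun h5 => by rw [h5] at he; norm_num at he
        exact mul_ne_zero h4 h3 h0
    · obtain ⟨hy, k, hk⟩ | h1 := (zone_cases h).symm
      · have hM : MZ (sh (6 * k - 3) v) := by
          rcases hk with ⟨a, -, b⟩ | ⟨a, -, b⟩
          · left
            simp only [sh_fst, sh_snd] at a b ⊢
            exact ⟨by rw [show v.1 + (6 * k - 3) - 1 = v.1 + 6 * k - 4 by ring]; exact a, b⟩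
          · right
            simp only [sh_fst, sh_snd] at a b ⊢
            exact ⟨by rw [show v.1 + (6 * k - 3) - 2 = v.1 + 6 * k - 5 by ring]; exact a, b⟩
        obtain ⟨q1, q2, q3⟩ := QQ_of_MZ hM
        have e1 : (sh (6 * k - 3) v).1 + 3 = v.1 + 6 * k := by rw [sh_fst]; ring
        rw [e1, ee_add_int] at q1
        rw [e1, ea_add_int] at q3
        have e2 : QQ (sh (6 * k - 3) v) = QQ (sh 3 v) := by
          rw [← QQ_sh (sh 3 v) (k - 1), sh_sh]
          congr 2
          push_cast
          ring
        rw [← e2, q1]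
        unfold UU
        rw [q3]
        simp [sub_eq_add_neg]
      · exact absurd h1 h0
  unfold PP
  rw [add_right_comm, key]
  unfold QQ
  rw [sub_smul, one_smul]
  abel

end Kuperberg

namespace Kuperberg

open Set Filter Topology
open scoped ContDiff

theorem bmp_or (z : ℝ) : bmp (z + 1) = 0 ∨ bmp (z - 1) = 0 := by
  rcases le_total z 0 with h | h
  · right; apply bmp_eq_zero; rw [le_abs]; right; linarith
  · left; apply bmp_eq_zero; rw [le_abs]; left; linarith

theorem bmp_sum_nonneg (z : ℝ) : 0 ≤ bmp (z + 1) + bmp (z - 1) :=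
  add_nonneg (bmp_nonneg _) (bmp_nonneg _)

theorem bmp_sum_le (z : ℝ) : bmp (z + 1) + bmp (z - 1) ≤ 1 := by
  rcases bmp_or z with h | h <;> rw [h]
  · simpa using bmp_le_one _
  · simpa using bmp_le_one _

theorem nn_div_nonneg (w) : 0 ≤ nn w / (1 + nn w) := by have := nn_nonneg w; positivity
theorem nn_div_le (w) : nn w / (1 + nn w) ≤ 1 := by
  have := nn_nonneg w
  rw [div_le_one (by linarith)]; linarith

theorem gg_aux (w : ℝ × ℝ × ℝ) : 0 ≤ (1 - chi w.1) * (nn w / (1 + nn w)) ∧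
    (1 - chi w.1) * (nn w / (1 + nn w)) ≤ 1 := by
  have h1 := nn_div_nonneg w
  have h2 := nn_div_le w
  have h3 := chi_nonneg w.1
  have h4 := chi_le_one w.1
  exact ⟨mul_nonneg (by linarith) h1, mul_le_one₀ (by linarith) h1 h2⟩

theorem gg_le_one (w) : gg w ≤ 1 := by
  have h1 := bmp_sum_nonneg w.2.2
  have h2 := nbmp_nonneg w.2.1
  have h3 := (gg_aux w).2
  unfold gg
  have : 0 ≤ nbmp w.2.1 * (bmp (w.2.2 + 1) + bmp (w.2.2 - 1)) *
    (1 - (1 - chi w.1) * (nn w / (1 + nn w))) := by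
    apply mul_nonneg (mul_nonneg h2 h1); linarith
  linarith

theorem nbmp_mul_le (w : ℝ × ℝ × ℝ) :
    nbmp w.2.1 * (bmp (w.2.2 + 1) + bmp (w.2.2 - 1)) ≤ 1 :=
  mul_le_one₀ (nbmp_le_one _) (bmp_sum_nonneg _) (bmp_sum_le _)

theorem gg_nonneg (w) : 0 ≤ gg w := by
  have h3 := gg_aux w
  have := mul_le_one₀ (nbmp_mul_le w) (by linarith [h3.2]) (by linarith [h3.1] :
    1 - (1 - chi w.1) * (nn w / (1 + nn w)) ≤ 1)
  unfold gg
  linarith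

theorem gg_eq_zero {w} (h : gg w = 0) : (1 - chi w.1) * nn w = 0 ∧ nbmp w.2.1 = 1 ∧
    (bmp (w.2.2 + 1) = 1 ∧ bmp (w.2.2 - 1) = 0 ∨ bmp (w.2.2 + 1) = 0 ∧ bmp (w.2.2 - 1) = 1) := by
  have h3 := gg_aux w
  have h4 := nbmp_mul_le w
  have h5 := nbmp_nonneg w.2.1
  have h6 := bmp_sum_nonneg w.2.2
  have h7 := nbmp_le_one w.2.1
  have h8 := bmp_sum_le w.2.2
  have hn := nn_nonneg w
  unfold gg at h
  set A := nbmp w.2.1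
  set B := bmp (w.2.2 + 1) + bmp (w.2.2 - 1) with hB
  set c := (1 - chi w.1) * (nn w / (1 + nn w)) with hc
  have hAB : 0 ≤ A * B := mul_nonneg h5 h6
  have c1 : A * B = 1 := by nlinarith
  have c2 : c = 0 := by rw [c1] at h; linarith
  have c3 : A = 1 := by nlinarith
  have c4 : B = 1 := by rw [c3] at c1; linarith
  refine ⟨?_, c3, ?_⟩
  · rw [hc, ← mul_div_assoc, div_eq_zero_iff] at c2
    rcases c2 with c2 | c2
    · exact c2
    · linarith
  · rcases bmp_or w.2.2 with h | h
    · right; exact ⟨h, by rw [h, zero_add] at hB; rw [← hB, c4]⟩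
    · left; exact ⟨by rw [h, add_zero] at hB; rw [← hB, c4], h⟩

theorem ff_of_gg_eq_zero {w} (h : gg w = 0) : ff w = 1 ∨ ff w = -1 := by
  obtain ⟨-, h1, h2 | h2⟩ := gg_eq_zero h <;> unfold ff <;> rw [h1, h2.1, h2.2] <;> norm_num

theorem WW_ne_zero (w) : WW w ≠ 0 := by
  intro h
  have h1 : ff w = 0 := congrArg Prod.fst h
  have h2 : gg w / kk w.1 = 0 := congrArg (fun u => u.2.2) h
  have h3 : gg w = 0 := by
    rcases div_eq_zero_iff.1 h2 with h | h
    · exact h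
    · exact absurd h (kk_ne_zero _)
  rcases ff_of_gg_eq_zero h3 with h | h <;> rw [h1] at h <;> norm_num at h

theorem abs_ff_le (w) : |ff w| ≤ 1 := by
  have h2 := nbmp_nonneg w.2.1
  have h3 := nbmp_le_one w.2.1
  unfold ff
  rw [abs_mul, abs_of_nonneg h2]
  apply mul_le_one₀ h3 (abs_nonneg _)
  rw [abs_le]
  constructor <;> linarith [bmp_nonneg (w.2.2 + 1), bmp_nonneg (w.2.2 - 1), bmp_le_one (w.2.2 + 1),
    bmp_le_one (w.2.2 - 1)]

theorem norm_WW_le (w) : ‖WW w‖ ≤ 100 := by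
  have h1 := abs_ff_le w
  have h2 := gg_nonneg w
  have h3 := gg_le_one w
  have h4 := kk_pos w.1
  have h5 : gg w / kk w.1 ≤ 100 := by rw [div_le_iff₀ (by linarith)]; nlinarith
  have h6 : 0 ≤ gg w / kk w.1 := by positivity
  simp only [WW, Prod.norm_def, Real.norm_eq_abs, abs_zero, max_le_iff, abs_of_nonneg h6]
  refine ⟨by linarith, by norm_num, h5⟩

theorem op_cases (v) : (QQ v = 0 ∧ QQ (sh 3 v) = 0) ∨
    ∃ w, (w = v ∨ w = sh 3 v) ∧ GG w ∧ ¬ Nest w ∧ PP v = PP w := by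
  have aux : ∀ u, GG u → ∃ w, (w = u ∨ w = sh 3 u) ∧ GG w ∧ ¬ Nest w ∧ PP u = PP w := by
    intro u hu
    by_cases hn : Nest u
    · obtain ⟨h1, h2, -⟩ := not_nest_of_nest hu hn
      exact ⟨_, Or.inr rfl, h1, h2, (PP_sh_three u).symm⟩
    · exact ⟨u, Or.inl rfl, hu, hn, rfl⟩
  by_cases h : QQ v = 0
  · by_cases h' : QQ (sh 3 v) = 0
    · exact Or.inl ⟨h, h'⟩
    · right
      obtain ⟨w, h1 | h1, h2, h3, h4⟩ := aux _ (GG_of_QQ_ne h')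
      · exact ⟨w, Or.inr h1, h2, h3, by rw [← h4, PP_sh_three]⟩
      · have e : w = sh (6 * (1 : ℤ)) v := by rw [h1, sh_sh]; norm_num
        refine ⟨v, Or.inl rfl, ?_, ?_, rfl⟩
        · rw [e, GG_sh] at h2; exact h2
        · rw [e, Nest_sh] at h3; exact h3
  · exact Or.inr (aux _ (GG_of_QQ_ne h))

theorem PP_ne_zero (v) : PP v ≠ 0 := by
  rcases op_cases v with ⟨h1, h2⟩ | ⟨w, -, h1, h2, h3⟩
  · unfold PP
    rw [h1, h2]
    simp
  · rw [h3, PP_eq h1 h2]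
    intro h0
    have hc := hasDerivAt_const (0 : ℝ) w
    rw [← h0] at hc
    have := hasDerivAt_Lam (v := fun _ => w) (t := 0) h1 hc
    exact WW_ne_zero _ (this.unique (hasDerivAt_const _ _))

theorem rr_sub (v) : 0 ≤ rr v - v.2.1 ∧ rr v - v.2.1 ≤ 2 := by
  have h1 := cc_nonneg (th v)
  have h2 := cc_le_one (th v)
  have h3 := bend_nonneg v
  have h4 := bend_le v
  have : rr v - v.2.1 = cc (th v) * bend v := by unfold rr; ring
  rw [this]
  constructor <;> nlinarith

theorem abs_le_of_GG {v} (h : GG v) : |v.2.1| < 5 / 2 ∧ |v.2.2| ≤ 10 := by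
  have h1 := rr_sub v
  have h2 := abs_le.1 h.1
  have h3 := abs_le.1 (abs_hd_le h)
  have h4 := kk_le_one v.1
  have h5 := abs_le.1 (abs_hh_le v.1)
  have : v.2.2 = hd v + hh v.1 := by unfold hd; ring
  exact ⟨abs_lt.2 ⟨by linarith, by linarith⟩, abs_le.2 ⟨by linarith, by linarith⟩⟩

theorem QQ_eq_zero {v : ℝ × ℝ × ℝ} (h : 5 / 2 ≤ |v.2.1| ∨ 10 < |v.2.2|) : QQ v = 0 := by
  by_contra hc
  have := abs_le_of_GG (GG_of_QQ_ne hc)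
  rcases h with h | h <;> linarith [this.1, this.2]

theorem PP_eq_of_outside {v : ℝ × ℝ × ℝ} (h : 5 / 2 ≤ |v.2.1| ∨ 10 < |v.2.2|) :
    PP v = (0, 0, 1) := by
  unfold PP
  rw [QQ_eq_zero h, QQ_eq_zero (v := sh 3 v) h]
  simp

theorem exists_bound_PP : ∃ M, ∀ v, ‖PP v‖ ≤ M := by
  have hK : IsCompact (Icc (0 : ℝ) 3 ×ˢ Icc (-(5 / 2) : ℝ) (5 / 2) ×ˢ Icc (-10 : ℝ) 10) :=
    isCompact_Icc.prod (isCompact_Icc.prod isCompact_Icc)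
  obtain ⟨M, hM⟩ := hK.exists_bound_of_continuousOn contDiff_PP.continuous.continuousOn
  refine ⟨max M 1, fun v => ?_⟩
  by_cases hv : 5 / 2 ≤ |v.2.1| ∨ 10 < |v.2.2|
  · rw [PP_eq_of_outside hv]
    simp [Prod.norm_def]
  · push Not at hv
    have h1 := abs_lt.1 hv.1
    have h2 := abs_le.1 hv.2
    have e : PP (sh (3 * (-⌊v.1 / 3⌋ : ℤ)) v) = PP v := PP_sh _ _
    have f1 := Int.floor_le (v.1 / 3)
    have f2 := Int.lt_floor_add_one (v.1 / 3)
    rw [← e]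
    refine (hM (sh (3 * (-⌊v.1 / 3⌋ : ℤ)) v) ⟨⟨?_, ?_⟩, ⟨h1.1.le, h1.2.le⟩, h2⟩).trans (le_max_left _ _) <;>
      simp only [sh_fst] <;> push_cast <;> linarith

end Kuperberg

namespace Kuperberg

open Set Filter Topology
open scoped ContDiff

/-! ### Dynamics of the Wilson-type field -/

theorem contDiff_one_WW : ContDiff ℝ 1 WW := contDiff_WW.of_le (by simp)

theorem hasDerivAt_sh {v : ℝ → ℝ × ℝ × ℝ} {w : ℝ × ℝ × ℝ} {t : ℝ} (c : ℝ)
    (h : HasDerivAt v w t) : HasDerivAt (fun s => sh c (v s)) w t :=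
  ((hasDerivAt_fst' h).add_const c).prodMk (hasDerivAt_snd' h)

theorem IsSol.sh_WW {σ : ℝ → ℝ × ℝ × ℝ} (h : IsSol WW σ) (k : ℤ) :
    IsSol WW fun t => sh (6 * k) (σ t) := by
  intro t
  rw [WW_sh]
  exact hasDerivAt_sh _ (h t)

theorem exists_isSol_WW (t₀ x₀) : ∃ σ, σ t₀ = x₀ ∧ IsSol WW σ :=
  exists_isSol contDiff_one_WW norm_WW_le t₀ x₀

section
variable {σ : ℝ → ℝ × ℝ × ℝ} (h : IsSol WW σ)
include h

theorem IsSol.hasDerivAt_z (t : ℝ) :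
    HasDerivAt (fun s => (σ s).2.2) (gg (σ t) / kk (σ t).1) t :=
  hasDerivAt_snd' (hasDerivAt_snd' (h t))

theorem IsSol.r_eq (s t : ℝ) : (σ s).2.1 = (σ t).2.1 :=
  is_const_of_deriv_eq_zero (f := fun s => (σ s).2.1)
    (fun t => (hasDerivAt_fst' (hasDerivAt_snd' (h t))).differentiableAt)
    (fun t => (hasDerivAt_fst' (hasDerivAt_snd' (h t))).deriv) s t

theorem IsSol.z_mono : Monotone fun s => (σ s).2.2 := by
  apply monotone_of_deriv_nonneg fun t => (h.hasDerivAt_z t).differentiableAt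
  intro t
  rw [(h.hasDerivAt_z t).deriv]
  exact div_nonneg (gg_nonneg _) (by linarith [kk_pos (σ t).1])

theorem IsSol.gg_eq_zero_of_z_eq {s t : ℝ} (hst : s < t) (hz : (σ s).2.2 = (σ t).2.2) :
    gg (σ ((s + t) / 2)) = 0 := by
  have hev : (fun u => (σ u).2.2) =ᶠ[𝓝 ((s + t) / 2)] fun _ => (σ s).2.2 := by
    filter_upwards [Ioo_mem_nhds (by linarith : s < (s + t) / 2)
      (by linarith : (s + t) / 2 < t)] with u hu
    apply le_antisymm
    · rw [hz]; exact h.z_mono hu.2.le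
    · exact h.z_mono hu.1.le
  have h1 := hev.deriv_eq
  rw [(h.hasDerivAt_z _).deriv, deriv_const] at h1
  rcases div_eq_zero_iff.1 h1 with h2 | h2
  · exact h2
  · exact absurd h2 (kk_ne_zero _)

theorem IsSol.eq_of_z_eq {s t : ℝ} (hz : (σ s).2.2 = (σ t).2.2) (h2 : 3 / 2 ≤ |(σ s).2.2|) :
    s = t := by
  have key : ∀ {s t : ℝ}, s < t → (σ s).2.2 = (σ t).2.2 → 3 / 2 ≤ |(σ s).2.2| → False := by
    intro s t hst hz h2
    have h3 := h.gg_eq_zero_of_z_eq hst hz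
    have h4 : (σ ((s + t) / 2)).2.2 = (σ s).2.2 := by
      apply le_antisymm
      · rw [hz]; exact h.z_mono (by linarith)
      · exact h.z_mono (by linarith)
    rw [(ff_gg_outside (Or.inr (h4 ▸ h2))).2] at h3
    norm_num at h3
  rcases lt_trichotomy s t with h1 | h1 | h1
  · exact (key h1 hz h2).elim
  · exact h1
  · exact (key h1 hz.symm (hz ▸ h2)).elim

end

/-- Reflection of the plug in its middle level. -/
def refl (w : ℝ × ℝ × ℝ) : ℝ × ℝ × ℝ := (w.1, w.2.1, -w.2.2)

theorem ff_refl (w) : ff (refl w) = -ff w := by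
  unfold ff refl
  rw [show -w.2.2 + 1 = -(w.2.2 - 1) by ring, show -w.2.2 - 1 = -(w.2.2 + 1) by ring, bmp_neg,
    bmp_neg]
  ring

theorem gg_refl (w) : gg (refl w) = gg w := by
  unfold gg nn refl
  simp only
  rw [show -w.2.2 + 1 = -(w.2.2 - 1) by ring, show -w.2.2 - 1 = -(w.2.2 + 1) by ring, bmp_neg,
    bmp_neg]
  ring

theorem IsSol.refl {σ : ℝ → ℝ × ℝ × ℝ} (h : IsSol WW σ) (c : ℝ) :
    IsSol WW fun t => Kuperberg.refl (σ (c - t)) := by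
  intro t
  have h1 : HasDerivAt (fun s => c - s) (-1) t := by simpa using (hasDerivAt_id t).const_sub c
  have h2 := (h (c - t)).scomp t h1
  have h3 := (hasDerivAt_fst' h2).prodMk ((hasDerivAt_fst' (hasDerivAt_snd' h2)).prodMk
    (hasDerivAt_snd' (hasDerivAt_snd' h2)).neg)
  refine h3.congr_deriv ?_
  unfold WW
  rw [ff_refl, gg_refl]
  simp [Kuperberg.refl]

/-- A trajectory which crosses the plug leaves it opposite its entrance. -/
theorem IsSol.facing {σ : ℝ → ℝ × ℝ × ℝ} (h : IsSol WW σ) {s t : ℝ} (hs : (σ s).2.2 = -2)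
    (ht : (σ t).2.2 = 2) : (σ t).1 = (σ s).1 ∧ (σ t).2.1 = (σ s).2.1 := by
  have hst : s ≤ t := by
    by_contra hc
    have h1 := h.z_mono (not_le.1 hc).le
    simp only [hs, ht] at h1
    norm_num at h1
  have hc : ContinuousOn (fun s => (σ s).2.2) (Icc s t) :=
    fun u _ => (h.hasDerivAt_z u).continuousAt.continuousWithinAt
  obtain ⟨t₀, -, h0⟩ := intermediate_value_Icc hst hc (show (0 : ℝ) ∈ Icc _ _ by
    simp only [hs, ht]; norm_num)
  have heq : σ = fun t => Kuperberg.refl (σ (2 * t₀ - t)) := by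
    refine IsSol.unique contDiff_one_WW h (h.refl (2 * t₀)) (t₀ := t₀) ?_
    simp only at h0 ⊢
    rw [show 2 * t₀ - t₀ = t₀ by ring]
    unfold Kuperberg.refl
    rw [h0, neg_zero, ← h0]
  have h1 := congrFun heq (2 * t₀ - s)
  simp only [sub_sub_cancel] at h1
  have h2 : 2 * t₀ - s = t := by
    apply h.eq_of_z_eq
    · rw [h1, ht]; simp [Kuperberg.refl, hs]
    · rw [h1]; simp [Kuperberg.refl, hs]; norm_num
  rw [h2] at h1
  rw [h1]
  exact ⟨rfl, rfl⟩

theorem WW_circle {w : ℝ × ℝ × ℝ} (hr : w.2.1 = 0) (hz : w.2.2 = -1 ∨ w.2.2 = 1) :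
    WW w = (-w.2.2, 0, 0) := by
  have hn : nn w = 0 := by
    unfold nn; rw [hr]; rcases hz with h | h <;> rw [h] <;> norm_num
  have h2 : bmp 2 = 0 := bmp_eq_zero (by rw [abs_of_pos] <;> norm_num)
  have h0 : bmp 0 = 1 := bmp_eq_one (by norm_num)
  have h3 : bmp (-2) = 0 := by rw [bmp_neg, h2]
  have hg : gg w = 0 := by
    unfold gg; rw [hn, hr, nbmp_zero]
    rcases hz with h | h <;> rw [h] <;> norm_num <;> simp [h0, h2, h3]
  have hf : ff w = -w.2.2 := by
    unfold ff; rw [hr, nbmp_zero]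
    rcases hz with h | h <;> rw [h] <;> norm_num <;> simp [h0, h2, h3]
  unfold WW
  rw [hf, hg, zero_div]

theorem isSol_circle {w : ℝ × ℝ × ℝ} (hr : w.2.1 = 0) (hz : w.2.2 = -1 ∨ w.2.2 = 1) (t₀ : ℝ) :
    IsSol WW fun t => sh (-w.2.2 * (t - t₀)) w := by
  intro t
  rw [WW_circle (w := sh _ w) hr hz]
  have : HasDerivAt (fun s => w.1 + -w.2.2 * (s - t₀)) (-w.2.2) t := by
    simpa using (((hasDerivAt_id t).sub_const t₀).const_mul (-w.2.2)).const_add w.1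
  exact this.prodMk (hasDerivAt_const t w.2)

/-- The two circles are invariant. -/
theorem IsSol.eq_circle {σ : ℝ → ℝ × ℝ × ℝ} (h : IsSol WW σ) {t₀ : ℝ} (hr : (σ t₀).2.1 = 0)
    (hz : (σ t₀).2.2 = -1 ∨ (σ t₀).2.2 = 1) (t : ℝ) :
    σ t = sh (-(σ t₀).2.2 * (t - t₀)) (σ t₀) :=
  congrFun (IsSol.unique contDiff_one_WW h (isSol_circle hr hz t₀) (t₀ := t₀) (by simp)) t

/-- The two circles are the only closed orbits. -/
theorem IsSol.closed {σ : ℝ → ℝ × ℝ × ℝ} (h : IsSol WW σ) {s t : ℝ} (hst : s < t) {k : ℤ}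
    (hk : σ t = sh (6 * k) (σ s)) : (σ s).2.1 = 0 ∧ ((σ s).2.2 = -1 ∨ (σ s).2.2 = 1) := by
  have hper : ∀ u, σ (u + (t - s)) = sh (6 * k) (σ u) := fun u =>
    congrFun (IsSol.unique contDiff_one_WW (h.comp_add (t - s)) (h.sh_WW k) (t₀ := s)
      (by simp [hk])) u
  have hg : ∀ u, gg (σ u) = 0 := by
    intro u
    have := h.gg_eq_zero_of_z_eq (s := u - (t - s) / 2) (t := u - (t - s) / 2 + (t - s))
      (by linarith) (by rw [hper]; rfl)
    rwa [show (u - (t - s) / 2 + (u - (t - s) / 2 + (t - s))) / 2 = u by ring] at this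
  have hz : ∀ u, (σ u).2.2 = (σ s).2.2 := by
    intro u
    refine is_const_of_deriv_eq_zero (f := fun s => (σ s).2.2)
      (fun t => (h.hasDerivAt_z t).differentiableAt) (fun t => ?_) u s
    rw [(h.hasDerivAt_z t).deriv, hg, zero_div]
  have hf : ∀ u, ff (σ u) = ff (σ s) := by
    intro u; unfold ff; rw [hz u, h.r_eq u s]
  have hθ : ∀ u, (σ u).1 = (σ s).1 + ff (σ s) * (u - s) := by
    intro u
    have hd : ∀ u, HasDerivAt (fun u => (σ u).1 - ff (σ s) * (u - s)) 0 u := by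
      intro u
      refine ((hasDerivAt_fst' (h u)).sub
        (((hasDerivAt_id u).sub_const s).const_mul (ff (σ s)))).congr_deriv ?_
      simp [WW, hf u]
    have := is_const_of_deriv_eq_zero (fun u => (hd u).differentiableAt) (fun u => (hd u).deriv) u s
    simp at this
    linarith
  have h3 : (σ (s + ff (σ s) * (3 - (σ s).1))).1 = 3 := by
    rw [hθ]
    rcases ff_of_gg_eq_zero (hg s) with h | h <;> rw [h] <;> ring
  have h4 := (gg_eq_zero (hg (s + ff (σ s) * (3 - (σ s).1)))).1
  have h5 : chi 3 = 0 := by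
    rw [chi_eq (by norm_num) (by norm_num), bmp_eq_zero, bmp_eq_zero] <;> norm_num
  rw [h3, h5, sub_zero, one_mul] at h4
  unfold nn at h4
  rw [hz, h.r_eq _ s] at h4
  have h6 : (σ s).2.1 ^ 2 = 0 := by nlinarith [sq_nonneg (σ s).2.1, sq_nonneg ((σ s).2.2 ^ 2 - 1)]
  have h7 : ((σ s).2.2 ^ 2 - 1) ^ 2 = 0 := by
    nlinarith [sq_nonneg (σ s).2.1, sq_nonneg ((σ s).2.2 ^ 2 - 1)]
  refine ⟨pow_eq_zero_iff (two_ne_zero) |>.1 h6, ?_⟩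
  have h8 : ((σ s).2.2 + 1) * ((σ s).2.2 - 1) = 0 := by
    have := pow_eq_zero_iff (two_ne_zero) |>.1 h7
    linarith
  rcases mul_eq_zero.1 h8 with h | h
  · left; linarith
  · right; linarith

end Kuperberg

namespace Kuperberg

open Set Filter Topology
open scoped ContDiff

/-! ### The box in the three-sphere -/

abbrev E4 := EuclideanSpace ℝ (Fin 4)

noncomputable def aa : ℝ := 1 / 1000
noncomputable def bb : ℝ := √2 / 1000
noncomputable def eta (v : ℝ × ℝ × ℝ) : ℝ := v.2.1 / 100
noncomputable def alp (v : ℝ × ℝ × ℝ) : ℝ := 2 * Real.pi * (v.1 - 3 / 8) / 3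

/-- Complex coordinates of the box at height `0`. -/
noncomputable def P1 (v : ℝ × ℝ × ℝ) : ℝ := Real.cos (eta v) * Real.cos (alp v)
noncomputable def Q1 (v : ℝ × ℝ × ℝ) : ℝ := -(Real.sin (eta v) * Real.sin (alp v))
noncomputable def P2 (v : ℝ × ℝ × ℝ) : ℝ := Real.cos (eta v) * Real.sin (alp v)
noncomputable def Q2 (v : ℝ × ℝ × ℝ) : ℝ := Real.sin (eta v) * Real.cos (alp v)

/-- The base flow. -/
noncomputable def DD (t : ℝ) (p : E4) : E4 :=
  !₂[Real.cos (aa * t) * p 0 - Real.sin (aa * t) * p 1,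
    Real.sin (aa * t) * p 0 + Real.cos (aa * t) * p 1,
    Real.cos (bb * t) * p 2 - Real.sin (bb * t) * p 3,
    Real.sin (bb * t) * p 2 + Real.cos (bb * t) * p 3]

/-- The base vector field. -/
noncomputable def X0 (p : E4) : E4 := !₂[-aa * p 1, aa * p 0, -bb * p 3, bb * p 2]

/-- The parametrization of the box. -/
noncomputable def ps (v : ℝ × ℝ × ℝ) : E4 := DD v.2.2 !₂[P1 v, Q1 v, P2 v, Q2 v]

theorem E4_ext {p q : E4} (h0 : p 0 = q 0) (h1 : p 1 = q 1) (h2 : p 2 = q 2) (h3 : p 3 = q 3) :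
    p = q := by
  ext i
  fin_cases i
  exacts [h0, h1, h2, h3]

@[simp] theorem mk_0 (a b c d : ℝ) : (!₂[a, b, c, d] : E4) 0 = a := rfl
@[simp] theorem mk_1 (a b c d : ℝ) : (!₂[a, b, c, d] : E4) 1 = b := rfl
@[simp] theorem mk_2 (a b c d : ℝ) : (!₂[a, b, c, d] : E4) 2 = c := rfl
@[simp] theorem mk_3 (a b c d : ℝ) : (!₂[a, b, c, d] : E4) 3 = d := rfl

section
variable (t : ℝ) (p : E4)
@[simp] theorem DD_0 : DD t p 0 = Real.cos (aa * t) * p 0 - Real.sin (aa * t) * p 1 := rfl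
@[simp] theorem DD_1 : DD t p 1 = Real.sin (aa * t) * p 0 + Real.cos (aa * t) * p 1 := rfl
@[simp] theorem DD_2 : DD t p 2 = Real.cos (bb * t) * p 2 - Real.sin (bb * t) * p 3 := rfl
@[simp] theorem DD_3 : DD t p 3 = Real.sin (bb * t) * p 2 + Real.cos (bb * t) * p 3 := rfl
end

theorem DD_zero (p) : DD 0 p = p := by
  apply E4_ext <;> simp

theorem DD_add (s t p) : DD (s + t) p = DD s (DD t p) := by
  apply E4_ext <;> simp only [DD_0, DD_1, DD_2, DD_3, mul_add, Real.cos_add, Real.sin_add] <;> ring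

theorem DD_ps (t v) : DD t (ps v) = ps (v.1, v.2.1, v.2.2 + t) := by
  unfold ps
  rw [← DD_add, add_comm]
  rfl

theorem hasDerivAt_E4 {f : ℝ → E4} {f' : E4} {t : ℝ} (h : ∀ i, HasDerivAt (fun s => f s i) (f' i) t) :
    HasDerivAt f f' t := by
  have h1 : HasDerivAt (fun s i => f s i) (fun i => f' i) t := hasDerivAt_pi.2 h
  exact ((PiLp.continuousLinearEquiv 2 ℝ fun _ : Fin 4 => ℝ).symm.toContinuousLinearMap
    |>.hasFDerivAt (x := fun i => f t i)).comp_hasDerivAt t h1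

theorem hasDerivAt_E4_apply {f : ℝ → E4} {f' : E4} {t : ℝ} (h : HasDerivAt f f' t) (i : Fin 4) :
    HasDerivAt (fun s => f s i) (f' i) t :=
  ((EuclideanSpace.proj (𝕜 := ℝ) i).hasFDerivAt (x := f t)).comp_hasDerivAt t h

theorem isSol_DD (p : E4) (t₀ : ℝ) : IsSol X0 fun t => DD (t - t₀) p := by
  intro t
  have h1 : HasDerivAt (fun s => aa * (s - t₀)) aa t := by
    simpa using ((hasDerivAt_id t).sub_const t₀).const_mul aa
  have h2 : HasDerivAt (fun s => bb * (s - t₀)) bb t := by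
    simpa using ((hasDerivAt_id t).sub_const t₀).const_mul bb
  apply hasDerivAt_E4
  intro i
  fin_cases i
  · refine ((h1.cos.mul_const (p 0)).sub (h1.sin.mul_const (p 1))).congr_deriv ?_
    simp [X0]; ring
  · refine ((h1.sin.mul_const (p 0)).add (h1.cos.mul_const (p 1))).congr_deriv ?_
    simp [X0]; ring
  · refine ((h2.cos.mul_const (p 2)).sub (h2.sin.mul_const (p 3))).congr_deriv ?_
    simp [X0]; ring
  · refine ((h2.sin.mul_const (p 2)).add (h2.cos.mul_const (p 3))).congr_deriv ?_
    simp [X0]; ring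

theorem contDiff_X0 : ContDiff ℝ ∞ X0 := by
  unfold X0
  rw [contDiff_euclidean]
  intro i
  fin_cases i <;> simp <;> fun_prop

theorem contDiff_ps : ContDiff ℝ ∞ ps := by
  unfold ps DD P1 Q1 P2 Q2 eta alp
  rw [contDiff_euclidean]
  intro i
  fin_cases i <;> simp <;> fun_prop

theorem norm_sq_E4 (p : E4) : ‖p‖ ^ 2 = p 0 ^ 2 + p 1 ^ 2 + p 2 ^ 2 + p 3 ^ 2 := by
  rw [EuclideanSpace.norm_sq_eq]
  simp [Fin.sum_univ_four]

theorem norm_DD (t p) : ‖DD t p‖ = ‖p‖ := by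
  rw [← sq_eq_sq₀ (norm_nonneg _) (norm_nonneg _), norm_sq_E4, norm_sq_E4]
  simp only [DD_0, DD_1, DD_2, DD_3]
  linear_combination (p 0 ^ 2 + p 1 ^ 2) * Real.cos_sq_add_sin_sq (aa * t) +
    (p 2 ^ 2 + p 3 ^ 2) * Real.cos_sq_add_sin_sq (bb * t)

theorem norm_ps (v) : ‖ps v‖ = 1 := by
  unfold ps
  rw [norm_DD, ← sq_eq_sq₀ (norm_nonneg _) zero_le_one, norm_sq_E4]
  show P1 v ^ 2 + Q1 v ^ 2 + P2 v ^ 2 + Q2 v ^ 2 = 1 ^ 2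
  simp only [P1, P2, Q1, Q2]
  have h1 := Real.cos_sq_add_sin_sq (eta v)
  have h2 := Real.cos_sq_add_sin_sq (alp v)
  linear_combination (Real.cos (alp v) ^ 2 + Real.sin (alp v) ^ 2) * h1 + h2

theorem ps_sh (v) (k : ℤ) : ps (sh (3 * k) v) = ps v := by
  have h : alp (sh (3 * k) v) = alp v + k * (2 * Real.pi) := by
    unfold alp; rw [sh_fst]; ring
  have h' : eta (sh (3 * k) v) = eta v := rfl
  unfold ps P1 Q1 P2 Q2
  rw [h, h', Real.cos_add_int_mul_two_pi, Real.sin_add_int_mul_two_pi, sh_snd]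

theorem fderiv_ps_sh (v) (k : ℤ) : fderiv ℝ ps (sh (3 * k) v) = fderiv ℝ ps v := by
  have h0 (v : ℝ × ℝ × ℝ) : sh (3 * k) v = v + ((3 * k : ℝ), 0, 0) := by
    simp [sh, Prod.ext_iff]
  have h : (fun v : ℝ × ℝ × ℝ => ps (v + ((3 * k : ℝ), 0, 0))) = ps := by
    funext v
    rw [← h0, ps_sh]
  rw [h0, ← fderiv_comp_add_right, h]

end Kuperberg

namespace Kuperberg

open Set Filter Topology
open scoped ContDiff

/-- The open box on which `ps` is an embedding modulo translations. -/
def Box (v : ℝ × ℝ × ℝ) : Prop := |v.2.1| < 3 ∧ |v.2.2| < 20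

theorem Box.sin_sq_le {v} (h : Box v) : Real.sin (eta v) ^ 2 ≤ 1 / 1000 := by
  have h1 : |eta v| ≤ 3 / 100 := by
    unfold eta; rw [abs_div, abs_of_pos (by norm_num : (0 : ℝ) < 100)]; linarith [h.1]
  have h2 : |Real.sin (eta v)| ≤ |eta v| := Real.abs_sin_le_abs
  have h3 : |Real.sin (eta v)| ≤ 3 / 100 := h2.trans h1
  rw [← sq_abs]
  nlinarith [abs_nonneg (Real.sin (eta v))]

theorem Box.cos_pos {v} (h : Box v) : 0 < Real.cos (eta v) := by
  have h1 := abs_lt.1 h.1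
  apply Real.cos_pos_of_mem_Ioo
  constructor <;> unfold eta <;> linarith [Real.pi_gt_three]

theorem P1Q1_add_P2Q2 (v) : P1 v * Q1 v + P2 v * Q2 v = 0 := by
  unfold P1 Q1 P2 Q2; ring

theorem sqrt_two_bounds : 1.41 < √(2 : ℝ) ∧ √(2 : ℝ) < 1.42 := by
  constructor
  · exact Real.lt_sqrt_of_sq_lt (by norm_num)
  · rw [Real.sqrt_lt' (by norm_num)]; norm_num

theorem twist_ne_zero {A B C S c s : ℝ} (hA : 0 < A) (hA' : A ≤ 2 / 25) (h1 : 1.41 * A < B)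
    (h2 : B < 1.42 * A) (hCS : C ^ 2 + S ^ 2 = 1) (hcs : c ^ 2 + s ^ 2 = 1) (hS : S ^ 2 ≤ 1 / 1000)
    (h : Real.sin A * (C ^ 2 * c ^ 2 - S ^ 2 * s ^ 2) + Real.sin B * (C ^ 2 * s ^ 2 - S ^ 2 * c ^ 2)
      - 2 * (Real.cos A - Real.cos B) * (C * S * c * s) = 0) : False := by
  have hsA : 0.99 * A ≤ Real.sin A := by
    have := Real.sin_gt_sub_cube hA
    nlinarith [mul_pos hA hA]
  have hsAB : Real.sin A ≤ Real.sin B := by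
    apply Real.sin_le_sin_of_le_of_le_pi_div_two <;> linarith [Real.pi_gt_three]
  have hsB : Real.sin B ≤ 1.42 * A := (Real.sin_le (by linarith)).trans h2.le
  have hcA : Real.cos A ≤ 1 := Real.cos_le_one A
  have hcB : 1 - B ^ 2 / 2 ≤ Real.cos B := Real.one_sub_sq_div_two_le_cos
  have hcAB : Real.cos B ≤ Real.cos A := by
    apply Real.cos_le_cos_of_nonneg_of_le_pi <;> linarith [Real.pi_gt_three]
  have hB2 : B ^ 2 / 2 ≤ 0.1 * A := by nlinarith
  have hM : |C * S * c * s| ≤ 1 / 4 := by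
    have e1 : |C * S| ≤ 1 / 2 := by
      rw [abs_le]; constructor <;> linarith [sq_nonneg (C + S), sq_nonneg (C - S)]
    have e2 : |c * s| ≤ 1 / 2 := by
      rw [abs_le]; constructor <;> linarith [sq_nonneg (c + s), sq_nonneg (c - s)]
    rw [mul_assoc, abs_mul]
    nlinarith [abs_nonneg (C * S), abs_nonneg (c * s)]
  have hM' := abs_le.1 hM
  have hC : 999 / 1000 ≤ C ^ 2 := by linarith
  have k1 : Real.sin A ≤ Real.sin A * c ^ 2 + Real.sin B * s ^ 2 := by
    nlinarith [mul_nonneg (sub_nonneg.2 hsAB) (sq_nonneg s)]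
  have k2 : Real.sin A * s ^ 2 + Real.sin B * c ^ 2 ≤ Real.sin B := by
    nlinarith [mul_nonneg (sub_nonneg.2 hsAB) (sq_nonneg s)]
  have k3 : 2 * (Real.cos A - Real.cos B) * (C * S * c * s) ≤ 0.2 * A * (1 / 4) := by
    have p1 : 2 * (Real.cos A - Real.cos B) ≤ 0.2 * A := by linarith
    have p2 : 0 ≤ 2 * (Real.cos A - Real.cos B) := by linarith
    exact (mul_le_mul_of_nonneg_left hM'.2 p2).trans (by linarith)
  have k4 : 999 / 1000 * Real.sin A ≤ C ^ 2 * (Real.sin A * c ^ 2 + Real.sin B * s ^ 2) := by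
    apply mul_le_mul hC k1 (by linarith) (sq_nonneg C)
  have k5 : S ^ 2 * (Real.sin A * s ^ 2 + Real.sin B * c ^ 2) ≤ 1 / 1000 * (1.42 * A) := by
    have p1 : 0 ≤ Real.sin A := by linarith
    have p2 : 0 ≤ Real.sin A * s ^ 2 + Real.sin B * c ^ 2 := by
      have := p1.trans hsAB
      positivity
    apply mul_le_mul hS (k2.trans hsB) p2 (by norm_num)
  linarith

theorem ps_z_le {v w : ℝ × ℝ × ℝ} (hv : Box v) (hw : Box w) (h : ps v = ps w) : w.2.2 ≤ v.2.2 := by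
  by_contra! hlt
  have h' := congrArg (DD (-v.2.2)) h
  rw [DD_ps, DD_ps, add_neg_cancel] at h'
  set τ := w.2.2 + -v.2.2 with hτ
  have c0 := congrArg (fun p : E4 => p 0) h'
  have c1 := congrArg (fun p : E4 => p 1) h'
  have c2 := congrArg (fun p : E4 => p 2) h'
  have c3 := congrArg (fun p : E4 => p 3) h'
  simp only [ps, DD_zero, DD_0, DD_1, DD_2, DD_3] at c0 c1 c2 c3
  replace c0 : P1 v = Real.cos (aa * τ) * P1 w - Real.sin (aa * τ) * Q1 w := c0
  replace c1 : Q1 v = Real.sin (aa * τ) * P1 w + Real.cos (aa * τ) * Q1 w := c1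
  replace c2 : P2 v = Real.cos (bb * τ) * P2 w - Real.sin (bb * τ) * Q2 w := c2
  replace c3 : Q2 v = Real.sin (bb * τ) * P2 w + Real.cos (bb * τ) * Q2 w := c3
  have hv0 := P1Q1_add_P2Q2 v
  have a1 := abs_lt.1 hv.2
  have a2 := abs_lt.1 hw.2
  have s2 := sqrt_two_bounds
  refine twist_ne_zero (A := 2 * (aa * τ)) (B := 2 * (bb * τ)) (C := Real.cos (eta w))
    (S := Real.sin (eta w)) (c := Real.cos (alp w)) (s := Real.sin (alp w)) ?_ ?_ ?_ ?_
    (Real.cos_sq_add_sin_sq _) (Real.cos_sq_add_sin_sq _) hw.sin_sq_le ?_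
  · unfold aa; linarith
  · unfold aa; linarith
  · unfold aa bb; nlinarith
  · unfold aa bb; nlinarith
  · rw [Real.sin_two_mul, Real.sin_two_mul, Real.cos_two_mul', Real.cos_two_mul']
    rw [c0, c1, c2, c3] at hv0
    unfold P1 Q1 P2 Q2 at hv0
    linear_combination 2 * hv0

theorem ps_inj {v w : ℝ × ℝ × ℝ} (hv : Box v) (hw : Box w) (h : ps v = ps w) :
    ∃ k : ℤ, w = sh (3 * k) v := by
  have hz : v.2.2 = w.2.2 := le_antisymm (ps_z_le hw hv h.symm) (ps_z_le hv hw h)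
  have h' := congrArg (DD (-v.2.2)) h
  rw [DD_ps, DD_ps, add_neg_cancel, hz, add_neg_cancel] at h'
  have c0 := congrArg (fun p : E4 => p 0) h'
  have c1 := congrArg (fun p : E4 => p 1) h'
  have c2 := congrArg (fun p : E4 => p 2) h'
  have c3 := congrArg (fun p : E4 => p 3) h'
  simp only [ps, DD_zero, mk_0, mk_1, mk_2, mk_3] at c0 c1 c2 c3
  replace c0 : P1 v = P1 w := c0
  replace c1 : Q1 v = Q1 w := c1
  replace c2 : P2 v = P2 w := c2
  replace c3 : Q2 v = Q2 w := c3
  unfold P1 at c0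
  unfold Q1 at c1
  unfold P2 at c2
  unfold Q2 at c3
  have pv := Real.cos_sq_add_sin_sq (alp v)
  have pw := Real.cos_sq_add_sin_sq (alp w)
  have hC : Real.cos (eta v) = Real.cos (eta w) := by
    have : Real.cos (eta v) ^ 2 = Real.cos (eta w) ^ 2 := by
      have e1 : (Real.cos (eta v) * Real.cos (alp v)) ^ 2 + (Real.cos (eta v) * Real.sin (alp v)) ^ 2
        = (Real.cos (eta w) * Real.cos (alp w)) ^ 2 + (Real.cos (eta w) * Real.sin (alp w)) ^ 2 := by
        rw [c0, c2]
      linear_combination e1 - Real.cos (eta v) ^ 2 * pv + Real.cos (eta w) ^ 2 * pw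
    exact (sq_eq_sq₀ hv.cos_pos.le hw.cos_pos.le).1 this
  rw [hC] at c0 c2
  have c0 := mul_left_cancel₀ hw.cos_pos.ne' c0
  have c2 := mul_left_cancel₀ hw.cos_pos.ne' c2
  have hS : Real.sin (eta v) = Real.sin (eta w) := by
    rw [c0] at c3
    rw [c2] at c1
    linear_combination Real.cos (alp w) * c3 - Real.sin (alp w) * c1 +
      (Real.sin (eta w) - Real.sin (eta v)) * pw
  have hy : v.2.1 = w.2.1 := by
    have a1 := abs_lt.1 hv.1
    have a2 := abs_lt.1 hw.1
    have : eta v = eta w := by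
      apply Real.injOn_sin _ _ hS <;> constructor <;> unfold eta <;> linarith [Real.pi_gt_three]
    unfold eta at this
    linarith
  have : Real.cos (alp w - alp v) = 1 := by
    rw [Real.cos_sub, c0, c2]; linear_combination pw
  obtain ⟨k, hk⟩ := (Real.cos_eq_one_iff _).1 this
  refine ⟨k, ?_⟩
  have hx : w.1 = v.1 + 3 * k := by
    unfold alp at hk
    have := Real.pi_pos
    field_simp at hk
    linarith
  exact Prod.ext hx (Prod.ext hy.symm hz.symm)

theorem hasDerivAt_ps_line (v w : ℝ × ℝ × ℝ) :
    HasDerivAt (fun s : ℝ => ps (v + s • w)) (fderiv ℝ ps v w) 0 := by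
  have h1 : HasDerivAt (fun s : ℝ => v + s • w) w 0 := by
    simpa using ((hasDerivAt_id (0 : ℝ)).smul_const w).const_add v
  have h2 : HasFDerivAt ps (fderiv ℝ ps v) (v + (0 : ℝ) • w) := by
    simpa using (contDiff_ps.differentiable (by simp) v).hasFDerivAt
  exact h2.comp_hasDerivAt 0 h1

theorem fderiv_ps_vert (v) : fderiv ℝ ps v (0, 0, 1) = X0 (ps v) := by
  have h1 := hasDerivAt_ps_line v (0, 0, 1)
  have h2 := isSol_DD (ps v) 0 0
  have : (fun s : ℝ => ps (v + s • ((0, 0, 1) : ℝ × ℝ × ℝ))) = fun s => DD (s - 0) (ps v) := by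
    funext s
    rw [DD_ps]
    congr 1
    simp [Prod.ext_iff]
  rw [this] at h1
  have := h1.unique h2
  simpa [DD_zero] using this

theorem inner_fderiv_ps (v w) : inner ℝ (fderiv ℝ ps v w) (ps v) = 0 := by
  have h1 := hasDerivAt_ps_line v w
  have h2 := h1.norm_sq
  simp only [norm_ps, zero_smul, add_zero] at h2
  have := h2.unique (hasDerivAt_const (0 : ℝ) _)
  rw [real_inner_comm] at this
  linarith

set_option maxHeartbeats 1000000 in
theorem fderiv_ps_inj {v : ℝ × ℝ × ℝ} (hv : Box v) {w} (h : fderiv ℝ ps v w = 0) : w = 0 := by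
  have h1 := hasDerivAt_ps_line v w
  rw [h] at h1
  have hη : HasDerivAt (fun s : ℝ => eta (v + s • w)) (w.2.1 / 100) 0 := by
    have : HasDerivAt (fun s : ℝ => (v.2.1 + s * w.2.1) / 100) (1 * w.2.1 / 100) 0 :=
      (((hasDerivAt_id (0 : ℝ)).mul_const w.2.1).const_add v.2.1).div_const 100
    simpa [eta] using this
  have hα : HasDerivAt (fun s : ℝ => alp (v + s • w)) (2 * Real.pi * w.1 / 3) 0 := by
    have : HasDerivAt (fun s : ℝ => 2 * Real.pi * (v.1 + s * w.1 - 3 / 8) / 3)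
        (2 * Real.pi * (1 * w.1) / 3) 0 :=
      (((((hasDerivAt_id (0 : ℝ)).mul_const w.1).const_add v.1).sub_const (3 / 8)).const_mul
        (2 * Real.pi)).div_const 3
    simpa [alp] using this
  have hA : HasDerivAt (fun s : ℝ => aa * (v + s • w).2.2) (aa * w.2.2) 0 := by
    have : HasDerivAt (fun s : ℝ => aa * (v.2.2 + s * w.2.2)) (aa * (1 * w.2.2)) 0 :=
      (((hasDerivAt_id (0 : ℝ)).mul_const w.2.2).const_add v.2.2).const_mul aa
    simpa using this
  have hB : HasDerivAt (fun s : ℝ => bb * (v + s • w).2.2) (bb * w.2.2) 0 := by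
    have : HasDerivAt (fun s : ℝ => bb * (v.2.2 + s * w.2.2)) (bb * (1 * w.2.2)) 0 :=
      (((hasDerivAt_id (0 : ℝ)).mul_const w.2.2).const_add v.2.2).const_mul bb
    simpa using this
  have hP1 := hη.cos.mul hα.cos
  have hQ1 := (hη.sin.mul hα.sin).neg
  have hP2 := hη.cos.mul hα.sin
  have hQ2 := hη.sin.mul hα.cos
  have e0 := (hA.cos.mul hP1).sub (hA.sin.mul hQ1)
  have d0 := (hasDerivAt_E4_apply h1 0).unique e0
  have e1 := (hA.sin.mul hP1).add (hA.cos.mul hQ1)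
  have d1 := (hasDerivAt_E4_apply h1 1).unique e1
  have e2 := (hB.cos.mul hP2).sub (hB.sin.mul hQ2)
  have d2 := (hasDerivAt_E4_apply h1 2).unique e2
  have e3 := (hB.sin.mul hP2).add (hB.cos.mul hQ2)
  have d3 := (hasDerivAt_E4_apply h1 3).unique e3
  simp only [zero_smul, add_zero, PiLp.zero_apply, Pi.mul_apply, Pi.neg_apply] at d0 d1 d2 d3
  clear e0 e1 e2 e3 hP1 hQ1 hP2 hQ2 h1
  set C := Real.cos (eta v)
  set S := Real.sin (eta v)
  set c := Real.cos (alp v)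
  set s := Real.sin (alp v)
  set η' := w.2.1 / 100 with hη'
  set α' := 2 * Real.pi * w.1 / 3 with hα'
  set CA := Real.cos (aa * v.2.2)
  set SA := Real.sin (aa * v.2.2)
  set CB := Real.cos (bb * v.2.2)
  set SB := Real.sin (bb * v.2.2)
  have hCA : CA ^ 2 + SA ^ 2 = 1 := Real.cos_sq_add_sin_sq _
  have hCB : CB ^ 2 + SB ^ 2 = 1 := Real.cos_sq_add_sin_sq _
  have hCS : C ^ 2 + S ^ 2 = 1 := Real.cos_sq_add_sin_sq _
  have hcs : c ^ 2 + s ^ 2 = 1 := Real.cos_sq_add_sin_sq _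
  have hS := hv.sin_sq_le
  have hC := hv.cos_pos
  have q0 : -S * η' * c + C * (-s * α') + aa * w.2.2 * (S * s) = 0 := by
    linear_combination (-CA) * d0 - SA * d1 -
      (-S * η' * c + C * (-s * α') + aa * w.2.2 * (S * s)) * hCA
  have q1 : -(C * η' * s + S * (c * α')) + aa * w.2.2 * (C * c) = 0 := by
    linear_combination SA * d0 - CA * d1 -
      (-(C * η' * s + S * (c * α')) + aa * w.2.2 * (C * c)) * hCA
  have q2 : -S * η' * s + C * (c * α') - bb * w.2.2 * (S * c) = 0 := by
    linear_combination (-CB) * d2 - SB * d3 -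
      (-S * η' * s + C * (c * α') - bb * w.2.2 * (S * c)) * hCB
  have q3 : C * η' * c + S * (-s * α') + bb * w.2.2 * (C * s) = 0 := by
    linear_combination SB * d2 - CB * d3 -
      (C * η' * c + S * (-s * α') + bb * w.2.2 * (C * s)) * hCB
  have hw : w.2.2 * (C ^ 2 * (aa * c ^ 2 + bb * s ^ 2) - S ^ 2 * (aa * s ^ 2 + bb * c ^ 2)) = 0 := by
    linear_combination (-S * s) * q0 + C * c * q1 + S * c * q2 + C * s * q3
  have hne : C ^ 2 * (aa * c ^ 2 + bb * s ^ 2) - S ^ 2 * (aa * s ^ 2 + bb * c ^ 2) ≠ 0 := by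
    have s2 := sqrt_two_bounds
    apply ne_of_gt
    have k1 : 1 / 1000 ≤ aa * c ^ 2 + bb * s ^ 2 := by
      unfold aa bb; nlinarith [mul_nonneg (sub_nonneg.2 s2.1.le) (sq_nonneg s), sq_nonneg s]
    have k2 : aa * s ^ 2 + bb * c ^ 2 ≤ 1.42 / 1000 := by
      unfold aa bb; nlinarith [mul_nonneg (sub_nonneg.2 s2.2.le) (sq_nonneg c), sq_nonneg s]
    have k3 : 999 / 1000 ≤ C ^ 2 := by linarith
    have k4 : S ^ 2 * (aa * s ^ 2 + bb * c ^ 2) ≤ S ^ 2 * (1.42 / 1000) :=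
      mul_le_mul_of_nonneg_left k2 (sq_nonneg S)
    have k5 : 999 / 1000 * (1 / 1000) ≤ C ^ 2 * (aa * c ^ 2 + bb * s ^ 2) :=
      mul_le_mul k3 k1 (by norm_num) (sq_nonneg C)
    linarith
  have hw3 : w.2.2 = 0 := (mul_eq_zero.1 hw).resolve_right hne
  rw [hw3] at q0 q1 q2 q3
  have r1 : C * η' = 0 := by linear_combination c * q3 - s * q1 - C * η' * hcs
  have r2 : C * α' = 0 := by linear_combination c * q2 - s * q0 - C * α' * hcs
  have r1 := (mul_eq_zero.1 r1).resolve_left hC.ne'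
  have r2 := (mul_eq_zero.1 r2).resolve_left hC.ne'
  have hw2 : w.2.1 = 0 := by rw [hη'] at r1; linarith
  have hw1 : w.1 = 0 := by
    rw [hα'] at r2
    have h2 : (2 * Real.pi) * w.1 = 0 := by linarith
    exact (mul_eq_zero.1 h2).resolve_left (by positivity)
  exact Prod.ext hw1 (Prod.ext hw2 hw3)

end Kuperberg

namespace Kuperberg

open Set Filter Topology
open scoped ContDiff

theorem isOpen_Box : IsOpen {v | Box v} := by
  have h1 : IsOpen {v : ℝ × ℝ × ℝ | |v.2.1| < 3} := isOpen_lt (by fun_prop) (by fun_prop)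
  have h2 : IsOpen {v : ℝ × ℝ × ℝ | |v.2.2| < 20} := isOpen_lt (by fun_prop) (by fun_prop)
  exact h1.inter h2

theorem exists_local_lift {v₀ : ℝ × ℝ × ℝ} (hv : Box v₀) : ∃ L : E4 → ℝ × ℝ × ℝ,
    ContDiffAt ℝ ∞ L (ps v₀) ∧ L (ps v₀) = v₀ ∧ ∀ᶠ q in 𝓝 (ps v₀), ‖q‖ = 1 → ps (L q) = q := by
  let Φ : (ℝ × ℝ × ℝ) × ℝ → E4 := fun x => x.2 • ps x.1
  have hΦ : ContDiff ℝ ∞ Φ := contDiff_snd.smul (contDiff_ps.comp contDiff_fst)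
  have hd : HasFDerivAt Φ (fderiv ℝ Φ (v₀, 1)) (v₀, 1) :=
    (hΦ.differentiable (by simp) _).hasFDerivAt
  have hval (x : (ℝ × ℝ × ℝ) × ℝ) :
      fderiv ℝ Φ (v₀, 1) x = fderiv ℝ ps v₀ x.1 + x.2 • ps v₀ := by
    have h1 : HasFDerivAt ps (fderiv ℝ ps v₀) ((v₀, (1 : ℝ)) : (ℝ × ℝ × ℝ) × ℝ).1 :=
      (contDiff_ps.differentiable (by simp) v₀).hasFDerivAt
    have h2 := (hasFDerivAt_snd (𝕜 := ℝ) (p := ((v₀, (1 : ℝ)) : (ℝ × ℝ × ℝ) × ℝ))).smul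
      (h1.comp _ (hasFDerivAt_fst (𝕜 := ℝ) (p := ((v₀, (1 : ℝ)) : (ℝ × ℝ × ℝ) × ℝ))))
    have h3 : fderiv ℝ Φ (v₀, 1) = _ := hd.unique h2
    rw [h3]
    simp
  have hinj : Function.Injective (fderiv ℝ Φ (v₀, 1) : (ℝ × ℝ × ℝ) × ℝ →ₗ[ℝ] E4) := by
    rw [← LinearMap.ker_eq_bot, LinearMap.ker_eq_bot']
    intro x hx
    have hx' : fderiv ℝ ps v₀ x.1 + x.2 • ps v₀ = 0 := by rw [← hval]; exact hx
    have h1 := congrArg (fun q => inner ℝ q (ps v₀)) hx'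
    simp only [inner_add_left, inner_fderiv_ps, inner_smul_left, inner_zero_left,
      real_inner_self_eq_norm_sq, norm_ps] at h1
    have h2 : x.2 = 0 := by simpa using h1
    rw [h2, zero_smul, add_zero] at hx'
    exact Prod.ext (fderiv_ps_inj hv hx') h2
  have hrank : Module.finrank ℝ ((ℝ × ℝ × ℝ) × ℝ) = Module.finrank ℝ E4 := by simp
  let e := (LinearMap.linearEquivOfInjective _ hinj hrank).toContinuousLinearEquiv
  have he : (e : (ℝ × ℝ × ℝ) × ℝ →L[ℝ] E4) = fderiv ℝ Φ (v₀, 1) := by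
    refine ContinuousLinearMap.ext fun x => rfl
  rw [← he] at hd
  have hne : (∞ : WithTop ℕ∞) ≠ 0 := by simp
  have hc : ContDiffAt ℝ ∞ Φ (v₀, 1) := hΦ.contDiffAt
  have hΦ1 : Φ (v₀, 1) = ps v₀ := one_smul ℝ _
  have hL := hc.to_localInverse hd hne
  have hLi := hc.localInverse_apply_image hd hne
  have hr := (hc.hasStrictFDerivAt' hd hne).eventually_right_inverse
  change ∀ᶠ y in 𝓝 (Φ (v₀, 1)), Φ (hc.localInverse hd hne y) = y at hr
  rw [hΦ1] at hL hLi hr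
  refine ⟨fun q => (hc.localInverse hd hne q).1, hL.fst, congrArg Prod.fst hLi, ?_⟩
  have hpos : ∀ᶠ q in 𝓝 (ps v₀), 0 < (hc.localInverse hd hne q).2 := by
    have : ContinuousAt (fun q => (hc.localInverse hd hne q).2) (ps v₀) := hL.continuousAt.snd
    apply this.eventually_const_lt
    show 0 < (hc.localInverse hd hne (ps v₀)).2
    rw [hLi]; exact one_pos
  filter_upwards [hr, hpos] with q hq hp h1
  have hn := congrArg norm hq
  rw [norm_smul, norm_ps, h1, mul_one, Real.norm_of_nonneg hp.le] at hn
  change (hc.localInverse hd hne q).2 • ps (hc.localInverse hd hne q).1 = q at hq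
  rwa [hn, one_smul] at hq

open Classical in
/-- The vector field on the three-sphere. -/
noncomputable def XX (p : E4) : E4 :=
  if h : ∃ v, Box v ∧ ps v = p then fderiv ℝ ps h.choose (PP h.choose) else X0 p

theorem XX_ps {v} (hv : Box v) : XX (ps v) = fderiv ℝ ps v (PP v) := by
  have h : ∃ w, Box w ∧ ps w = ps v := ⟨v, hv, rfl⟩
  unfold XX
  rw [dif_pos h]
  obtain ⟨k, hk⟩ := ps_inj h.choose_spec.1 hv h.choose_spec.2
  generalize h.choose = w at hk
  rw [hk, fderiv_ps_sh, PP_sh]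

theorem XX_eq_X0 {p} (h : ∀ v, Box v → ps v = p → PP v = (0, 0, 1)) : XX p = X0 p := by
  by_cases hp : ∃ v, Box v ∧ ps v = p
  · obtain ⟨v, hv, rfl⟩ := hp
    rw [XX_ps hv, h v hv rfl, fderiv_ps_vert]
  · unfold XX
    rw [dif_neg hp]

theorem exists_contDiffAt_XX (p : E4) (hp : ‖p‖ = 1) :
    ∃ G : E4 → E4, ContDiffAt ℝ ∞ G p ∧ ∀ᶠ q in 𝓝 p, ‖q‖ = 1 → XX q = G q := by
  by_cases h : ∃ v, Box v ∧ ps v = p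
  · obtain ⟨v, hv, rfl⟩ := h
    obtain ⟨L, hL, hLv, hLr⟩ := exists_local_lift hv
    refine ⟨fun q => fderiv ℝ ps (L q) (PP (L q)), ?_, ?_⟩
    · have h1 : ContDiff ℝ ∞ (fderiv ℝ ps) := contDiff_ps.fderiv_right (m := ∞) (by simp)
      exact (h1.contDiffAt.comp _ hL).clm_apply (contDiff_PP.contDiffAt.comp _ hL)
    · have hB : ∀ᶠ q in 𝓝 (ps v), Box (L q) :=
        hL.continuousAt.eventually_mem (isOpen_Box.mem_nhds (by rwa [hLv]))
      filter_upwards [hLr, hB] with q hq hqB hq1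
      have := XX_ps hqB
      rwa [hq hq1] at this
  · refine ⟨X0, contDiff_X0.contDiffAt, ?_⟩
    let K := Icc (0 : ℝ) 3 ×ˢ Icc (-(5 / 2) : ℝ) (5 / 2) ×ˢ Icc (-10 : ℝ) 10
    have hK : IsCompact K := isCompact_Icc.prod (isCompact_Icc.prod isCompact_Icc)
    have hK' : IsClosed (ps '' K) := (hK.image contDiff_ps.continuous).isClosed
    have hpK : p ∉ ps '' K := by
      rintro ⟨v, hv, rfl⟩
      refine h ⟨v, ⟨?_, ?_⟩, rfl⟩
      · have := hv.2.1
        rw [abs_lt]; constructor <;> linarith [this.1, this.2]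
      · have := hv.2.2
        rw [abs_lt]; constructor <;> linarith [this.1, this.2]
    filter_upwards [hK'.isOpen_compl.mem_nhds hpK] with q hq _
    apply XX_eq_X0
    rintro v hv rfl
    apply PP_eq_of_outside
    by_contra! hcon
    have hx : ∃ k : ℤ, 0 ≤ v.1 + 3 * k ∧ v.1 + 3 * k ≤ 3 := by
      refine ⟨-⌊v.1 / 3⌋, ?_, ?_⟩ <;> push_cast
      · linarith [Int.floor_le (v.1 / 3)]
      · linarith [Int.lt_floor_add_one (v.1 / 3)]
    obtain ⟨k, hk⟩ := hx
    apply hq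
    refine ⟨sh (3 * k) v, ⟨hk, ?_, ?_⟩, ps_sh v k⟩
    · exact abs_le.1 hcon.1.le
    · exact abs_le.1 hcon.2

theorem inner_X0 (p : E4) : inner ℝ (X0 p) p = 0 := by
  simp [PiLp.inner_apply, Fin.sum_univ_four, X0]
  ring

theorem X0_ne_zero {p : E4} (hp : ‖p‖ = 1) : X0 p ≠ 0 := by
  intro h
  have h2 : (0 : ℝ) < √2 := by positivity
  have c0 := congrArg (fun p : E4 => p 0) h
  have c1 := congrArg (fun p : E4 => p 1) h
  have c2 := congrArg (fun p : E4 => p 2) h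
  have c3 := congrArg (fun p : E4 => p 3) h
  simp [X0, aa, bb] at c0 c1 c2 c3
  have := norm_sq_E4 p
  rw [hp, c0, c1, c2, c3] at this
  norm_num at this

theorem inner_XX (p : E4) : inner ℝ (XX p) p = 0 := by
  by_cases hp : ∃ v, Box v ∧ ps v = p
  · obtain ⟨v, hv, rfl⟩ := hp
    rw [XX_ps hv, inner_fderiv_ps]
  · unfold XX
    rw [dif_neg hp, inner_X0]

theorem XX_ne_zero {p : E4} (h1 : ‖p‖ = 1) : XX p ≠ 0 := by
  by_cases hp : ∃ v, Box v ∧ ps v = p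
  · obtain ⟨v, hv, rfl⟩ := hp
    rw [XX_ps hv]
    exact fun h => PP_ne_zero v (fderiv_ps_inj hv h)
  · unfold XX
    rw [dif_neg hp]
    exact X0_ne_zero h1

open Manifold in
theorem contMDiff_XX : ContMDiff (𝓡 3) 𝓘(ℝ, EuclideanSpace ℝ (Fin 4)) (⊤ : ℕ∞)
    (fun p : Metric.sphere (0 : EuclideanSpace ℝ (Fin 4)) 1 => XX p) := by
  intro p
  obtain ⟨G, hG, hGe⟩ := exists_contDiffAt_XX p (by simp)
  have h1 : ContMDiffAt (𝓡 3) 𝓘(ℝ, EuclideanSpace ℝ (Fin 4)) (⊤ : ℕ∞)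
      (fun p : Metric.sphere (0 : EuclideanSpace ℝ (Fin 4)) 1 => G p) p := by
    have h2 : ContMDiffAt 𝓘(ℝ, EuclideanSpace ℝ (Fin 4)) 𝓘(ℝ, EuclideanSpace ℝ (Fin 4))
      (⊤ : ℕ∞) G p := hG.contMDiffAt
    have : Fact (Module.finrank ℝ (EuclideanSpace ℝ (Fin 4)) = 3 + 1) := ⟨by simp⟩
    exact h2.comp p (contMDiff_coe_sphere p)
  refine h1.congr_of_eventuallyEq ?_
  have := continuous_subtype_val.continuousAt (x := p) |>.eventually hGe
  filter_upwards [this] with q hq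
  exact hq (by simp)

/-- Solution curves of the vector field. -/
structure IsCurve (γ : ℝ → E4) : Prop where
  norm_eq : ∀ t, ‖γ t‖ = 1
  hasDerivAt : ∀ t, HasDerivAt γ (XX (γ t)) t

theorem IsCurve.continuous {γ} (h : IsCurve γ) : Continuous γ :=
  continuous_iff_continuousAt.2 fun t => (h.hasDerivAt t).continuousAt

theorem contDiff_one_PP : ContDiff ℝ 1 PP := contDiff_PP.of_le (by simp)

theorem IsCurve.eventually_lift {γ} (h : IsCurve γ) {σ : ℝ → ℝ × ℝ × ℝ} (hσ : IsSol PP σ) {t₀ : ℝ}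
    (hB : Box (σ t₀)) (h₀ : γ t₀ = ps (σ t₀)) : ∀ᶠ t in 𝓝 t₀, γ t = ps (σ t) := by
  obtain ⟨L, hL, hLv, hLr⟩ := exists_local_lift hB
  rw [← h₀] at hL hLv hLr
  have hc : Tendsto γ (𝓝 t₀) (𝓝 (γ t₀)) := h.continuous.continuousAt
  have e1 : ∀ᶠ t in 𝓝 t₀, ps (L (γ t)) = γ t :=
    (hc.eventually hLr).mono fun t ht => ht (h.norm_eq t)
  have e2 : ∀ᶠ t in 𝓝 t₀, Box (L (γ t)) :=
    hc.eventually (hL.continuousAt.eventually_mem (isOpen_Box.mem_nhds (by rwa [hLv])))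
  have e3 : ∀ᶠ t in 𝓝 t₀, DifferentiableAt ℝ L (γ t) := by
    apply hc.eventually
    have hL1 : ContDiffAt ℝ 1 L (γ t₀) := hL.of_le (by simp)
    exact (hL1.eventually (by simp)).mono fun q hq => hq.differentiableAt (by simp)
  have e4 : ∀ᶠ t in 𝓝 t₀, HasDerivAt (fun s => L (γ s)) (PP (L (γ t))) t := by
    filter_upwards [e1.eventually_nhds, e2, e3] with t h1 h2 h3
    have d1 := h3.hasFDerivAt.comp_hasDerivAt t (h.hasDerivAt t)
    have d2 : HasDerivAt (fun s => ps (L (γ s))) (fderiv ℝ ps (L (γ t)) (fderiv ℝ L (γ t) (XX (γ t)))) t :=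
      HasFDerivAt.comp_hasDerivAt (f := fun s => L (γ s)) t
        (contDiff_ps.differentiable (by simp) (L (γ t))).hasFDerivAt d1
    have d3 := (d2.congr_of_eventuallyEq (h1.mono fun s hs => hs.symm)).unique (h.hasDerivAt t)
    have d4 := XX_ps h2
    rw [h1.self_of_nhds] at d4
    have : fderiv ℝ L (γ t) (XX (γ t)) = PP (L (γ t)) := by
      rw [← sub_eq_zero]
      apply fderiv_ps_inj h2
      rw [map_sub, d3, d4, sub_self]
    rw [← this]
    exact d1
  have e5 := eventually_eq_of_hasDerivAt contDiff_one_PP e4 (Eventually.of_forall hσ) hLv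
  filter_upwards [e1, e5] with t h1 h5
  rw [← h5, h1]

theorem exists_isSol_PP (t₀ v₀) : ∃ σ, σ t₀ = v₀ ∧ IsSol PP σ :=
  exists_isSol contDiff_one_PP exists_bound_PP.choose_spec t₀ v₀

/-- While the curve avoids the support of the plug it follows the base flow. -/
theorem IsCurve.eq_DD {γ} (h : IsCurve γ) {s : Set ℝ} (hs : IsOpen s) (hc : IsPreconnected s)
    (hX : ∀ t ∈ s, XX (γ t) = X0 (γ t)) {t₀} (ht₀ : t₀ ∈ s) : ∀ t ∈ s, γ t = DD (t - t₀) (γ t₀) := by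
  refine eqOn_of_hasDerivAt (F := X0) (contDiff_X0.of_le (by simp)) hs hc (fun t ht => ?_)
    (fun t _ => isSol_DD _ _ t) ht₀ ?_
  · rw [← hX t ht]; exact h.hasDerivAt t
  · simp [DD_zero]

end Kuperberg

namespace Kuperberg

open Set Filter Topology
open scoped ContDiff

theorem rot_fixed {A x y : ℝ} (h0 : Real.cos A * x - Real.sin A * y = x)
    (h1 : Real.sin A * x + Real.cos A * y = y) : (x = 0 ∧ y = 0) ∨ Real.cos A = 1 := by
  by_cases h : x ^ 2 + y ^ 2 = 0
  · left
    constructor <;> nlinarith [sq_nonneg x, sq_nonneg y]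
  · right
    have : (Real.cos A - 1) * (x ^ 2 + y ^ 2) = 0 := by linear_combination x * h0 + y * h1
    have := (mul_eq_zero.1 this).resolve_right h
    linarith

theorem DD_closed {t : ℝ} (ht : 0 < t) {p : E4} (h : DD t p = p) :
    (p 0 = 0 ∧ p 1 = 0) ∨ (p 2 = 0 ∧ p 3 = 0) := by
  have c0 := congrArg (fun p : E4 => p 0) h
  have c1 := congrArg (fun p : E4 => p 1) h
  have c2 := congrArg (fun p : E4 => p 2) h
  have c3 := congrArg (fun p : E4 => p 3) h
  simp only [DD_0, DD_1, DD_2, DD_3] at c0 c1 c2 c3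
  rcases rot_fixed c0 c1 with h0 | h0
  · exact Or.inl h0
  rcases rot_fixed c2 c3 with h1 | h1
  · exact Or.inr h1
  exfalso
  obtain ⟨m, hm⟩ := (Real.cos_eq_one_iff _).1 h0
  obtain ⟨n, hn⟩ := (Real.cos_eq_one_iff _).1 h1
  have hpi := Real.pi_pos
  unfold aa at hm
  unfold bb at hn
  have hm0 : (m : ℝ) ≠ 0 := by
    intro h
    rw [h] at hm
    linarith
  have h2 : (n : ℝ) * (2 * Real.pi) = √2 * (m * (2 * Real.pi)) := by rw [hm, hn]; ring
  have h3 : (n : ℝ) = √2 * m := by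
    have : ((n : ℝ) - √2 * m) * (2 * Real.pi) = 0 := by linear_combination h2
    have := (mul_eq_zero.1 this).resolve_right (by positivity)
    linarith
  apply irrational_sqrt_two
  exact ⟨n / m, by push_cast; rw [h3]; field_simp⟩

theorem exists_angle {x y : ℝ} (h : x ^ 2 + y ^ 2 = 1) :
    ∃ φ : ℝ, x = Real.cos φ ∧ y = Real.sin φ := by
  have hn : ‖(⟨x, y⟩ : ℂ)‖ = 1 := by
    rw [Complex.norm_def, Complex.normSq_mk, ← sq, ← sq, h, Real.sqrt_one]
  have h0 : (⟨x, y⟩ : ℂ) ≠ 0 := by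
    intro h0
    rw [h0, norm_zero] at hn
    exact zero_ne_one hn
  refine ⟨Complex.arg ⟨x, y⟩, ?_, ?_⟩
  · rw [Complex.cos_arg h0, hn, div_one]
  · rw [Complex.sin_arg, hn, div_one]

theorem exists_DD_eq {p : E4} (hp : ‖p‖ = 1) (h : (p 0 = 0 ∧ p 1 = 0) ∨ (p 2 = 0 ∧ p 3 = 0)) :
    ∃ t x : ℝ, (|x - 1| ≤ 1 / 4 ∨ |x - 2| ≤ 1 / 4) ∧ DD t p = ps (x, 0, -2) := by
  have hn := norm_sq_E4 p
  rw [hp] at hn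
  rcases h with h | h
  · obtain ⟨φ, h2, h3⟩ := exists_angle (x := p 2) (y := p 3) (by rw [h.1, h.2] at hn; linarith)
    have hb : bb ≠ 0 := by unfold bb; positivity
    refine ⟨-2 + -φ / bb, 9 / 8, by norm_num [abs_of_pos], ?_⟩
    rw [DD_add]
    unfold ps
    have e1 : eta ((9 / 8 : ℝ), (0 : ℝ), (-2 : ℝ)) = 0 := by simp [eta]
    have e2 : alp ((9 / 8 : ℝ), (0 : ℝ), (-2 : ℝ)) = Real.pi / 2 := by simp [alp]; ring
    congr 1
    have e3 : bb * (-φ / bb) = -φ := by field_simp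
    apply E4_ext <;> simp [P1, P2, Q1, Q2, e1, e2, e3, h, h2, h3]
    · linear_combination Real.cos_sq_add_sin_sq φ
    · ring
  · obtain ⟨φ, h2, h3⟩ := exists_angle (x := p 0) (y := p 1) (by rw [h.1, h.2] at hn; linarith)
    have hb : aa ≠ 0 := by unfold aa; positivity
    refine ⟨-2 + (Real.pi - φ) / aa, 15 / 8, by norm_num [abs_of_pos, abs_of_neg], ?_⟩
    rw [DD_add]
    unfold ps
    have e1 : eta ((15 / 8 : ℝ), (0 : ℝ), (-2 : ℝ)) = 0 := by simp [eta]
    have e2 : alp ((15 / 8 : ℝ), (0 : ℝ), (-2 : ℝ)) = Real.pi := by simp [alp]; ring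
    congr 1
    have e3 : aa * ((Real.pi - φ) / aa) = Real.pi - φ := by field_simp
    apply E4_ext <;> simp [P1, P2, Q1, Q2, e1, e2, e3, h, h2, h3]
    · linear_combination -Real.cos_sq_add_sin_sq φ
    · ring

theorem special_of_ps {v} (hv : Box v)
    (h : (ps v 0 = 0 ∧ ps v 1 = 0) ∨ (ps v 2 = 0 ∧ ps v 3 = 0)) :
    v.2.1 = 0 ∧ ∃ n : ℤ, v.1 = 3 / 8 + 3 / 4 * n := by
  have hc := hv.cos_pos
  have key : Real.sin (eta v) = 0 ∧ Real.sin (2 * alp v) = 0 := by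
    have hcs := Real.cos_sq_add_sin_sq (alp v)
    rcases h with ⟨h0, h1⟩ | ⟨h0, h1⟩
    · replace h0 : Real.cos (aa * v.2.2) * P1 v - Real.sin (aa * v.2.2) * Q1 v = 0 := h0
      replace h1 : Real.sin (aa * v.2.2) * P1 v + Real.cos (aa * v.2.2) * Q1 v = 0 := h1
      have hA := Real.cos_sq_add_sin_sq (aa * v.2.2)
      have hp : P1 v = 0 := by
        linear_combination Real.cos (aa * v.2.2) * h0 + Real.sin (aa * v.2.2) * h1 - P1 v * hA
      have hq : Q1 v = 0 := by
        linear_combination Real.cos (aa * v.2.2) * h1 - Real.sin (aa * v.2.2) * h0 - Q1 v * hA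
      unfold P1 at hp
      unfold Q1 at hq
      have hp := (mul_eq_zero.1 hp).resolve_left hc.ne'
      rw [Real.sin_two_mul, hp]
      refine ⟨?_, by ring⟩
      rw [hp] at hcs
      linear_combination (-Real.sin (alp v)) * hq - Real.sin (eta v) * hcs
    · replace h0 : Real.cos (bb * v.2.2) * P2 v - Real.sin (bb * v.2.2) * Q2 v = 0 := h0
      replace h1 : Real.sin (bb * v.2.2) * P2 v + Real.cos (bb * v.2.2) * Q2 v = 0 := h1
      have hA := Real.cos_sq_add_sin_sq (bb * v.2.2)
      have hp : P2 v = 0 := by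
        linear_combination Real.cos (bb * v.2.2) * h0 + Real.sin (bb * v.2.2) * h1 - P2 v * hA
      have hq : Q2 v = 0 := by
        linear_combination Real.cos (bb * v.2.2) * h1 - Real.sin (bb * v.2.2) * h0 - Q2 v * hA
      unfold P2 at hp
      unfold Q2 at hq
      have hp := (mul_eq_zero.1 hp).resolve_left hc.ne'
      rw [Real.sin_two_mul, hp]
      refine ⟨?_, by ring⟩
      rw [hp] at hcs
      linear_combination Real.cos (alp v) * hq - Real.sin (eta v) * hcs
  have hpi := Real.pi_pos
  constructor
  · have a1 := abs_lt.1 hv.1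
    have : eta v = 0 := by
      rw [← Real.sin_eq_zero_iff_of_lt_of_lt (x := eta v)]
      · exact key.1
      · unfold eta; linarith [Real.pi_gt_three]
      · unfold eta; linarith [Real.pi_gt_three]
    unfold eta at this
    linarith
  · obtain ⟨n, hn⟩ := Real.sin_eq_zero_iff.1 key.2
    refine ⟨n, ?_⟩
    unfold alp at hn
    have : (v.1 - (3 / 8 + 3 / 4 * n)) * Real.pi = 0 := by linear_combination (-3 / 4) * hn
    have := (mul_eq_zero.1 this).resolve_right hpi.ne'
    linarith

theorem rr_eq_zero_of_special {v} (hG : GG v) (hy : v.2.1 = 0) (hx : ∃ n : ℤ, v.1 = 3 / 8 + 3 / 4 * n) :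
    rr v = 0 := by
  obtain ⟨k, hk1, hk2⟩ := exists_window v.1
  rw [← rr_sh v k]
  rw [← GG_sh v k] at hG
  replace hx : ∃ n : ℤ, (sh (6 * k) v).1 = 3 / 8 + 3 / 4 * n := by
    obtain ⟨n, hn⟩ := hx
    refine ⟨n + 8 * k, ?_⟩
    rw [sh_fst, hn]; push_cast; ring
  rw [← sh_fst (6 * k) v] at hk1 hk2
  replace hy : (sh (6 * k) v).2.1 = 0 := hy
  generalize sh (6 * k) v = w at *
  obtain ⟨n, hn⟩ := hx
  by_cases hm : w.1 ≤ 3 ∨ 6 ≤ w.1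
  · have h1 := ee_eq_zero_main hk1 (hm.imp (by intro; linarith) (by intro; linarith)) hk2.le
    have hth : th w = w.1 := by unfold th; rw [h1.1]; ring
    unfold rr
    rw [hth, (cc_eq_zero hk1 hk2.le hm).1, hy]; ring
  · exfalso
    push Not at hm
    have b1 : (3 : ℝ) < n := by rw [hn] at hm; linarith
    have b2 : (n : ℝ) < 8 := by rw [hn] at hm; linarith
    have b1' : (3 : ℤ) < n := by exact_mod_cast b1
    have b2' : n < (8 : ℤ) := by exact_mod_cast b2
    have c1 : (4 : ℝ) ≤ n := by exact_mod_cast b1'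
    have c2 : (n : ℝ) ≤ 7 := by exact_mod_cast (by omega : n ≤ 7)
    have hkk : kk w.1 = 1 / 100 := (cc_eq_one (abs_le.2 ⟨by linarith, by linarith⟩)).2
    have d1 := abs_le.1 ((abs_th_sub_le w).trans (abs_hd_le hG))
    rw [hkk] at d1
    have hcc : cc (th w) = 1 := (cc_eq_one (abs_le.2 ⟨by linarith, by linarith⟩)).1
    have hr := abs_le.1 hG.1
    unfold rr at hr
    rw [hcc, hy] at hr
    have := abs_lt.1 (abs_sub_round_lt (x := th w) (by linarith [sin_sq_le_bend w]))
    set m := round (th w)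
    have e1 : (-1 : ℝ) < (3 + 6 * n - 8 * m : ℤ) := by push_cast; linarith
    have e2 : ((3 + 6 * n - 8 * m : ℤ) : ℝ) < 1 := by push_cast; linarith
    have e1' : (-1 : ℤ) < 3 + 6 * n - 8 * m := by exact_mod_cast e1
    have e2' : 3 + 6 * n - 8 * m < (1 : ℤ) := by exact_mod_cast e2
    omega

end Kuperberg

namespace Kuperberg
open Set Filter Topology
open scoped ContDiff

/-- A lift of a crossing of the top or bottom of the plug. -/
def Ev (v : ℝ × ℝ × ℝ) : Prop := |rr v| < 1 / 1000 ∧ |zz v| = 2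

/-- The opposite point lies in the interior of the plug. -/
def In (v : ℝ × ℝ × ℝ) : Prop := |rr (sh 3 v)| < 1 / 1000 ∧ |zz (sh 3 v)| < 2

theorem In_sh (v) (k : ℤ) : In (sh (6 * k) v) ↔ In v := by
  unfold In
  rw [sh_comm, rr_sh, zz_sh]

theorem Ev_sh (v) (k : ℤ) : Ev (sh (6 * k) v) ↔ Ev v := by
  unfold Ev
  rw [rr_sh, zz_sh]

theorem Ev.GG {v} (h : Ev v) : GG v := ⟨h.1.le, h.2.le⟩

theorem MZ.abs_zz_lt {v : ℝ × ℝ × ℝ} {k : ℤ} (h : MZ (sh (6 * k) v)) : |zz v| < 2 := by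
  have h1 : zz (sh (6 * k) v) = v.2.2 := congrArg (fun w => w.2.2) h.Lam
  rw [zz_sh] at h1
  rw [h1]
  rcases h with ⟨-, h⟩ | ⟨-, h⟩ <;> simp only [sh_snd] at h <;> have := abs_lt.1 h <;>
    rw [abs_lt] <;> constructor <;> linarith

theorem opposite_of_abs_zz_eq {v : ℝ × ℝ × ℝ} (h : GG v) (hz : |zz v| = 2) (h3 : GG (sh 3 v)) :
    |v.2.1| ≤ 1 / 1000 ∧ ∃ k : ℤ, MZ (sh (6 * k) (sh 3 v)) := by
  obtain ⟨hy, k, hk | hk⟩ := inter_cases h h3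
  · exact absurd hz hk.abs_zz_lt.ne
  · exact ⟨hy, k, hk⟩

theorem not_nest_of_abs_zz_eq {v : ℝ × ℝ × ℝ} (h : GG v) (hz : |zz v| = 2) : ¬ Nest v := by
  intro hn
  obtain ⟨h3, -, hc⟩ := not_nest_of_nest h hn
  obtain ⟨-, k, hk⟩ := opposite_of_abs_zz_eq h hz h3
  have := hk.child
  rw [sh_comm, Child_sh, sh_sh, show (3 + 3 : ℝ) = 6 * (1 : ℤ) by norm_num, Child_sh] at this
  exact hc this

theorem sh_three_cases (v : ℝ × ℝ × ℝ) (k : ℤ) :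
    ∃ j : ℤ, sh (3 * k) v = sh (6 * j) v ∨ sh (3 * k) v = sh (6 * j) (sh 3 v) := by
  obtain ⟨j, hj⟩ | ⟨j, hj⟩ := Int.even_or_odd k
  · exact ⟨j, Or.inl (by rw [hj]; push_cast; congr 1; ring)⟩
  · exact ⟨j, Or.inr (by rw [hj, sh_sh]; push_cast; congr 1; ring)⟩

/-- The two fingers: their orientation and their centre. -/
def EC (e c : ℝ) : Prop := e = 1 ∧ c = 4 ∨ e = -1 ∧ c = 5

theorem EC.eqs {e c x : ℝ} (h : EC e c) (hx : |x - c| ≤ 1 / 4) :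
    ee x = e ∧ ea x = 1 ∧ hh x = e * (c - x) - e ∧ cc x = 1 ∧ kk x = 1 / 100 := by
  rcases h with ⟨rfl, rfl⟩ | ⟨rfl, rfl⟩
  · obtain ⟨h1, h2, h3⟩ := ee_zone₄ hx
    obtain ⟨h4, h5⟩ := cc_eq_one (x := x) (by rw [abs_le] at hx ⊢; constructor <;> linarith)
    exact ⟨h1, h2, by rw [h3]; ring, h4, h5⟩
  · obtain ⟨h1, h2, h3⟩ := ee_zone₅ hx
    obtain ⟨h4, h5⟩ := cc_eq_one (x := x) (by rw [abs_le] at hx ⊢; constructor <;> linarith)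
    exact ⟨h1, h2, by rw [h3]; ring, h4, h5⟩

theorem EC.abs_le {e c : ℝ} (h : EC e c) : |e| = 1 := by
  rcases h with ⟨rfl, rfl⟩ | ⟨rfl, rfl⟩ <;> simp

theorem zone_of_th {v : ℝ × ℝ × ℝ} {e c : ℝ} (h : GG v) (hec : EC e c) (ht : |th v - c| < 3 / 20) :
    |v.1 - c| < 9 / 50 ∧ |v.2.2 + e| < 9 / 50 ∧ hd v = zz v / 100 ∧
      v.1 = th v + zz v / 100 * (e * nbmp v.2.1) ∧
      v.2.2 = e * (c - th v) - e + zz v / 100 * (1 - nbmp v.2.1) := by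
  have hk : kk v.1 = 1 / 100 := by
    rw [← (zone_facts h).2.2.2.1]
    exact (hec.eqs (ht.le.trans (by norm_num))).2.2.2.2
  have hhd : hd v = zz v / 100 := by rw [hd_eq, hk]; ring
  have h1 := abs_th_sub_le v
  have h2 := abs_le.1 h.2
  have h3 : |hd v| ≤ 1 / 50 := by rw [hhd, abs_le]; constructor <;> linarith
  have hX : |v.1 - c| < 9 / 50 := by
    have h4 := abs_le.1 (h1.trans h3)
    rw [abs_lt] at ht ⊢; constructor <;> linarith
  obtain ⟨e1, e2, e3, -, -⟩ := hec.eqs (x := v.1) (hX.le.trans (by norm_num))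
  have hth : v.1 = th v + zz v / 100 * (e * nbmp v.2.1) := by
    rw [← hhd, ← e1]; unfold th; ring
  have hee : e * e = 1 := by rcases hec with ⟨rfl, rfl⟩ | ⟨rfl, rfl⟩ <;> norm_num
  have hZ : v.2.2 = e * (c - th v) - e + zz v / 100 * (1 - nbmp v.2.1) := by
    have a : v.2.2 = hd v + hh v.1 := by unfold hd; ring
    rw [a, e3, hhd]
    linear_combination (-e) * hth - zz v / 100 * nbmp v.2.1 * hee
  refine ⟨hX, ?_, hhd, hth, hZ⟩
  have n0 := nbmp_nonneg v.2.1
  have n1 := nbmp_le_one v.2.1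
  have h5 : |e * (c - th v)| < 3 / 20 := by
    rw [abs_mul, hec.abs_le, one_mul, abs_sub_comm]; exact ht
  have h6 : |zz v / 100 * (1 - nbmp v.2.1)| ≤ 1 / 50 := by
    rw [← hhd, abs_mul, abs_of_nonneg (by linarith : 0 ≤ 1 - nbmp v.2.1)]
    nlinarith [abs_nonneg (hd v)]
  rw [hZ]
  rw [abs_lt] at *
  rw [_root_.abs_le] at h6
  constructor <;> linarith

theorem EC.main {e c : ℝ} (h : EC e c) {v : ℝ × ℝ × ℝ} (hX : |v.1 - c| ≤ 1 / 4) :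
    |(sh (-3) v).1 - 1| ≤ 1 / 4 ∨ |(sh (-3) v).1 - 2| ≤ 1 / 4 := by
  rcases h with ⟨rfl, rfl⟩ | ⟨rfl, rfl⟩
  · left; rw [sh_fst]; convert hX using 2; ring
  · right; rw [sh_fst]; convert hX using 2; ring

theorem sh_neg_three (v : ℝ × ℝ × ℝ) : sh (-3) v = sh (6 * ((-1 : ℤ) : ℝ)) (sh 3 v) := by
  rw [sh_sh]; congr 1; push_cast; norm_num

theorem EC.rr_zz {e c : ℝ} (h : EC e c) {v : ℝ × ℝ × ℝ} (hX : |v.1 - c| ≤ 1 / 4) :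
    rr (sh 3 v) = v.2.1 ∧ zz (sh 3 v) = v.2.2 := by
  have h1 := Lam_eq_self (h.main hX)
  have h2 : rr (sh (-3) v) = v.2.1 := congrArg (fun w => w.2.1) h1
  have h3 : zz (sh (-3) v) = v.2.2 := congrArg (fun w => w.2.2) h1
  rw [sh_neg_three, rr_sh] at h2
  rw [sh_neg_three, zz_sh] at h3
  exact ⟨h2, h3⟩

theorem in_of_zone {v : ℝ × ℝ × ℝ} {e c : ℝ} (hec : EC e c) (hX : |v.1 - c| < 9 / 50)
    (hZ : |v.2.2 + e| < 9 / 50) (hy : |v.2.1| < 1 / 1000) : In v := by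
  obtain ⟨h1, h2⟩ := hec.rr_zz (hX.le.trans (by norm_num))
  unfold In
  rw [h1, h2]
  refine ⟨hy, ?_⟩
  have h3 := abs_lt.1 hZ
  have h4 := abs_le.1 hec.abs_le.le
  rw [abs_lt]; constructor <;> linarith

theorem th_of_in {v : ℝ × ℝ × ℝ} (h : GG v) (hz : |zz v| = 2) (hin : In v) :
    ∃ (k : ℤ) (e c : ℝ), EC e c ∧ |th (sh (6 * k) v) - c| < 3 / 20 := by
  obtain ⟨-, k, hk⟩ := opposite_of_abs_zz_eq h hz ⟨hin.1.le, hin.2.le⟩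
  have key : ∀ e c : ℝ, EC e c → |(sh (6 * ((k + 1 : ℤ) : ℝ)) v).1 - c| < 1 / 8 →
      |th (sh (6 * ((k + 1 : ℤ) : ℝ)) v) - c| < 3 / 20 := by
    intro e c hec hX
    have h1 := abs_th_sub_le (sh (6 * ((k + 1 : ℤ) : ℝ)) v)
    have h2 := abs_hd_le ((GG_sh v (k + 1)).2 h)
    rw [(hec.eqs (hX.le.trans (by norm_num))).2.2.2.2] at h2
    have h3 := abs_le.1 (h1.trans h2)
    rw [abs_lt] at hX ⊢; constructor <;> linarith
  rcases hk with ⟨hk, -⟩ | ⟨hk, -⟩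
  · refine ⟨k + 1, 1, 4, Or.inl ⟨rfl, rfl⟩, key 1 4 (Or.inl ⟨rfl, rfl⟩) ?_⟩
    convert hk using 2; simp only [sh_fst]; push_cast; ring
  · refine ⟨k + 1, -1, 5, Or.inr ⟨rfl, rfl⟩, key (-1) 5 (Or.inr ⟨rfl, rfl⟩) ?_⟩
    convert hk using 2; simp only [sh_fst]; push_cast; ring

theorem slant_eq_zero {v : ℝ × ℝ × ℝ} (h : GG v) (hin : ¬ In v) : ee v.1 * nbmp v.2.1 = 0 := by
  rcases zone_cases h with h0 | ⟨hy, k, hk⟩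
  · exact h0
  · exfalso
    apply hin
    rw [← In_sh v k]
    rcases hk with ⟨-, hk, -⟩ | ⟨-, hk, -⟩
    · have hec : EC 1 4 := Or.inl ⟨rfl, rfl⟩
      obtain ⟨h1, h2, -⟩ := zone_of_th ((GG_sh v k).2 h) hec (hk.trans (by norm_num))
      exact in_of_zone hec h1 h2 (hy.trans (by norm_num))
    · have hec : EC (-1) 5 := Or.inr ⟨rfl, rfl⟩
      obtain ⟨h1, h2, -⟩ := zone_of_th ((GG_sh v k).2 h) hec (hk.trans (by norm_num))
      exact in_of_zone hec h1 h2 (hy.trans (by norm_num))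

/-- Reachability along the straightened plug field in a given time, modulo the period. -/
def RWt (τ : ℝ) (a b : ℝ × ℝ × ℝ) : Prop :=
  ∃ (σ : ℝ → ℝ × ℝ × ℝ) (k : ℤ), IsSol WW σ ∧ σ 0 = a ∧ σ τ = sh (6 * k) b

theorem sh_six_sh (i j : ℤ) (v) : sh (6 * (i : ℝ)) (sh (6 * (j : ℝ)) v) = sh (6 * ((j + i : ℤ) : ℝ)) v := by
  rw [sh_sh]; push_cast; congr 1; ring

theorem RWt.trans {s t : ℝ} {a b c} (h : RWt s a b) (h' : RWt t b c) : RWt (s + t) a c := by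
  obtain ⟨σ, k, h1, h2, h3⟩ := h
  obtain ⟨ρ, l, h4, h5, h6⟩ := h'
  refine ⟨σ, l + k, h1, h2, ?_⟩
  have e : (fun u => σ (u + s)) = fun u => sh (6 * k) (ρ u) :=
    (h1.comp_add s).unique contDiff_one_WW (h4.sh_WW k) (t₀ := 0) (by simp [h3, h5])
  have : σ (t + s) = sh (6 * k) (ρ t) := congrFun e t
  rw [add_comm, this, h6, sh_six_sh]

theorem RWt.sh_left {t : ℝ} {a b} (h : RWt t a b) (j : ℤ) : RWt t (sh (6 * j) a) b := by
  obtain ⟨σ, k, h1, h2, h3⟩ := h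
  exact ⟨_, k + j, h1.sh_WW j, by simp [h2], by simp only [h3]; rw [sh_six_sh]⟩

theorem RWt.sh_right {t : ℝ} {a b} (h : RWt t a b) (j : ℤ) : RWt t a (sh (6 * j) b) := by
  obtain ⟨σ, k, h1, h2, h3⟩ := h
  exact ⟨σ, k - j, h1, h2, by rw [h3, sh_six_sh]; congr 2; push_cast; ring⟩

theorem RWt.of_sh_left {t : ℝ} {a b} (j : ℤ) (h : RWt t (sh (6 * j) a) b) : RWt t a b := by
  have := h.sh_left (-j)
  rwa [sh_six_sh, add_neg_cancel, Int.cast_zero, mul_zero, sh_zero] at this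

theorem RWt.of_sh_right {t : ℝ} {a b} (j : ℤ) (h : RWt t a (sh (6 * j) b)) : RWt t a b := by
  have := h.sh_right (-j)
  rwa [sh_six_sh, add_neg_cancel, Int.cast_zero, mul_zero, sh_zero] at this

theorem IsSol.RWt {σ : ℝ → ℝ × ℝ × ℝ} (h : IsSol WW σ) (s t : ℝ) : RWt (t - s) (σ s) (σ t) :=
  ⟨_, 0, h.comp_add s, by simp, by simp⟩

theorem RWt.r_eq {t : ℝ} {a b} (h : RWt t a b) : a.2.1 = b.2.1 := by
  obtain ⟨σ, k, h1, rfl, h3⟩ := h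
  rw [h1.r_eq 0 t, h3]; rfl

theorem RWt.closed {t : ℝ} {a} (h : RWt t a a) (ht : 0 < t) :
    a.2.1 = 0 ∧ (a.2.2 = -1 ∨ a.2.2 = 1) := by
  obtain ⟨σ, k, h1, rfl, h3⟩ := h
  exact h1.closed ht h3

theorem RWt.z_eq_of_circle {t : ℝ} {a b} (h : RWt t a b) (hr : a.2.1 = 0)
    (hz : a.2.2 = -1 ∨ a.2.2 = 1) : b.2.2 = a.2.2 := by
  obtain ⟨σ, k, h1, rfl, h3⟩ := h
  have := h1.eq_circle hr hz t
  rw [h3] at this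
  simpa using congrArg (fun w => w.2.2) this

theorem RWt.symm_z_eq_of_circle {t : ℝ} {a b} (h : RWt t a b) (hr : b.2.1 = 0)
    (hz : b.2.2 = -1 ∨ b.2.2 = 1) : a.2.2 = b.2.2 := by
  obtain ⟨σ, k, h1, rfl, h3⟩ := h
  have := h1.eq_circle (t₀ := t) (by rw [h3]; exact hr) (by rw [h3]; exact hz) 0
  rw [this]; simp [h3]

/-- An orbit with vanishing radius does not traverse the plug. -/
theorem RWt.r_ne_zero {t : ℝ} {a b} (h : RWt t a b) (ha : a.2.2 = -2) (hb : b.2.2 = 2) :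
    a.2.1 ≠ 0 := by
  intro hr
  obtain ⟨σ, k, h1, rfl, h3⟩ := h
  have hc : Continuous fun s => (σ s).2.2 := h1.continuous.snd.snd
  have hm : (-1 : ℝ) ∈ uIcc ((σ 0).2.2) ((σ t).2.2) := by
    rw [h3, sh_snd, ha, hb, uIcc_of_le (by norm_num)]; constructor <;> norm_num
  obtain ⟨s, -, hs⟩ := intermediate_value_uIcc hc.continuousOn hm
  simp only at hs
  have := h1.eq_circle (t₀ := s) (by rw [h1.r_eq s 0, hr]) (Or.inl hs) 0
  have h2 := congrArg (fun w => w.2.2) this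
  simp only [sh_snd, hs, ha] at h2
  norm_num at h2

theorem RWt.facing {t : ℝ} {a b} (h : RWt t a b) (ha : a.2.2 = -2) (hb : b.2.2 = 2) :
    ∃ k : ℤ, b.1 + 6 * k = a.1 ∧ b.2.1 = a.2.1 := by
  obtain ⟨σ, k, h1, rfl, h3⟩ := h
  obtain ⟨h4, h5⟩ := h1.facing ha (by rw [h3]; exact hb)
  rw [h3] at h4 h5
  exact ⟨k, h4, h5⟩

theorem WW_straight {e c : ℝ} (hec : EC e c) {w : ℝ × ℝ × ℝ} (hX : |w.1 + 3 - c| ≤ 1 / 4)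
    (hZ : |w.2.2 + e| ≤ 1 / 4) : WW w = (e * nbmp w.2.1, 0, 1 - nbmp w.2.1) := by
  have hm : |w.1 - 1| ≤ 1 / 4 ∨ |w.1 - 2| ≤ 1 / 4 := by
    rcases hec with ⟨rfl, rfl⟩ | ⟨rfl, rfl⟩
    · left; convert hX using 2; ring
    · right; convert hX using 2; ring
  obtain ⟨-, -, -, -, h5, h6⟩ := main_zone hm
  have hb := abs_le.1 hZ
  unfold WW ff gg
  rw [h5, h6]
  rcases hec with ⟨rfl, rfl⟩ | ⟨rfl, rfl⟩
  · rw [bmp_eq_one hZ, bmp_eq_zero (x := w.2.2 - 1) (by rw [le_abs]; right; linarith)]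
    simp
  · rw [bmp_eq_one (x := w.2.2 - 1) hZ,
      bmp_eq_zero (x := w.2.2 + 1) (by rw [le_abs]; left; linarith)]
    simp

theorem RWt_straight {e c : ℝ} (hec : EC e c) {v : ℝ × ℝ × ℝ} (hX : |v.1 - c| < 9 / 50)
    (hZ : |v.2.2 + e| < 9 / 50) :
    RWt (1 / 25) (sh (-3) v)
      (sh (-3) (v.1 + 1 / 25 * (e * nbmp v.2.1), v.2.1, v.2.2 + 1 / 25 * (1 - nbmp v.2.1))) := by
  obtain ⟨σ, h1, h2⟩ := exists_isSol_WW 0 (sh (-3) v)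
  refine ⟨σ, 0, h2, h1, ?_⟩
  have n0 := nbmp_nonneg v.2.1
  have n1 := nbmp_le_one v.2.1
  have := eqOn_of_hasDerivAt (f := σ) (g := fun t =>
    (v.1 + -3 + t * (e * nbmp v.2.1), v.2.1, v.2.2 + t * (1 - nbmp v.2.1))) contDiff_one_WW
    (isOpen_Ioo (a := (-1 / 40 : ℝ)) (b := 13 / 200)) isPreconnected_Ioo (fun t _ => h2 t)
    (fun t ht => ?_) (t₀ := 0) ⟨by norm_num, by norm_num⟩ (by simp [h1, sh]) (1 / 25)
    ⟨by norm_num, by norm_num⟩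
  · rw [this]; simp [sh]; ring
  · have hte : |t| < 13 / 200 := by rw [abs_lt]; constructor <;> linarith [ht.1, ht.2]
    have a1 : |t * (e * nbmp v.2.1)| < 13 / 200 := by
      rw [abs_mul, abs_mul, hec.abs_le, one_mul, abs_of_nonneg n0]
      nlinarith [abs_nonneg t]
    have a2 : |t * (1 - nbmp v.2.1)| < 13 / 200 := by
      rw [abs_mul, abs_of_nonneg (by linarith : 0 ≤ 1 - nbmp v.2.1)]
      nlinarith [abs_nonneg t]
    rw [WW_straight hec]
    · refine HasDerivAt.prodMk ?_ (HasDerivAt.prodMk (hasDerivAt_const _ _) ?_)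
      · simpa using ((hasDerivAt_id t).mul_const (e * nbmp v.2.1)).const_add (v.1 + -3)
      · simpa using ((hasDerivAt_id t).mul_const (1 - nbmp v.2.1)).const_add v.2.2
    · simp only
      rw [abs_lt] at *; rw [abs_le]; constructor <;> linarith
    · simp only
      rw [abs_lt] at *; rw [abs_le]; constructor <;> linarith

end Kuperberg

namespace Kuperberg
open Set Filter Topology
open scoped ContDiff

theorem y_eq_of_rr_eq {v w : ℝ × ℝ × ℝ} (ht : th w = th v) (hr : rr w = rr v) :
    w.2.1 = v.2.1 := by
  unfold rr bend at hr
  rw [ht] at hr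
  have h := Real.abs_cos_sub_cos_le w.2.1 v.2.1
  have c0 := cc_nonneg (th v)
  have c1 := cc_le_one (th v)
  have e : w.2.1 - v.2.1 = cc (th v) / 2 * (Real.cos w.2.1 - Real.cos v.2.1) := by
    linear_combination hr
  have h2 : |w.2.1 - v.2.1| ≤ 1 / 2 * |w.2.1 - v.2.1| := by
    calc |w.2.1 - v.2.1| = cc (th v) / 2 * |Real.cos w.2.1 - Real.cos v.2.1| := by
          rw [e, abs_mul, abs_of_nonneg (by linarith)]
      _ ≤ 1 / 2 * |w.2.1 - v.2.1| := by
          apply mul_le_mul (by linarith) h (abs_nonneg _) (by norm_num)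
  have h3 : |w.2.1 - v.2.1| = 0 := by linarith [abs_nonneg (w.2.1 - v.2.1)]
  linarith [abs_eq_zero.1 h3]

theorem EC.Lam_opposite {e c : ℝ} (h : EC e c) {v : ℝ × ℝ × ℝ} (hX : |v.1 - c| < 9 / 50) :
    sh (-3) v = sh (6 * ((-1 : ℤ) : ℝ)) (Lam (sh 3 v)) := by
  rw [← Lam_sh, ← sh_neg_three, Lam_eq_self (h.main (hX.le.trans (by norm_num)))]

/-- Two facing crossings of the plug face each other outside the plug as well. -/
theorem facing_outside {v w : ℝ × ℝ × ℝ} (hv : GG v) (hw : GG w) (zv : zz v = -2) (zw : zz w = 2)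
    (ht : th w = th v) (hr : rr w = rr v) :
    (In v ∧ In w ∧ RWt (1 / 25) (Lam (sh 3 v)) (Lam (sh 3 w))) ∨
      (¬ In v ∧ ¬ In w ∧ ∃ τ > 0, ps w = DD τ (ps v)) := by
  have hy := y_eq_of_rr_eq ht hr
  by_cases hin : In v ∨ In w
  · left
    have key : ∃ (k : ℤ) (e c : ℝ), EC e c ∧ |th (sh (6 * k) v) - c| < 3 / 20 ∧
        |v.2.1| < 1 / 1000 := by
      rcases hin with hin | hin
      · obtain ⟨k, e, c, hec, h⟩ := th_of_in hv (by rw [zv]; norm_num) hin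
        refine ⟨k, e, c, hec, h, ?_⟩
        have h1 := (zone_of_th ((GG_sh v k).2 hv) hec h).1
        have h2 := (hec.rr_zz (h1.le.trans (by norm_num))).1
        rw [← In_sh v k] at hin
        have := hin.1
        rwa [h2] at this
      · obtain ⟨k, e, c, hec, h⟩ := th_of_in hw (by rw [zw]; norm_num) hin
        refine ⟨k, e, c, hec, by rwa [th_sh, ← ht, ← th_sh], ?_⟩
        have h1 := (zone_of_th ((GG_sh w k).2 hw) hec h).1
        have h2 := (hec.rr_zz (h1.le.trans (by norm_num))).1
        rw [← In_sh w k] at hin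
        have := hin.1
        rwa [h2, sh_snd, hy] at this
    obtain ⟨k, e, c, hec, h, hyv⟩ := key
    obtain ⟨a1, a2, -, a4, a5⟩ := zone_of_th ((GG_sh v k).2 hv) hec h
    have h' : |th (sh (6 * k) w) - c| < 3 / 20 := by rwa [th_sh, ht, ← th_sh]
    obtain ⟨b1, b2, -, b4, b5⟩ := zone_of_th ((GG_sh w k).2 hw) hec h'
    refine ⟨(In_sh v k).1 (in_of_zone hec a1 a2 hyv),
      (In_sh w k).1 (in_of_zone hec b1 b2 (by rw [sh_snd, hy]; exact hyv)), ?_⟩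
    have H := RWt_straight hec a1 a2
    have hwe : ((sh (6 * k) v).1 + 1 / 25 * (e * nbmp (sh (6 * k) v).2.1), (sh (6 * k) v).2.1,
        (sh (6 * k) v).2.2 + 1 / 25 * (1 - nbmp (sh (6 * k) v).2.1)) = sh (6 * k) w := by
      rw [zz_sh, zv, th_sh] at a4 a5
      rw [zz_sh, zw, th_sh, ht] at b4 b5
      simp only [sh_snd, hy] at a4 a5 b4 b5 ⊢
      refine Prod.ext ?_ (Prod.ext ?_ ?_)
      · simp only; rw [a4, b4]; ring
      · simp [hy]
      · simp only [sh_snd]; rw [a5, b5]; ring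
    rw [hwe, hec.Lam_opposite a1, hec.Lam_opposite b1, sh_comm 3, sh_comm 3, Lam_sh, Lam_sh] at H
    exact (((H.of_sh_left _).of_sh_left _).of_sh_right _).of_sh_right _
  · right
    push Not at hin
    refine ⟨hin.1, hin.2, 4 * kk v.1, by linarith [kk_pos v.1], ?_⟩
    have s1 := slant_eq_zero hv hin.1
    have s2 := slant_eq_zero hw hin.2
    have t1 : th v = v.1 := by unfold th; rw [mul_assoc, s1]; ring
    have t2 : th w = w.1 := by unfold th; rw [mul_assoc, s2]; ring
    have hx : w.1 = v.1 := by rw [← t1, ← t2, ht]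
    have d1 := hd_eq v
    have d2 := hd_eq w
    unfold hd at d1 d2
    rw [zv] at d1
    rw [zw, hx] at d2
    rw [DD_ps]
    congr 1
    exact Prod.ext hx (Prod.ext hy (by simp only; linarith))

/-- At a crossing nested in the opposite strand, the outer radius is smaller, except when the
outer point lies on a closed orbit. -/
theorem rad_lt_aux {v : ℝ × ℝ × ℝ} (hv : GG v) (hz : |zz v| = 2) (hin : In v) :
    rr (sh 3 v) ≤ rr v ∧ (rr (sh 3 v) = rr v →
      (Lam (sh 3 v)).2.1 = 0 ∧ ((Lam (sh 3 v)).2.2 = -1 ∨ (Lam (sh 3 v)).2.2 = 1)) ∧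
      ((Lam (sh 3 v)).2.1 = 0 ∧ ((Lam (sh 3 v)).2.2 = -1 ∨ (Lam (sh 3 v)).2.2 = 1) →
        rr v = 0) := by
  obtain ⟨k, e, c, hec, h⟩ := th_of_in hv hz hin
  obtain ⟨a1, a2, -, a4, a5⟩ := zone_of_th ((GG_sh v k).2 hv) hec h
  obtain ⟨h2, h3⟩ := hec.rr_zz (a1.le.trans (by norm_num))
  rw [sh_comm, rr_sh, sh_snd] at h2
  rw [sh_comm, zz_sh, sh_snd] at h3
  have hL1 : (Lam (sh 3 v)).2.1 = v.2.1 := h2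
  have hL2 : (Lam (sh 3 v)).2.2 = v.2.2 := h3
  have hc : cc (th v) = 1 := by
    have := (hec.eqs (h.le.trans (by norm_num))).2.2.2.1
    rwa [th_sh, cc_add_int] at this
  have hr : rr v = v.2.1 + bend v := by unfold rr; rw [hc, one_mul]
  have hcZ : c = 4 ∧ e = 1 ∨ c = 5 ∧ e = -1 := by
    rcases hec with ⟨rfl, rfl⟩ | ⟨rfl, rfl⟩ <;> simp
  rw [hL1, hL2, h2, hr]
  rw [zz_sh, th_sh] at a4 a5
  rw [th_sh] at h
  simp only [sh_fst, sh_snd] at a1 a2 a4 a5 h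
  refine ⟨by linarith [bend_nonneg v], fun heq => ?_, fun ⟨hy, hZ⟩ => ?_⟩
  · have hb : bend v = 0 := by linarith
    have hs : Real.sin (Real.pi * th v) ^ 2 ≤ 0 := (sin_sq_le_bend v).trans hb.le
    have hs0 : Real.sin (Real.pi * th v) = 0 := by nlinarith [sq_nonneg (Real.sin (Real.pi * th v))]
    have hcos : Real.cos v.2.1 = 1 := by
      unfold bend at hb; rw [hs0] at hb; linarith
    have hyb : |v.2.1| < 1 / 1000 := by have := hin.1; rwa [h2] at this
    have hy : v.2.1 = 0 := by
      have := abs_lt.1 hyb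
      have hpi := Real.pi_gt_three
      exact (Real.cos_eq_one_iff_of_lt_of_lt (by linarith) (by linarith)).1 hcos
    refine ⟨hy, ?_⟩
    obtain ⟨n, hn⟩ := Real.sin_eq_zero_iff.1 hs0
    have hn' : th v = n := by
      have := Real.pi_pos
      field_simp at hn
      linarith
    rw [hn'] at h
    have hnc : (n : ℝ) + 6 * k = c := by
      have h' := abs_lt.1 h
      rcases hcZ with ⟨rfl, -⟩ | ⟨rfl, -⟩
      · have : n + 6 * k = 4 := by
          have b1 : n + 6 * k < 5 := by
            have : ((n + 6 * k : ℤ) : ℝ) < (5 : ℤ) := by push_cast; linarith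
            exact_mod_cast this
          have b2 : 3 < n + 6 * k := by
            have : ((3 : ℤ) : ℝ) < ((n + 6 * k : ℤ) : ℝ) := by push_cast; linarith
            exact_mod_cast this
          omega
        exact_mod_cast this
      · have : n + 6 * k = 5 := by
          have b1 : n + 6 * k < 6 := by
            have : ((n + 6 * k : ℤ) : ℝ) < (6 : ℤ) := by push_cast; linarith
            exact_mod_cast this
          have b2 : 4 < n + 6 * k := by
            have : ((4 : ℤ) : ℝ) < ((n + 6 * k : ℤ) : ℝ) := by push_cast; linarith
            exact_mod_cast this
          omega
        exact_mod_cast this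
    rw [hn', hnc, hy, nbmp_zero] at a5
    rcases hcZ with ⟨rfl, rfl⟩ | ⟨rfl, rfl⟩
    · left; linarith
    · right; linarith
  · have hb : bend v = 0 := by
      rw [hy, nbmp_zero] at a5
      have hth : th v + 6 * k = c := by
        have a2' := abs_lt.1 a2
        rcases hcZ with ⟨rfl, rfl⟩ | ⟨rfl, rfl⟩ <;> rcases hZ with hZ | hZ <;> linarith
      have hcn : ∃ n : ℤ, th v = n := by
        rcases hcZ with ⟨rfl, -⟩ | ⟨rfl, -⟩
        · exact ⟨4 - 6 * k, by push_cast; linarith⟩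
        · exact ⟨5 - 6 * k, by push_cast; linarith⟩
      obtain ⟨n, hn⟩ := hcn
      unfold bend
      rw [hy, hn, mul_comm Real.pi, Real.sin_int_mul_pi]
      simp
    rw [hb, hy, add_zero]

/-- Reachability, along the plug field on the left and along the base flow on the right. -/
def Rch : (ℝ × ℝ × ℝ) ⊕ E4 → (ℝ × ℝ × ℝ) ⊕ E4 → Prop
  | .inl a, .inl b => ∃ τ, 0 ≤ τ ∧ RWt τ a b
  | .inr p, .inr q => ∃ τ, 0 ≤ τ ∧ q = DD τ p
  | _, _ => False

open Classical in
/-- The outer description of a crossing. -/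
noncomputable def outY (v : ℝ × ℝ × ℝ) : (ℝ × ℝ × ℝ) ⊕ E4 :=
  if In v then .inl (Lam (sh 3 v)) else .inr (ps v)

theorem Rch.trans {a b c} (h : Rch a b) (h' : Rch b c) : Rch a c := by
  rcases a with a | a <;> rcases b with b | b <;> rcases c with c | c <;>
    simp only [Rch] at h h' ⊢
  · obtain ⟨s, h1, h2⟩ := h
    obtain ⟨t, h3, h4⟩ := h'
    exact ⟨s + t, add_nonneg h1 h3, h2.trans h4⟩
  · obtain ⟨s, h1, h2⟩ := h
    obtain ⟨t, h3, h4⟩ := h'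
    exact ⟨t + s, add_nonneg h3 h1, by rw [h4, h2, DD_add]⟩

variable {v w : ℝ × ℝ × ℝ}

theorem Rch.facing (hv : Ev v) (zv : zz v = -2) (hw : Ev w) (zw : zz w = 2)
    (h : Rch (.inl (Lam v)) (.inl (Lam w))) :
    (In v ∧ In w ∧ RWt (1 / 25) (Lam (sh 3 v)) (Lam (sh 3 w))) ∨
      (¬ In v ∧ ¬ In w ∧ ∃ τ > 0, ps w = DD τ (ps v)) := by
  obtain ⟨τ, -, h⟩ := h
  obtain ⟨k, h1, h2⟩ := h.facing zv zw
  have := facing_outside hv.GG ((GG_sh w k).2 hw.GG) zv (by rw [zz_sh]; exact zw)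
    (by rw [th_sh]; exact h1) (by rw [rr_sh]; exact h2)
  rw [In_sh, sh_comm, Lam_sh, show (6 * (k : ℝ)) = 3 * ((2 * k : ℤ) : ℝ) by push_cast; ring,
    ps_sh] at this
  rw [show 3 * ((2 * k : ℤ) : ℝ) = (6 * (k : ℝ)) by push_cast; ring] at this
  exact this.imp (fun ⟨a, b, c⟩ => ⟨a, b, c.of_sh_right k⟩) id

theorem Rch.match_ends (hv : Ev v) (zv : zz v = -2) (hw : Ev w) (zw : zz w = 2)
    (h : Rch (.inl (Lam v)) (.inl (Lam w))) : Rch (outY v) (outY w) := by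
  rcases h.facing hv zv hw zw with ⟨h1, h2, h3⟩ | ⟨h1, h2, τ, h3, h4⟩
  · rw [outY, outY, if_pos h1, if_pos h2]
    exact ⟨_, by norm_num, h3⟩
  · rw [outY, outY, if_neg h1, if_neg h2]
    exact ⟨τ, h3.le, h4⟩

theorem Rch.rad_lt (hw : Ev w) (hz : |zz v| = 2)
    (h : Rch (.inl (Lam v)) (outY w)) : rr v < rr w := by
  unfold outY at h
  split_ifs at h with hin
  · obtain ⟨τ, -, h⟩ := h
    obtain ⟨h1, h2, -⟩ := rad_lt_aux hw.GG hw.2 hin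
    have hr : rr v = rr (sh 3 w) := h.r_eq
    rw [hr]
    refine lt_of_le_of_ne h1 fun he => ?_
    obtain ⟨h3, h4⟩ := h2 he
    have h5 : zz v = _ := h.symm_z_eq_of_circle h3 h4
    rw [← h5] at h4
    rcases h4 with h4 | h4 <;> rw [h4] at hz <;> norm_num at hz
  · exact h.elim

theorem Rch.rad_lt' (hw : Ev w) (hz : |zz v| = 2)
    (h : Rch (outY w) (.inl (Lam v))) : rr v < rr w := by
  unfold outY at h
  split_ifs at h with hin
  · obtain ⟨τ, -, h⟩ := h
    obtain ⟨h1, h2, -⟩ := rad_lt_aux hw.GG hw.2 hin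
    have hr : rr (sh 3 w) = rr v := h.r_eq
    rw [← hr]
    refine lt_of_le_of_ne h1 fun he => ?_
    obtain ⟨h3, h4⟩ := h2 he
    have h5 : zz v = _ := h.z_eq_of_circle h3 h4
    rw [← h5] at h4
    rcases h4 with h4 | h4 <;> rw [h4] at hz <;> norm_num at hz
  · exact h.elim

theorem GG.box (h : GG v) : Box v := by
  obtain ⟨h1, h2⟩ := abs_le_of_GG h
  exact ⟨by linarith, by linarith⟩

theorem Rch.no_cycle (hv : Ev v) (zv : zz v = -2) (hw : Ev w) (zw : zz w = 2)
    (h : Rch (.inl (Lam v)) (.inl (Lam w))) (h' : Rch (outY w) (outY v)) : False := by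
  have hne : rr v ≠ 0 := by
    obtain ⟨τ, -, h⟩ := h
    exact h.r_ne_zero zv zw
  rcases h.facing hv zv hw zw with ⟨h1, h2, h3⟩ | ⟨h1, h2, τ, h3, h4⟩
  · rw [outY, outY, if_pos h1, if_pos h2] at h'
    obtain ⟨s, hs, h'⟩ := h'
    have := (h3.trans h').closed (by linarith)
    exact hne ((rad_lt_aux hv.GG hv.2 h1).2.2 this)
  · rw [outY, outY, if_neg h1, if_neg h2] at h'
    obtain ⟨s, hs, h'⟩ := h'
    rw [h4, ← DD_add] at h'
    obtain ⟨h5, h6⟩ := special_of_ps hv.GG.box (DD_closed (by linarith) h'.symm)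
    exact hne (rr_eq_zero_of_special hv.GG h5 h6)

end Kuperberg

namespace Kuperberg
open Set Filter Topology
open scoped ContDiff

/-- A lift to the interior of a plug which is not superseded by the opposite strand. -/
def Wt (v : ℝ × ℝ × ℝ) : Prop := |rr v| < 1 / 1000 ∧ |zz v| < 2 ∧ ¬ Nest v

/-- The point of the sphere is a crossing. -/
def EvP (p : E4) : Prop := ∃ v, Ev v ∧ ps v = p

@[fun_prop] theorem continuous_rr : Continuous rr := contDiff_rr.continuous
@[fun_prop] theorem continuous_zz : Continuous zz := contDiff_zz.continuous
@[fun_prop] theorem continuous_Lam : Continuous Lam := contDiff_Lam.continuous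
@[fun_prop] theorem continuous_sh (c : ℝ) : Continuous (sh c) := (contDiff_sh c).continuous
@[fun_prop] theorem continuous_ps : Continuous ps := contDiff_ps.continuous

theorem isOpen_Child : IsOpen {v | Child v} := by
  have : {v | Child v} = ⋃ k : ℤ, {v : ℝ × ℝ × ℝ | 7 / 2 < v.1 + 6 * k ∧ v.1 + 6 * k < 11 / 2} := by
    ext v; simp [Child]
  rw [this]
  exact isOpen_iUnion fun k => IsOpen.and (isOpen_lt (by fun_prop) (by fun_prop))
    (isOpen_lt (by fun_prop) (by fun_prop))

theorem isOpen_inside : IsOpen {v | |rr v| < 1 / 1000 ∧ |zz v| < 2} :=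
  IsOpen.and (isOpen_lt (by fun_prop) (by fun_prop)) (isOpen_lt (by fun_prop) (by fun_prop))

theorem isOpen_Nest : IsOpen {v | Nest v} :=
  (isOpen_Child.inter isOpen_inside).preimage (continuous_sh 3)

theorem isClosed_GG : IsClosed {v | GG v} :=
  IsClosed.and (isClosed_le (by fun_prop) (by fun_prop)) (isClosed_le (by fun_prop) (by fun_prop))

theorem ps_sh_three (v) : ps (sh 3 v) = ps v := by
  simpa using ps_sh v 1

theorem exists_Wt {v : ℝ × ℝ × ℝ} (h : |rr v| < 1 / 1000 ∧ |zz v| < 2) :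
    ∃ w, Wt w ∧ ps w = ps v := by
  by_cases hn : Nest v
  · exact ⟨sh 3 v, ⟨hn.2.1, hn.2.2, (not_nest_of_nest ⟨h.1.le, h.2.le⟩ hn).2.1⟩, ps_sh_three v⟩
  · exact ⟨v, ⟨h.1, h.2, hn⟩, rfl⟩

theorem XX_eq_X0_of_outside {p : E4} (h : ∀ v, ps v = p → ¬ Wt v) : XX p = X0 p := by
  refine XX_eq_X0 fun v _ hv => ?_
  have key : ∀ w, ps w = p → QQ w = 0 := by
    intro w hw
    by_contra hq
    obtain ⟨h1, h2, -⟩ := QQ_ne hq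
    obtain ⟨u, hu, hu'⟩ := exists_Wt (v := w) ⟨by linarith, by linarith⟩
    exact h u (hu'.trans hw) hu
  unfold PP
  rw [key v hv, key (sh 3 v) (by rw [ps_sh_three, hv])]
  simp

theorem IsSol.sh_three {σ : ℝ → ℝ × ℝ × ℝ} (h : IsSol PP σ) : IsSol PP fun t => sh 3 (σ t) := by
  intro t
  simp only [PP_sh_three]
  exact hasDerivAt_sh 3 (h t)

theorem IsSol.hasDerivAt_Lam_of {σ : ℝ → ℝ × ℝ × ℝ} (h : IsSol PP σ) {t : ℝ} (hG : GG (σ t))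
    (hn : ¬ Nest (σ t)) : HasDerivAt (fun s => Lam (σ s)) (WW (Lam (σ t))) t := by
  have := h t
  rw [PP_eq hG hn] at this
  exact hasDerivAt_Lam hG this

theorem IsSol.rr_eventually_const {σ : ℝ → ℝ × ℝ × ℝ} (h : IsSol PP σ) {t : ℝ}
    (hG : ∀ᶠ u in 𝓝 t, GG (σ u) ∧ ¬ Nest (σ u)) : ∀ᶠ u in 𝓝 t, rr (σ u) = rr (σ t) := by
  obtain ⟨ε, hε, hb⟩ := Metric.eventually_nhds_iff_ball.1 hG
  have hd : ∀ u ∈ Metric.ball t ε, HasDerivAt (fun s => rr (σ s)) 0 u := fun u hu =>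
    hasDerivAt_fst' (hasDerivAt_snd' (h.hasDerivAt_Lam_of (hb u hu).1 (hb u hu).2))
  filter_upwards [Metric.ball_mem_nhds t hε] with u hu
  exact Metric.isOpen_ball.is_const_of_deriv_eq_zero (convex_ball t ε).isPreconnected
    (fun u hu => (hd u hu).differentiableAt.differentiableWithinAt) (fun u hu => (hd u hu).deriv)
    hu (Metric.mem_ball_self hε)

variable {γ : ℝ → E4} {σ : ℝ → ℝ × ℝ × ℝ} {a b : ℝ}

theorem frequently_closed {p : ℝ → Prop} (hp : IsClosed {u | p u}) {t : ℝ} (h : ∃ᶠ u in 𝓝 t, p u) :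
    p t :=
  hp.mem_of_frequently_of_tendsto h tendsto_id

/-- Without crossings, a solution inside the opposite strand stays there. -/
theorem opposite_persist (hσ : IsSol PP σ) {s : Set ℝ} (hs : IsOpen s) (hc : IsPreconnected s)
    (hch : ∀ u ∈ s, Child (σ u)) (hev : ∀ u ∈ s, ¬ Ev (σ u)) {t₀ : ℝ} (ht₀ : t₀ ∈ s)
    (h₀ : |rr (σ t₀)| < 1 / 1000 ∧ |zz (σ t₀)| < 2) :
    ∀ u ∈ s, |rr (σ u)| < 1 / 1000 ∧ |zz (σ u)| < 2 := by
  have hcont := hσ.continuous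
  have := connected_induction hs hc (p := fun u => (|rr (σ u)| < 1 / 1000 ∧ |zz (σ u)| < 2) ∧
    rr (σ u) = rr (σ t₀)) ht₀ ⟨h₀, rfl⟩ (fun t ht ⟨h1, h2⟩ => ?_) (fun t ht hf => ?_)
  · exact fun u hu => (this u hu).1
  · have e1 := hcont.continuousAt.eventually (isOpen_inside.mem_nhds h1)
    have e2 : ∀ᶠ u in 𝓝 t, GG (σ u) ∧ ¬ Nest (σ u) := by
      filter_upwards [e1, hs.mem_nhds ht] with u hu hus
      have hG : GG (σ u) := ⟨hu.1.le, hu.2.le⟩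
      exact ⟨hG, fun hn => (not_nest_of_nest hG hn).2.2 (hch u hus)⟩
    filter_upwards [e1, hσ.rr_eventually_const e2] with u hu hu'
    exact ⟨hu, by rw [hu', h2]⟩
  · have c1 : IsClosed {u | |zz (σ u)| ≤ 2 ∧ rr (σ u) = rr (σ t₀)} :=
      IsClosed.and (isClosed_le (by fun_prop) (by fun_prop)) (isClosed_eq (by fun_prop) (by fun_prop))
    obtain ⟨h1, h2⟩ := frequently_closed c1 (hf.mono fun u hu => ⟨hu.1.2.le, hu.2⟩)
    have h3 : |rr (σ t)| < 1 / 1000 := by rw [h2]; exact h₀.1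
    exact ⟨⟨h3, lt_of_le_of_ne h1 fun he => hev t ht ⟨h3, he⟩⟩, h2⟩

theorem IsCurve.persist (hγ : IsCurve γ) (hσ : IsSol PP σ) (hev : ∀ u ∈ Ioo a b, ¬ EvP (γ u))
    {t₀ : ℝ} (ht₀ : t₀ ∈ Ioo a b) (h₀ : γ t₀ = ps (σ t₀)) (hW : Wt (σ t₀)) :
    ∀ u ∈ Ioo a b, γ u = ps (σ u) ∧ Wt (σ u) ∧ rr (σ u) = rr (σ t₀) := by
  have hcont := hσ.continuous
  have hγc := hγ.continuous
  refine connected_induction isOpen_Ioo isPreconnected_Ioo ht₀ ⟨h₀, hW, rfl⟩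
    (fun t ht ⟨h1, h2, h3⟩ => ?_) (fun t ht hf => ?_)
  · have hG : GG (σ t) := ⟨h2.1.le, h2.2.1.le⟩
    have e1 := hγ.eventually_lift hσ hG.box h1
    have e2 := hcont.continuousAt.eventually (isOpen_inside.mem_nhds ⟨h2.1, h2.2.1⟩)
    have e3 : ∀ᶠ u in 𝓝 t, ¬ Nest (σ u) := by
      by_contra hne
      have hfr : ∃ᶠ u in 𝓝 t, Nest (σ u) := by rwa [Filter.Frequently]
      have c1 : IsClosed {u | GG (sh 3 (σ u))} := isClosed_GG.preimage (by fun_prop)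
      have hG3 : GG (sh 3 (σ t)) :=
        frequently_closed c1 (hfr.mono fun u hu => ⟨hu.2.1.le, hu.2.2.le⟩)
      have hch : Child (sh 3 (σ t)) := by
        obtain ⟨-, k, hk | hk⟩ := inter_cases hG hG3
        · have := hk.child
          rwa [sh_comm, Child_sh] at this
        · exfalso
          obtain ⟨-, b1, b2⟩ := hk.bounds
          have o : IsOpen {u | 7 / 8 < (sh (6 * k) (sh 3 (σ u))).1 ∧
              (sh (6 * k) (sh 3 (σ u))).1 < 17 / 8} :=
            IsOpen.and (isOpen_lt (by fun_prop) (by fun_prop)) (isOpen_lt (by fun_prop) (by fun_prop))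
          obtain ⟨u, hu, h4, h5⟩ := (hfr.and_eventually (o.mem_nhds ⟨b1, b2⟩)).exists
          obtain ⟨j, hj1, hj2⟩ := hu.1
          rw [sh_fst] at h4 h5
          have a1 : (0 : ℤ) < j - k := by
            have : (0 : ℝ) < ((j - k : ℤ) : ℝ) := by push_cast; linarith
            exact_mod_cast this
          have a2 : j - k < 1 := by
            have : ((j - k : ℤ) : ℝ) < 1 := by push_cast; linarith
            exact_mod_cast this
          omega
      have hN : ∀ᶠ u in 𝓝 t, Child (sh 3 (σ u)) ∧ γ u = ps (σ u) ∧ u ∈ Ioo a b := by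
        have o : IsOpen {u | Child (sh 3 (σ u))} := isOpen_Child.preimage (by fun_prop)
        filter_upwards [o.mem_nhds hch, e1, isOpen_Ioo.mem_nhds ht] with u hu1 hu2 hu3
        exact ⟨hu1, hu2, hu3⟩
      obtain ⟨ε, hε, hb⟩ := Metric.eventually_nhds_iff_ball.1 hN
      obtain ⟨u₁, hu₁, hu₁'⟩ := (hfr.and_eventually (Metric.ball_mem_nhds t hε)).exists
      have := opposite_persist hσ.sh_three Metric.isOpen_ball (convex_ball t ε).isPreconnected
        (fun u hu => (hb u hu).1)
        (fun u hu he => hev u (hb u hu).2.2 ⟨_, he, by rw [ps_sh_three, (hb u hu).2.1]⟩) hu₁' hu₁.2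
        t (Metric.mem_ball_self hε)
      exact h2.2.2 ⟨hch, this⟩
    have e4 : ∀ᶠ u in 𝓝 t, GG (σ u) ∧ ¬ Nest (σ u) := by
      filter_upwards [e2, e3] with u hu hu'
      exact ⟨⟨hu.1.le, hu.2.le⟩, hu'⟩
    filter_upwards [e1, e2, e3, hσ.rr_eventually_const e4] with u hu1 hu2 hu3 hu4
    exact ⟨hu1, ⟨hu2.1, hu2.2, hu3⟩, by rw [hu4, h3]⟩
  · have c1 : IsClosed {u | γ u = ps (σ u) ∧ |zz (σ u)| ≤ 2 ∧ rr (σ u) = rr (σ t₀)} :=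
      IsClosed.and (isClosed_eq (by fun_prop) (by fun_prop))
        (IsClosed.and (isClosed_le (by fun_prop) (by fun_prop)) (isClosed_eq (by fun_prop) (by fun_prop)))
    obtain ⟨h1, h2, h3⟩ := frequently_closed c1
      (hf.mono fun u hu => ⟨hu.1, hu.2.1.2.1.le, hu.2.2⟩)
    have h4 : |rr (σ t)| < 1 / 1000 := by rw [h3]; exact hW.1
    have c2 : IsClosed {u | ¬ Nest (σ u)} := (isOpen_Nest.preimage hcont).isClosed_compl
    exact ⟨h1, ⟨h4, lt_of_le_of_ne h2 fun he => hev t ht ⟨_, ⟨h4, he⟩, h1.symm⟩,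
      frequently_closed c2 (hf.mono fun u hu => hu.2.1.2.2)⟩, h3⟩

/-- Between two crossings, a solution inside the plug follows the straightened field. -/
theorem IsCurve.inside (hγ : IsCurve γ) (hσ : IsSol PP σ) (hev : ∀ u ∈ Ioo a b, ¬ EvP (γ u))
    {t₀ : ℝ} (ht₀ : t₀ ∈ Ioo a b) (h₀ : γ t₀ = ps (σ t₀)) (hW : Wt (σ t₀)) :
    (∀ u ∈ Icc a b, γ u = ps (σ u) ∧ |rr (σ u)| < 1 / 1000 ∧ |zz (σ u)| ≤ 2) ∧
      ∃ ρ, IsSol WW ρ ∧ ∀ u ∈ Icc a b, Lam (σ u) = ρ u := by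
  have hcont := hσ.continuous
  have hγc := hγ.continuous
  have hp := hγ.persist hσ hev ht₀ h₀ hW
  have hab : a ≠ b := (ht₀.1.trans ht₀.2).ne
  constructor
  · have c1 : IsClosed {u | γ u = ps (σ u) ∧ rr (σ u) = rr (σ t₀) ∧ |zz (σ u)| ≤ 2} :=
      IsClosed.and (isClosed_eq (by fun_prop) (by fun_prop))
        (IsClosed.and (isClosed_eq (by fun_prop) (by fun_prop)) (isClosed_le (by fun_prop) (by fun_prop)))
    intro u hu
    rw [← closure_Ioo hab] at hu
    have hsub : Ioo a b ⊆ {u | γ u = ps (σ u) ∧ rr (σ u) = rr (σ t₀) ∧ |zz (σ u)| ≤ 2} :=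
      fun u hu => ⟨(hp u hu).1, (hp u hu).2.2, (hp u hu).2.1.2.1.le⟩
    obtain ⟨h1, h2, h3⟩ := closure_minimal hsub c1 hu
    exact ⟨h1, by rw [h2]; exact hW.1, h3⟩
  · obtain ⟨ρ, h1, h2⟩ := exists_isSol_WW t₀ (Lam (σ t₀))
    refine ⟨ρ, h2, ?_⟩
    have h3 := eqOn_of_hasDerivAt contDiff_one_WW isOpen_Ioo isPreconnected_Ioo
      (fun u hu => hσ.hasDerivAt_Lam_of (t := u)
        ⟨(hp u hu).2.1.1.le, (hp u hu).2.1.2.1.le⟩ (hp u hu).2.1.2.2)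
      (fun u _ => h2 u) ht₀ h1.symm
    have hρ := h2.continuous
    have c1 : IsClosed {u | Lam (σ u) = ρ u} := isClosed_eq (by fun_prop) (by fun_prop)
    intro u hu
    rw [← closure_Ioo hab] at hu
    exact closure_minimal h3 c1 hu

end Kuperberg

namespace Kuperberg
open Set Filter Topology
open scoped ContDiff

variable {γ : ℝ → E4} {σ : ℝ → ℝ × ℝ × ℝ} {s t : ℝ} {v w : ℝ × ℝ × ℝ}

theorem IsSol.hasDerivAt_zz (hσ : IsSol PP σ) (hG : GG (σ t)) (hz : |zz (σ t)| = 2) :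
    HasDerivAt (fun u => zz (σ u)) (1 / kk (σ t).1) t := by
  have h := hσ.hasDerivAt_Lam_of hG (not_nest_of_abs_zz_eq hG hz)
  have h1 := hasDerivAt_snd' (hasDerivAt_snd' h)
  have h2 : gg (Lam (σ t)) = 1 :=
    (ff_gg_outside (Or.inr (by show _ ≤ |zz (σ t)|; rw [hz]; norm_num))).2
  have h3 : (WW (Lam (σ t))).2.2 = 1 / kk (σ t).1 := by
    show gg (Lam (σ t)) / kk (th (σ t)) = _
    rw [h2, (zone_facts hG).2.2.2.1]
  rw [h3] at h1
  exact h1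

/-- Just after an entry the solution is inside the plug. -/
theorem IsSol.inside_after (hσ : IsSol PP σ) (hE : Ev (σ t)) (hz : zz (σ t) = -2) :
    ∀ᶠ u in 𝓝[>] t, |rr (σ u)| < 1 / 1000 ∧ |zz (σ u)| < 2 := by
  have hcont := hσ.continuous
  have hd := hσ.hasDerivAt_zz hE.GG hE.2
  have o : IsOpen {u | |rr (σ u)| < 1 / 1000 ∧ zz (σ u) < 2} :=
    IsOpen.and (isOpen_lt (by fun_prop) (by fun_prop)) (isOpen_lt (by fun_prop) (by fun_prop))
  have hpos : 0 < 1 / kk (σ t).1 := by have := kk_pos (σ t).1; positivity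
  have h1 : ∀ᶠ u in 𝓝[>] t, 0 < slope (fun u => zz (σ u)) t u :=
    (hasDerivAt_iff_tendsto_slope.1 hd).mono_left (nhdsWithin_mono _ fun u hu => ne_of_gt hu)
      |>.eventually (lt_mem_nhds hpos)
  filter_upwards [h1, nhdsWithin_le_nhds (o.mem_nhds ⟨hE.1, by rw [hz]; norm_num⟩),
    self_mem_nhdsWithin] with u hu1 hu2 hu3
  rw [slope_def_field, hz] at hu1
  have hu4 : 0 < u - t := sub_pos.2 hu3
  have := (div_pos_iff_of_pos_right hu4).1 hu1
  exact ⟨hu2.1, abs_lt.2 ⟨by linarith, hu2.2⟩⟩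

/-- Just before an exit the solution is inside the plug. -/
theorem IsSol.inside_before (hσ : IsSol PP σ) (hE : Ev (σ t)) (hz : zz (σ t) = 2) :
    ∀ᶠ u in 𝓝[<] t, |rr (σ u)| < 1 / 1000 ∧ |zz (σ u)| < 2 := by
  have hcont := hσ.continuous
  have hd := hσ.hasDerivAt_zz hE.GG hE.2
  have o : IsOpen {u | |rr (σ u)| < 1 / 1000 ∧ -2 < zz (σ u)} :=
    IsOpen.and (isOpen_lt (by fun_prop) (by fun_prop)) (isOpen_lt (by fun_prop) (by fun_prop))
  have hpos : 0 < 1 / kk (σ t).1 := by have := kk_pos (σ t).1; positivity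
  have h1 : ∀ᶠ u in 𝓝[<] t, 0 < slope (fun u => zz (σ u)) t u :=
    (hasDerivAt_iff_tendsto_slope.1 hd).mono_left (nhdsWithin_mono _ fun u hu => ne_of_lt hu)
      |>.eventually (lt_mem_nhds hpos)
  filter_upwards [h1, nhdsWithin_le_nhds (o.mem_nhds ⟨hE.1, by rw [hz]; norm_num⟩),
    self_mem_nhdsWithin] with u hu1 hu2 hu3
  rw [slope_def_field, hz] at hu1
  have hu4 : u - t < 0 := sub_neg.2 hu3
  have : zz (σ u) - 2 < 0 := by
    by_contra hc
    exact absurd hu1 (not_lt.2 (div_nonpos_of_nonneg_of_nonpos (not_lt.1 hc) hu4.le))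
  exact ⟨hu2.1, abs_lt.2 ⟨hu2.2, by linarith⟩⟩

/-- Crossings in the weak sense, including the rim of the plug. -/
def WE (v : ℝ × ℝ × ℝ) : Prop := |rr v| ≤ 1 / 1000 ∧ |zz v| = 2

theorem isClosed_WE : IsClosed {v | WE v} :=
  IsClosed.and (isClosed_le (by fun_prop) (by fun_prop)) (isClosed_eq (by fun_prop) (by fun_prop))

theorem WE.GG (h : WE v) : GG v := ⟨h.1, h.2.le⟩

theorem WE.not_opposite (h : WE v) : ¬ WE (sh 3 v) := by
  intro h'
  obtain ⟨-, k, hk⟩ := opposite_of_abs_zz_eq h.GG h.2 h'.GG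
  exact absurd h'.2 hk.abs_zz_lt.ne

theorem Ev.WE (h : Ev v) : WE v := ⟨h.1.le, h.2⟩

theorem WE_sh (v) (k : ℤ) : WE (sh (6 * k) v) ↔ WE v := by
  unfold WE
  rw [rr_sh, zz_sh]

theorem isClosed_image_WE : IsClosed (ps '' {v | WE v}) := by
  have h : ps '' {v | WE v} =
      ps '' ({v | WE v} ∩ (Icc (0 : ℝ) 7 ×ˢ Icc (-3 : ℝ) 3 ×ˢ Icc (-10 : ℝ) 10)) := by
    refine Subset.antisymm ?_ (image_mono inter_subset_left)
    rintro _ ⟨v, hv, rfl⟩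
    obtain ⟨k, hk1, hk2⟩ := exists_window v.1
    obtain ⟨h1, h2⟩ := abs_le_of_GG hv.GG
    have h1' := abs_lt.1 h1
    have h2' := abs_le.1 h2
    refine ⟨sh (6 * k) v, ⟨(WE_sh v k).2 hv, ⟨?_, ?_⟩, ⟨?_, ?_⟩, ?_, ?_⟩, ?_⟩
    · simp only [sh_fst]; linarith
    · simp only [sh_fst]; linarith
    · simp only [sh_snd]; linarith
    · simp only [sh_snd]; linarith
    · simp only [sh_snd]; linarith
    · simp only [sh_snd]; linarith
    · rw [show (6 * (k : ℝ)) = 3 * ((2 * k : ℤ) : ℝ) by push_cast; ring, ps_sh]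
  rw [h]
  refine (IsCompact.image ?_ continuous_ps).isClosed
  exact (isCompact_Icc.prod (isCompact_Icc.prod isCompact_Icc)).inter_left isClosed_WE

theorem IsCurve.eventually_not_EvP (hγ : IsCurve γ) (t : ℝ) : ∀ᶠ u in 𝓝[≠] t, ¬ EvP (γ u) := by
  by_cases h : γ t ∈ ps '' {v | WE v}
  · obtain ⟨v, hv, hvt⟩ := h
    obtain ⟨σ, h1, h2⟩ := exists_isSol_PP t v
    have hcont := h2.continuous
    rw [← h1] at hv hvt
    have e1 := hγ.eventually_lift h2 hv.GG.box hvt.symm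
    have hd := h2.hasDerivAt_zz hv.GG hv.2
    have hne : 1 / kk (σ t).1 ≠ 0 := by have := kk_pos (σ t).1; positivity
    have e2 := hd.eventually_ne (c := 2) hne
    have e3 := hd.eventually_ne (c := -2) hne
    have o : IsOpen {u | ¬ WE (sh 3 (σ u))} := by
      have : IsClosed {u | WE (sh 3 (σ u))} := isClosed_WE.preimage (by fun_prop)
      exact this.isOpen_compl
    have e4 := isOpen_Box.preimage hcont |>.mem_nhds hv.GG.box
    filter_upwards [nhdsWithin_le_nhds e1, e2, e3, nhdsWithin_le_nhds (o.mem_nhds hv.not_opposite),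
      nhdsWithin_le_nhds e4] with u hu1 hu2 hu3 hu4 hu5
    rintro ⟨w, hw, hwu⟩
    obtain ⟨k, rfl⟩ := ps_inj hu5 hw.GG.box (by rw [hwu, hu1])
    obtain ⟨j, hj | hj⟩ := sh_three_cases (σ u) k
    · rw [hj, Ev_sh] at hw
      rcases (abs_eq (by norm_num)).1 hw.2 with h | h
      · exact hu2 h
      · exact hu3 h
    · rw [hj, Ev_sh] at hw
      exact hu4 hw.WE
  · have := hγ.continuous.continuousAt.eventually (isClosed_image_WE.isOpen_compl.mem_nhds h)
    filter_upwards [nhdsWithin_le_nhds this] with u hu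
    rintro ⟨v, hv, hvu⟩
    exact hu ⟨v, hv.WE, hvu⟩

open Classical in
/-- The state just after a crossing. -/
noncomputable def startY (v : ℝ × ℝ × ℝ) : (ℝ × ℝ × ℝ) ⊕ E4 :=
  if zz v = -2 then .inl (Lam v) else outY v

open Classical in
/-- The state just before a crossing. -/
noncomputable def endY (v : ℝ × ℝ × ℝ) : (ℝ × ℝ × ℝ) ⊕ E4 :=
  if zz v = -2 then outY v else .inl (Lam v)

theorem child_of_opposite (h : WE v) (h3 : GG (sh 3 v)) : Child v := by
  obtain ⟨-, k, hk⟩ := opposite_of_abs_zz_eq h.GG h.2 h3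
  have := hk.child
  rwa [sh_comm, Child_sh, sh_sh, show (3 + 3 : ℝ) = 6 * (1 : ℤ) by norm_num, Child_sh] at this

theorem Ev.cases (h : Ev v) : zz v = -2 ∨ zz v = 2 := by
  rcases (abs_eq (by norm_num)).1 h.2 with h | h
  · exact Or.inr h
  · exact Or.inl h

/-- At a crossing, a lift of the curve which is on the plug is the crossing or is opposite. -/
theorem lift_cases (hv : Ev v) (h : ps w = ps v) (hw : |rr w| < 1 / 1000 ∧ |zz w| ≤ 2) :
    (∃ j : ℤ, w = sh (6 * j) v) ∨ (∃ j : ℤ, w = sh (6 * j) (sh 3 v)) ∧ In v ∧ Child v := by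
  obtain ⟨k, rfl⟩ := ps_inj hv.GG.box (GG.box ⟨hw.1.le, hw.2⟩) h.symm
  obtain ⟨j, hj | hj⟩ := sh_three_cases v k
  · exact Or.inl ⟨j, hj⟩
  · right
    rw [hj, rr_sh, zz_sh] at hw
    refine ⟨⟨j, hj⟩, ⟨hw.1, lt_of_le_of_ne hw.2 fun he => hv.WE.not_opposite ⟨hw.1.le, he⟩⟩,
      child_of_opposite hv.WE ⟨hw.1.le, hw.2⟩⟩

theorem nest_of_opposite {j : ℤ} (h : v = sh (6 * (j : ℝ)) (sh 3 w)) : sh 3 v = sh (6 * ((j + 1 : ℤ) : ℝ)) w := by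
  rw [h, sh_sh, sh_sh]; congr 1; push_cast; ring

/-- Reachability between the states at consecutive crossings, when the curve is in a plug. -/
theorem IsCurve.arc_inside (hγ : IsCurve γ) (hev : ∀ u ∈ Ioo s t, ¬ EvP (γ u))
    (hv : Ev v) (hvs : ps v = γ s) (hw : Ev w) (hwt : ps w = γ t) {τ : ℝ} (hτ : τ ∈ Ioo s t)
    {x : ℝ × ℝ × ℝ} (hx : Wt x) (hxτ : ps x = γ τ) : Rch (startY v) (endY w) := by
  obtain ⟨σ, rfl, hσ⟩ := exists_isSol_PP τ x
  have hst : s < t := hτ.1.trans hτ.2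
  have hp := hγ.persist hσ hev hτ hxτ.symm hx
  obtain ⟨hI, ρ, hρ, hL⟩ := hγ.inside hσ hev hτ hxτ.symm hx
  have hsI : s ∈ Icc s t := ⟨le_rfl, hst.le⟩
  have htI : t ∈ Icc s t := ⟨hst.le, le_rfl⟩
  have hz : ∀ u ∈ Icc s t, zz (σ u) = (ρ u).2.2 := fun u hu => congrArg (fun w => w.2.2) (hL u hu)
  have hτz := abs_lt.1 hx.2.1
  have hs1 : zz (σ s) ≤ zz (σ τ) := by
    rw [hz s hsI, hz τ ⟨hτ.1.le, hτ.2.le⟩]; exact hρ.z_mono hτ.1.le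
  have ht1 : zz (σ τ) ≤ zz (σ t) := by
    rw [hz t htI, hz τ ⟨hτ.1.le, hτ.2.le⟩]; exact hρ.z_mono hτ.2.le
  have hR : RWt (t - s) (Lam (σ s)) (Lam (σ t)) := by
    rw [hL s hsI, hL t htI]; exact hρ.RWt s t
  have hS : ∃ (j : ℤ) (a : ℝ × ℝ × ℝ), Lam (σ s) = sh (6 * j) a ∧ startY v = .inl a := by
    rcases lift_cases hv (by rw [← (hI s hsI).1, hvs]) (hI s hsI).2 with
      ⟨j, hj⟩ | ⟨⟨j, hj⟩, hin, hc⟩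
    · refine ⟨j, Lam v, by rw [hj, Lam_sh], if_pos ?_⟩
      rw [hj, zz_sh] at hs1
      rcases hv.cases with h | h
      · exact h
      · linarith
    · refine ⟨j, Lam (sh 3 v), by rw [hj, Lam_sh], ?_⟩
      have hne : zz v ≠ -2 := by
        intro he
        have h3 := nest_of_opposite hj
        have e1 := hσ.sh_three.inside_after (t := s) (by simp only [h3, Ev_sh]; exact hv)
          (by simp only [h3, zz_sh]; exact he)
        have o : IsOpen {u | Child (sh 3 (σ u))} :=
          isOpen_Child.preimage ((continuous_sh 3).comp hσ.continuous)
        have e2 := nhdsWithin_le_nhds (s := Ioi s) (o.mem_nhds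
          (show Child (sh 3 (σ s)) by rw [h3, Child_sh]; exact hc))
        obtain ⟨u, hu1, hu2, hu3⟩ := (e1.and (Filter.Eventually.and e2 (Ioo_mem_nhdsGT hst))).exists
        exact (hp u hu3).2.1.2.2 ⟨hu2, hu1⟩
      rw [startY, if_neg hne, outY, if_pos hin]
  have hE : ∃ (j : ℤ) (b : ℝ × ℝ × ℝ), Lam (σ t) = sh (6 * j) b ∧ endY w = .inl b := by
    rcases lift_cases hw (by rw [← (hI t htI).1, hwt]) (hI t htI).2 with
      ⟨j, hj⟩ | ⟨⟨j, hj⟩, hin, hc⟩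
    · refine ⟨j, Lam w, by rw [hj, Lam_sh], if_neg ?_⟩
      rw [hj, zz_sh] at ht1
      intro h
      linarith
    · refine ⟨j, Lam (sh 3 w), by rw [hj, Lam_sh], ?_⟩
      have he : zz w = -2 := by
        rcases hw.cases with h | h
        · exact h
        · exfalso
          have h3 := nest_of_opposite hj
          have e1 := hσ.sh_three.inside_before (t := t) (by simp only [h3, Ev_sh]; exact hw)
            (by simp only [h3, zz_sh]; exact h)
          have o : IsOpen {u | Child (sh 3 (σ u))} :=
            isOpen_Child.preimage ((continuous_sh 3).comp hσ.continuous)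
          have e2 := nhdsWithin_le_nhds (s := Iio t) (o.mem_nhds
            (show Child (sh 3 (σ t)) by rw [h3, Child_sh]; exact hc))
          obtain ⟨u, hu1, hu2, hu3⟩ := (e1.and (Filter.Eventually.and e2 (Ioo_mem_nhdsLT hst))).exists
          exact (hp u hu3).2.1.2.2 ⟨hu2, hu1⟩
      rw [endY, if_pos he, outY, if_pos hin]
  obtain ⟨i, a, ha, ha'⟩ := hS
  obtain ⟨j, b, hb, hb'⟩ := hE
  rw [ha', hb']
  rw [ha, hb] at hR
  exact ⟨t - s, by linarith, (hR.of_sh_left i).of_sh_right j⟩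

theorem IsCurve.eq_DD_Icc (hγ : IsCurve γ) (hst : s < t)
    (hout : ∀ u ∈ Ioo s t, ∀ x, ps x = γ u → ¬ Wt x) : γ t = DD (t - s) (γ s) := by
  obtain ⟨τ, hτ⟩ : (Ioo s t).Nonempty := nonempty_Ioo.2 hst
  have h := hγ.eq_DD isOpen_Ioo isPreconnected_Ioo
    (fun u hu => XX_eq_X0_of_outside (hout u hu)) hτ
  have hγc := hγ.continuous
  have hDc := (isSol_DD (γ τ) τ).continuous
  have c1 : IsClosed {u | γ u = DD (u - τ) (γ τ)} := isClosed_eq hγc hDc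
  have hcl : ∀ u ∈ Icc s t, γ u = DD (u - τ) (γ τ) := by
    intro u hu
    rw [← closure_Ioo hst.ne] at hu
    exact closure_minimal h c1 hu
  rw [hcl t ⟨hst.le, le_rfl⟩, hcl s ⟨le_rfl, hst.le⟩, ← DD_add]
  congr 1; ring

theorem IsCurve.arc_outside (hγ : IsCurve γ) (hst : s < t)
    (hv : Ev v) (hvs : ps v = γ s) (hw : Ev w) (hwt : ps w = γ t)
    (hout : ∀ u ∈ Ioo s t, ∀ x, ps x = γ u → ¬ Wt x) : Rch (startY v) (endY w) := by
  have key : ∀ u ∈ Ioo s t, ∀ x, ps x = γ u → ¬ (|rr x| < 1 / 1000 ∧ |zz x| < 2) := by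
    intro u hu x hx h
    obtain ⟨y, hy, hy'⟩ := exists_Wt h
    exact hout u hu y (hy'.trans hx) hy
  have hS : startY v = .inr (ps v) := by
    obtain ⟨σ, rfl, hσ⟩ := exists_isSol_PP s v
    have hl := hγ.eventually_lift hσ hv.GG.box hvs.symm
    have hl' := nhdsWithin_le_nhds (s := Ioi s) hl
    have hne : zz (σ s) ≠ -2 := by
      intro he
      obtain ⟨u, hu1, hu2, hu3⟩ :=
        ((hσ.inside_after hv he).and (Filter.Eventually.and hl' (Ioo_mem_nhdsGT hst))).exists
      exact key u hu3 _ hu2.symm hu1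
    have hin : ¬ In (σ s) := by
      intro hin
      have o : IsOpen {u | |rr (sh 3 (σ u))| < 1 / 1000 ∧ |zz (sh 3 (σ u))| < 2} :=
        isOpen_inside.preimage ((continuous_sh 3).comp hσ.continuous)
      have e := nhdsWithin_le_nhds (s := Ioi s) (o.mem_nhds hin)
      obtain ⟨u, hu1, hu2, hu3⟩ :=
        (Filter.Eventually.and e (Filter.Eventually.and hl' (Ioo_mem_nhdsGT hst))).exists
      exact key u hu3 _ (by rw [ps_sh_three]; exact hu2.symm) hu1
    rw [startY, if_neg hne, outY, if_neg hin]
  have hE : endY w = .inr (ps w) := by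
    obtain ⟨σ, rfl, hσ⟩ := exists_isSol_PP t w
    have hl := hγ.eventually_lift hσ hw.GG.box hwt.symm
    have hl' := nhdsWithin_le_nhds (s := Iio t) hl
    have he : zz (σ t) = -2 := by
      rcases hw.cases with h | h
      · exact h
      · exfalso
        obtain ⟨u, hu1, hu2, hu3⟩ :=
          ((hσ.inside_before hw h).and (Filter.Eventually.and hl' (Ioo_mem_nhdsLT hst))).exists
        exact key u hu3 _ hu2.symm hu1
    have hin : ¬ In (σ t) := by
      intro hin
      have o : IsOpen {u | |rr (sh 3 (σ u))| < 1 / 1000 ∧ |zz (sh 3 (σ u))| < 2} :=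
        isOpen_inside.preimage ((continuous_sh 3).comp hσ.continuous)
      have e := nhdsWithin_le_nhds (s := Iio t) (o.mem_nhds hin)
      obtain ⟨u, hu1, hu2, hu3⟩ :=
        (Filter.Eventually.and e (Filter.Eventually.and hl' (Ioo_mem_nhdsLT hst))).exists
      exact key u hu3 _ (by rw [ps_sh_three]; exact hu2.symm) hu1
    rw [endY, if_pos he, outY, if_neg hin]
  rw [hS, hE]
  exact ⟨t - s, by linarith, by rw [hvs, hwt]; exact hγ.eq_DD_Icc hst hout⟩

/-- Reachability between the states at consecutive crossings. -/
theorem IsCurve.arc (hγ : IsCurve γ) (hst : s < t) (hev : ∀ u ∈ Ioo s t, ¬ EvP (γ u))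
    (hv : Ev v) (hvs : ps v = γ s) (hw : Ev w) (hwt : ps w = γ t) :
    Rch (startY v) (endY w) := by
  by_cases h : ∃ u ∈ Ioo s t, ∃ x, ps x = γ u ∧ Wt x
  · obtain ⟨τ, hτ, x, hx, hW⟩ := h
    exact hγ.arc_inside hev hv hvs hw hwt hτ hW hx
  · push Not at h
    exact hγ.arc_outside hst hv hvs hw hwt h

end Kuperberg

namespace Kuperberg
open Set Filter Topology
open scoped ContDiff

/-- A nonempty discrete closed set of reals invariant under a translation can be enumerated by the
integers in increasing order. -/
theorem exists_enumeration {S : Set ℝ} (hS : S.Nonempty) (hd : ∀ t, ∀ᶠ u in 𝓝[≠] t, u ∉ S)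
    {T : ℝ} (hT : 0 < T) (hper : ∀ t, t + T ∈ S ↔ t ∈ S) :
    ∃ (e : ℤ → ℝ) (n : ℤ), 0 < n ∧ StrictMono e ∧ (∀ k, e k ∈ S) ∧
      (∀ k, ∀ u ∈ Ioo (e k) (e (k + 1)), u ∉ S) ∧ ∀ k, e (k + n) = e k + T := by
  have hfin : ∀ a b : ℝ, (S ∩ Icc a b).Finite := by
    intro a b
    by_contra hinf
    obtain ⟨x, -, hx⟩ := Set.Infinite.exists_accPt_of_subset_isCompact hinf isCompact_Icc
      inter_subset_right
    rw [accPt_iff_frequently_nhdsNE] at hx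
    exact hx ((hd x).mono fun u hu hu' => hu hu'.1)
  have hsub : ∀ t, t - T ∈ S ↔ t ∈ S := fun t => by rw [← hper (t - T), sub_add_cancel]
  have hne : Nonempty S := hS.to_subtype
  have : NoMaxOrder S := ⟨fun x => ⟨⟨x + T, (hper _).2 x.2⟩, by
    rw [← Subtype.coe_lt_coe]; simpa using hT⟩⟩
  have : NoMinOrder S := ⟨fun x => ⟨⟨x - T, (hsub _).2 x.2⟩, by
    rw [← Subtype.coe_lt_coe]; simpa using hT⟩⟩
  let : LocallyFiniteOrder S := LocallyFiniteOrder.ofFiniteIcc fun a b => by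
    refine Set.Finite.of_finite_image ((hfin a b).subset ?_) Subtype.val_injective.injOn
    rintro _ ⟨x, hx, rfl⟩
    exact ⟨x.2, hx.1, hx.2⟩
  let : SuccOrder S := LinearLocallyFiniteOrder.succOrder S
  let : PredOrder S := LinearLocallyFiniteOrder.predOrder S
  let φ : S ≃o ℤ := orderIsoIntOfLinearSuccPredArch
  let τ : S ≃o S :=
    { toFun := fun x => ⟨x + T, (hper _).2 x.2⟩
      invFun := fun x => ⟨x - T, (hsub _).2 x.2⟩
      left_inv := fun x => by ext; simp
      right_inv := fun x => by ext; simp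
      map_rel_iff' := fun {x y} => by
        rw [← Subtype.coe_le_coe, ← Subtype.coe_le_coe]; simp }
  let g : ℤ ≃o ℤ := (φ.symm.trans τ).trans φ
  have hg : ∀ k, g k = k + g 0 := by
    have hs : ∀ k : ℤ, g (k + 1) = g k + 1 := fun k => by
      simpa [Order.succ_eq_add_one] using g.map_succ k
    intro k
    induction k using Int.induction_on with
    | zero => simp
    | succ i ih => rw [hs, ih]; ring
    | pred i ih =>
      have := hs (-(i : ℤ) - 1)
      rw [sub_add_cancel, ih] at this
      linarith
  refine ⟨fun k => (φ.symm k : ℝ), g 0, ?_, ?_, fun k => (φ.symm k).2, ?_, ?_⟩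
  · have h : φ.symm 0 < τ (φ.symm 0) := by
      rw [← Subtype.coe_lt_coe]
      show (φ.symm 0 : ℝ) < φ.symm 0 + T
      linarith
    have := φ.lt_iff_lt.2 h
    rwa [φ.apply_symm_apply] at this
  · intro a b hab
    exact Subtype.coe_lt_coe.2 (φ.symm.lt_iff_lt.2 hab)
  · intro k u hu huS
    have h1 : φ.symm k < ⟨u, huS⟩ := Subtype.coe_lt_coe.1 hu.1
    have h2 : ⟨u, huS⟩ < φ.symm (k + 1) := Subtype.coe_lt_coe.1 hu.2
    rw [φ.symm_apply_lt] at h1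
    rw [φ.lt_symm_apply] at h2
    lia
  · intro k
    have : φ.symm (k + g 0) = τ (φ.symm k) := by
      rw [← hg k]
      exact φ.symm_apply_apply _
    show (φ.symm (k + g 0) : ℝ) = _
    rw [this]
    rfl

variable {γ : ℝ → E4}

theorem eq_of_Lam_eq {v : ℝ × ℝ × ℝ} {x z : ℝ} (hG : GG v) (h : Lam v = (x, 0, z))
    (hx : x = 1 ∨ x = 2) : v = (x, 0, z) := by
  have hth : th v = x := congrArg Prod.fst h
  rcases zone_cases hG with h0 | ⟨-, k, hk⟩
  · have h1 : v.1 = x := by rw [← hth]; unfold th; rw [mul_assoc, h0]; ring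
    rw [← h, Lam_eq_self]
    rw [h1]
    rcases hx with rfl | rfl <;> norm_num
  · exfalso
    unfold NZ at hk
    rw [th_sh, hth] at hk
    have key : ∀ c : ℝ, 1 ≤ c - x → c - x ≤ 4 → |x + 6 * (k : ℝ) - c| < 1 / 8 → False := by
      intro c h1 h2 h3
      rw [abs_lt] at h3
      have a : (0 : ℤ) < k := by
        have : (0 : ℝ) < k := by linarith
        exact_mod_cast this
      have b : k < 1 := by
        have : (k : ℝ) < 1 := by linarith
        exact_mod_cast this
      lia
    rcases hk with ⟨-, hk, -⟩ | ⟨-, hk, -⟩ <;>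
      exact key _ (by rcases hx with rfl | rfl <;> norm_num)
        (by rcases hx with rfl | rfl <;> norm_num) hk

theorem nest_circle {x z : ℝ} (h : x = 1 ∧ z = -1 ∨ x = 2 ∧ z = 1) : Nest (x, 0, z) := by
  have hM : MZ (x, 0, z) := by
    rcases h with ⟨rfl, rfl⟩ | ⟨rfl, rfl⟩ <;> norm_num [MZ]
  have key : ∃ m : ℤ, (x + 3 : ℝ) = m ∧ hd (sh 3 (x, 0, z)) = 0 := by
    rcases h with ⟨rfl, rfl⟩ | ⟨rfl, rfl⟩
    · refine ⟨4, by norm_num, ?_⟩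
      unfold hd
      rw [sh_fst, show ((1 : ℝ), (0 : ℝ), (-1 : ℝ)).1 + 3 = 4 by norm_num,
        (ee_zone₄ (x := 4) (by norm_num)).2.2, sh_snd]
      norm_num
    · refine ⟨5, by norm_num, ?_⟩
      unfold hd
      rw [sh_fst, show ((2 : ℝ), (0 : ℝ), (1 : ℝ)).1 + 3 = 5 by norm_num,
        (ee_zone₅ (x := 5) (by norm_num)).2.2, sh_snd]
      norm_num
  obtain ⟨m, hm, hhd⟩ := key
  refine ⟨hM.child, ?_, ?_⟩
  · have hth : th (sh 3 (x, 0, z)) = m := by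
      unfold th
      rw [hhd, sh_fst, ← hm]
      ring
    unfold rr bend
    rw [hth, mul_comm Real.pi, Real.sin_int_mul_pi]
    simp [sh_snd]
  · unfold zz
    rw [hhd]
    norm_num

theorem IsSol.sh_PP {σ : ℝ → ℝ × ℝ × ℝ} (h : IsSol PP σ) (k : ℤ) :
    IsSol PP fun t => sh (3 * k) (σ t) := by
  intro t
  simp only [PP_sh]
  exact hasDerivAt_sh _ (h t)

/-- A periodic trajectory crosses the boundary of the plug. -/
theorem IsCurve.exists_EvP (hγ : IsCurve γ) {T : ℝ} (hT : 0 < T) (hper : ∀ t, γ (t + T) = γ t) :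
    ∃ t, EvP (γ t) := by
  by_contra hev
  push Not at hev
  by_cases hW : ∃ τ x, ps x = γ τ ∧ Wt x
  · obtain ⟨τ, x, hx, hW⟩ := hW
    obtain ⟨σ, rfl, hσ⟩ := exists_isSol_PP τ x
    set b := τ + 2 * T + 7 with hb
    have hτ : τ ∈ Ioo (τ - 1) b := ⟨by linarith, by linarith⟩
    have hp := hγ.persist (a := τ - 1) (b := b) hσ (fun u _ => hev u) hτ hx.symm hW
    obtain ⟨-, ρ, hρ, hL⟩ := hγ.inside (a := τ - 1) (b := b) hσ (fun u _ => hev u) hτ hx.symm hW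
    have hWG : ∀ {v}, Wt v → GG v := fun h => ⟨h.1.le, h.2.1.le⟩
    obtain ⟨e1, W1, -⟩ := hp (τ + T) ⟨by linarith, by linarith⟩
    obtain ⟨k, hk⟩ := ps_inj (hWG hW).box (hWG W1).box (by rw [hx, ← e1, hper])
    have hshift : ∀ u, σ (u + T) = sh (3 * k) (σ u) := fun u =>
      congrFun (IsSol.unique contDiff_one_PP (hσ.comp_add T) (hσ.sh_PP k) (t₀ := τ) hk) u
    have h2 : σ (τ + 2 * T) = sh (6 * k) (σ τ) := by
      rw [show τ + 2 * T = τ + T + T by ring, hshift, hshift, sh_sh]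
      congr 1; ring
    have h3 : ρ (τ + 2 * T) = sh (6 * k) (ρ τ) := by
      rw [← hL _ ⟨by linarith, by linarith⟩, ← hL τ ⟨by linarith, by linarith⟩, h2, Lam_sh]
    obtain ⟨hr, hz⟩ := hρ.closed (by linarith) h3
    have hcirc := hρ.eq_circle hr hz
    obtain ⟨x, z, u, j, hxz, hu1, hu2, hu3⟩ : ∃ (x z u : ℝ) (j : ℤ), (x = 1 ∧ z = -1 ∨
        x = 2 ∧ z = 1) ∧ τ < u ∧ u < τ + 7 ∧ ρ u = sh (6 * j) (x, 0, z) := by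
      rcases hz with hz | hz
      · obtain ⟨j, hj1, hj2⟩ := exists_window (1 - (ρ τ).1)
        refine ⟨1, -1, τ + (1 - (ρ τ).1 + 6 * j), j, Or.inl ⟨rfl, rfl⟩, by linarith, by linarith, ?_⟩
        rw [hcirc, hz]
        refine Prod.ext ?_ (Prod.ext hr hz)
        simp only [sh_fst]; ring
      · obtain ⟨j, hj1, hj2⟩ := exists_window ((ρ τ).1 - 2)
        refine ⟨2, 1, τ + ((ρ τ).1 - 2 + 6 * j), -j, Or.inr ⟨rfl, rfl⟩, by linarith, by linarith, ?_⟩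
        rw [hcirc, hz]
        refine Prod.ext ?_ (Prod.ext hr hz)
        simp only [sh_fst]; push_cast; ring
    obtain ⟨-, W2, -⟩ := hp u ⟨by linarith, by linarith⟩
    rw [← hL u ⟨by linarith, by linarith⟩] at hu3
    have h4 : Lam (sh (6 * ((-j : ℤ) : ℝ)) (σ u)) = (x, 0, z) := by
      rw [Lam_sh, hu3, sh_sh]
      simp [sh]
    have h5 := eq_of_Lam_eq ((GG_sh _ _).2 (hWG W2)) h4 (hxz.imp And.left And.left)
    exact W2.2.2 ((Nest_sh _ (-j)).1 (h5 ▸ nest_circle hxz))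
  · push Not at hW
    have hD := hγ.eq_DD isOpen_univ isPreconnected_univ
      (fun u _ => XX_eq_X0_of_outside fun v hv => hW u v hv) (mem_univ 0)
    have hTc : DD T (γ 0) = γ 0 := by
      have := hD T (mem_univ T)
      rw [sub_zero] at this
      rw [← this]
      simpa using hper 0
    obtain ⟨t, x, hx, hps⟩ := exists_DD_eq (hγ.norm_eq 0) (DD_closed hT hTc)
    have h1 : Lam (x, 0, -2) = (x, 0, -2) := Lam_eq_self hx
    have hr : rr (x, 0, -2) = 0 := congrArg (fun w => w.2.1) h1
    have hz : zz (x, 0, -2) = -2 := congrArg (fun w => w.2.2) h1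
    refine hev t ⟨(x, 0, -2), ⟨by rw [hr]; norm_num, by rw [hz]; norm_num⟩, ?_⟩
    rw [← hps, hD t (mem_univ t), sub_zero]

/-- The vector field has no periodic orbit. -/
theorem IsCurve.not_periodic (hγ : IsCurve γ) {T : ℝ} (hT : 0 < T)
    (hper : ∀ t, γ (t + T) = γ t) : False := by
  obtain ⟨e, n, hn, he, heS, hgap, hshift⟩ := exists_enumeration (S := {t | EvP (γ t)})
    (hγ.exists_EvP hT hper) hγ.eventually_not_EvP hT (fun t => by simp only [mem_ofPred_eq, hper])
  have hex : ∀ p, ∃ v, EvP p → Ev v ∧ ps v = p := by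
    intro p
    by_cases h : EvP p
    · obtain ⟨v, hv⟩ := h
      exact ⟨v, fun _ => hv⟩
    · exact ⟨0, fun h' => absurd h' h⟩
  choose lift hlift using hex
  let v : ℤ → ℝ × ℝ × ℝ := fun k => lift (γ (e k))
  have hv : ∀ k, Ev (v k) := fun k => (hlift _ (heS k)).1
  have hvs : ∀ k, ps (v k) = γ (e k) := fun k => (hlift _ (heS k)).2
  have hvn : ∀ k, v (k + n) = v k := fun k => by simp only [v, hshift, hper]
  have harc : ∀ k, Rch (startY (v k)) (endY (v (k + 1))) := fun k =>
    hγ.arc (he (lt_add_one k)) (hgap k) (hv k) (hvs k) (hv (k + 1)) (hvs (k + 1))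
  have hz2 : ∀ {k}, ¬ zz (v k) = -2 → zz (v k) = 2 := fun {k} h => (hv k).cases.resolve_left h
  have data : CrossingData Rch (fun k => zz (v k) = -2) (fun k => .inl (Lam (v k)))
      (fun k => outY (v k)) (fun k => rr (v k)) := by
    refine ⟨Rch.trans, fun k h1 h2 => ?_, fun k h1 h2 => ?_, fun k h1 h2 => ?_,
      fun k h1 h2 => ?_, fun k l h1 h2 h => ?_, fun k l h1 h2 h => ?_, fun k l h1 h2 h => ?_,
      fun k l h1 h2 h h' => ?_⟩
    · simpa only [startY, endY, if_pos h1, if_pos h2] using harc k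
    · simpa only [startY, endY, if_pos h1, if_neg h2] using harc k
    · simpa only [startY, endY, if_neg h1, if_pos h2] using harc k
    · simpa only [startY, endY, if_neg h1, if_neg h2] using harc k
    · exact Rch.match_ends (hv k) h1 (hv l) (hz2 h2) h
    · exact Rch.rad_lt (hv l) (hv k).2 h
    · exact Rch.rad_lt' (hv k) (hv l).2 h
    · exact Rch.no_cycle (hv k) h1 (hv l) (hz2 h2) h h'
  exact data.not_periodic hn (fun k => by simp only [hvn]) (fun k => by simp only [hvn])
    (fun k => by simp only [hvn])

end Kuperberg

open Metric Manifold

/-- **Kuperberg's counterexample to the Seifert Conjecture.**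
There exists a smooth nonvanishing vector field on the 3-sphere `S³ ⊆ ℝ⁴`
(presented extrinsically, i.e. tangent to the sphere) with no periodic orbit. -/
theorem kuperberg_seifert_counterexample_sphere :
    ∃ X : sphere (0 : EuclideanSpace ℝ (Fin 4)) 1 → EuclideanSpace ℝ (Fin 4),
      ContMDiff (𝓡 3) 𝓘(ℝ, EuclideanSpace ℝ (Fin 4)) (⊤ : ℕ∞) X ∧
      (∀ p : sphere (0 : EuclideanSpace ℝ (Fin 4)) 1,
        inner ℝ (X p) (p : EuclideanSpace ℝ (Fin 4)) = (0 : ℝ)) ∧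
      (∀ p : sphere (0 : EuclideanSpace ℝ (Fin 4)) 1, X p ≠ 0) ∧
      ¬ ∃ (γ : ℝ → EuclideanSpace ℝ (Fin 4))
          (hγ : ∀ t : ℝ, γ t ∈ sphere (0 : EuclideanSpace ℝ (Fin 4)) 1),
          (∀ t : ℝ, HasDerivAt γ (X ⟨γ t, hγ t⟩) t) ∧
          (∃ s t : ℝ, γ s ≠ γ t) ∧
          (∃ T : ℝ, 0 < T ∧ ∀ t : ℝ, γ (t + T) = γ t) := by
  refine ⟨fun p => Kuperberg.XX p, Kuperberg.contMDiff_XX, fun p => Kuperberg.inner_XX p,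
    fun p => Kuperberg.XX_ne_zero (by simp), ?_⟩
  rintro ⟨γ, hγ, hd, -, T, hT, hper⟩
  have hc : Kuperberg.IsCurve γ := ⟨fun t => by simpa using hγ t, hd⟩
  exact hc.not_periodic hT hper
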